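/- Let p be an odd prime, s a positive integer, q = p^{2s}, and let h ≥ 3 be a positive divisor of q + 2p^{s}. Then for all integers t, m with 1 ≤ t < m ≤ (q + 2p^{s} − h)/(2h) − 1, there exists an optimal (2h−2, 3)-LRC over F_q with parameters [2hm, (2h−2)t + 1, 2h(m−t)]_q, and there exists an optimal (2, 2h−1)-LRC over F_q with parameters [2hm, 2t + 1, 2h(m−t)]_q. -/

import Mathlib

/-- The Hamming weight of a vector: the number of nonzero coordinates. -/
def hammingWt {F : Type*} [Zero F] [DecidableEq F] {n : ℕ} (v : Fin n → F) : ℕ :=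
  (Finset.univ.filter (fun i => v i ≠ 0)).card

/-- The minimum distance of the linear code `C` is at least `d`. -/
def MinDistGe {F : Type*} [Field F] [DecidableEq F] {n : ℕ}
    (C : Submodule F (Fin n → F)) (d : ℕ) : Prop :=
  ∀ c ∈ C, c ≠ 0 → d ≤ hammingWt c

/-- The minimum distance of the linear code `C` is exactly `d`. -/
def MinDistEq {F : Type*} [Field F] [DecidableEq F] {n : ℕ}
    (C : Submodule F (Fin n → F)) (d : ℕ) : Prop :=
  MinDistGe C d ∧ ∃ c ∈ C, c ≠ 0 ∧ hammingWt c = d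

/-- `C` is an `(r, δ)`-locally repairable code: every coordinate `i` has a repair
group `R` containing `i`, of size at most `r + δ - 1`, such that the punctured code
`C|_R` has minimum distance at least `δ` (i.e. every codeword whose restriction to
`R` is nonzero has at least `δ` nonzero coordinates inside `R`). -/
def IsLRC {F : Type*} [Field F] [DecidableEq F] {n : ℕ}
    (C : Submodule F (Fin n → F)) (r δ : ℕ) : Prop :=
  ∀ i : Fin n, ∃ R : Finset (Fin n), i ∈ R ∧ R.card ≤ r + δ - 1 ∧
    ∀ c ∈ C, (∃ j ∈ R, c j ≠ 0) → δ ≤ (R.filter (fun j => c j ≠ 0)).card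

/-- The parameters `[n, k, d]` attain the Singleton-type bound for `(r, δ)`-LRCs:
`d = n - k + 1 - (⌈k/r⌉ - 1)(δ - 1)`  (here `⌈k/r⌉ = (k + r - 1)/r`). -/
def SingletonOptimal (n k d r δ : ℕ) : Prop :=
  (d : ℤ) = (n : ℤ) - (k : ℤ) + 1 - ((((k + r - 1) / r : ℕ) : ℤ) - 1) * ((δ : ℤ) - 1)

/-- There exists an optimal `(r, δ)`-LRC over `F` with parameters `[n, k, d]`. -/
def ExistsOptimalLRC (F : Type*) [Field F] [DecidableEq F] (n k d r δ : ℕ) : Prop :=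
  ∃ C : Submodule F (Fin n → F),
    Module.finrank F C = k ∧ MinDistEq C d ∧ IsLRC C r δ ∧ SingletonOptimal n k d r δ

section Part1

theorem generic_lrc {F : Type*} [Field F] [DecidableEq F] (h t m r δ : ℕ)
    {M : Type*} [AddCommGroup M] [Module F M]
    {ι : Type*} [Fintype ι] (hι : Fintype.card ι = 2 * h)
    (E : M →ₗ[F] (Fin m × ι → F)) (hk : Module.finrank F M = r * t + 1)
    (hz : ∀ v, v ≠ 0 → (Finset.univ.filter (fun p => E v p = 0)).card ≤ 2 * h * t)
    (hex : ∃ v, v ≠ 0 ∧ (Finset.univ.filter (fun p => E v p = 0)).card = 2 * h * t)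
    (loc : ∀ v j, (∃ i, E v (j, i) ≠ 0) →
      δ ≤ (Finset.univ.filter (fun i => E v (j, i) ≠ 0)).card)
    (hr : 1 ≤ r) (hδ : 1 ≤ δ) (hrd : r + δ - 1 = 2 * h) (htm : t < m) :
    ExistsOptimalLRC F (2 * h * m) (r * t + 1) (2 * h * (m - t)) r δ := by
  classical
  have hh : 0 < 2 * h := by omega
  have hcard : Fintype.card (Fin m × ι) = 2 * h * m := by
    rw [Fintype.card_prod, hι, Fintype.card_fin]; ring
  let e : Fin (2 * h * m) ≃ Fin m × ι := (Fintype.equivFinOfCardEq hcard).symm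
  let E' : M →ₗ[F] (Fin (2 * h * m) → F) := (LinearMap.funLeft F F e).comp E
  have hE' : ∀ v i, E' v i = E v (e i) := fun v i => rfl
  have hsplit : ∀ v, (Finset.univ.filter (fun p => E v p = 0)).card
      + (Finset.univ.filter (fun p => E v p ≠ 0)).card = 2 * h * m := by
    intro v
    rw [Finset.card_filter_add_card_filter_not, Finset.card_univ, hcard]
  have hwt : ∀ v, hammingWt (E' v) = (Finset.univ.filter (fun p => E v p ≠ 0)).card := by
    intro v
    unfold hammingWt
    apply Finset.card_bij (fun i _ => e i)
    · intro a ha; simpa [hE'] using ha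
    · intro a _ b _ hab; exact e.injective hab
    · intro b hb; exact ⟨e.symm b, by simpa [hE'] using hb, by simp⟩
  have hmul : 2 * h * (m - t) + 2 * h * t = 2 * h * m := by
    rw [← mul_add]; congr 1; omega
  have hpos : 0 < 2 * h * (m - t) := Nat.mul_pos hh (by omega)
  have hinj : Function.Injective E' := by
    rw [injective_iff_map_eq_zero]
    intro v hv
    by_contra hv0
    have h1 := hz v hv0
    have h2 := hsplit v
    have h3 := hwt v
    rw [hv] at h3
    have : hammingWt (0 : Fin (2 * h * m) → F) = 0 := by simp [hammingWt]
    omega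
  refine ⟨LinearMap.range E', ?_, ⟨?_, ?_⟩, ?_, ?_⟩
  · rw [LinearMap.finrank_range_of_inj hinj, hk]
  · rintro c ⟨v, rfl⟩ hc
    have hv : v ≠ 0 := by rintro rfl; simp at hc
    have h1 := hz v hv
    have h2 := hsplit v
    have h3 := hwt v
    omega
  · obtain ⟨v, hv, hv'⟩ := hex
    refine ⟨E' v, ⟨v, rfl⟩, ?_, ?_⟩
    · intro hc; exact hv (hinj (by simpa using hc))
    · have h2 := hsplit v
      have h3 := hwt v
      omega
  · intro i
    refine ⟨Finset.univ.filter (fun k => (e k).1 = (e i).1), by simp, ?_, ?_⟩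
    · rw [hrd]
      refine le_of_le_of_eq ?_ ((Finset.card_univ).trans hι)
      apply Finset.card_le_card_of_injOn (fun k => (e k).2) (by simp)
      intro a ha b hb hab
      simp at ha hb hab
      exact e.injective (Prod.ext (ha.trans hb.symm) hab)
    · rintro c ⟨v, rfl⟩ ⟨k, hk1, hk2⟩
      simp at hk1
      refine (loc v (e i).1 ⟨(e k).2, ?_⟩).trans ?_
      · rw [hE'] at hk2; rw [← hk1]; exact hk2
      · apply Finset.card_le_card_of_injOn (fun l => e.symm ((e i).1, l))
        · intro l hl
          simp at hl
          simp [hE', hl]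
        · intro a _ b _ hab
          simpa using hab
  · unfold SingletonOptimal
    have h1 : (r * t + 1 + r - 1) / r = t + 1 := by
      have : r * t + 1 + r - 1 = r * (t + 1) := by rw [mul_add]; omega
      rw [this, Nat.mul_div_cancel_left _ (by omega)]
    rw [h1]
    have h2 : ((2 * h * m : ℕ) : ℤ) = (2 * h * (m - t) : ℕ) + (2 * h * t : ℕ) := by
      exact_mod_cast hmul.symm
    have h3 : (2 * h * t : ℕ) = (r + δ - 1) * t := by rw [hrd]
    have h4 : ((r + δ - 1 : ℕ) : ℤ) = r + δ - 1 := by omega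
    rw [h2, h3]
    push_cast [h4]
    ring

end Part1

section Part2
open Polynomial

theorem exists_sq_distinct {F : Type*} [Field F] [Fintype F] [DecidableEq F] (m : ℕ)
    (hm : 2 * m ≤ Fintype.card F - 1) :
    ∃ x : Fin m → F, (∀ j, x j ≠ 0) ∧ ∀ i j, (x i) ^ 2 = (x j) ^ 2 → i = j := by
  classical
  let S : Finset F := Finset.univ.erase 0
  have hS : S.card = Fintype.card F - 1 := by
    simp [S, Finset.card_erase_of_mem]
  have h1 : S.card ≤ 2 * (S.image (fun x => x ^ 2)).card := by
    apply Finset.card_le_mul_card_image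
    intro a ha
    obtain ⟨b, hb, rfl⟩ := Finset.mem_image.1 ha
    refine (Finset.card_le_card (t := {b, -b}) ?_).trans Finset.card_le_two
    intro c hc
    simp only [Finset.mem_filter] at hc
    simpa using sq_eq_sq_iff_eq_or_eq_neg.1 hc.2
  have h2 : m ≤ (S.image (fun x => x ^ 2)).card := by omega
  obtain ⟨T, hT, hTc⟩ := Finset.exists_subset_card_eq h2
  have hx : ∀ j : Fin m, ∃ x : F, x ∈ S ∧ x ^ 2 = (T.equivFinOfCardEq hTc).symm j := by
    intro j
    exact Finset.mem_image.1 (hT ((T.equivFinOfCardEq hTc).symm j).2)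
  choose x hx1 hx2 using hx
  refine ⟨x, fun j => Finset.ne_of_mem_erase (hx1 j), fun i j hij => ?_⟩
  rw [hx2, hx2] at hij
  simpa using Subtype.ext hij

def bsgn {F : Type*} [Field F] (b : Bool) : F := if b then 1 else -1

theorem bsgn_inj {F : Type*} [Field F] (h2 : (2 : F) ≠ 0) {x : F} (hx : x ≠ 0) {b c : Bool}
    (h : bsgn b * x = bsgn c * x) : b = c := by
  have : (bsgn b : F) = bsgn c := mul_right_cancel₀ hx h
  have h3 : (1 : F) ≠ -1 := by
    intro h; apply h2; linear_combination h
  cases b <;> cases c <;> simp [bsgn] at this ⊢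
  · exact h3 this.symm
  · exact h3 this

theorem bsgn_sq {F : Type*} [Field F] (b : Bool) : (bsgn b : F) ^ 2 = 1 := by
  cases b <;> simp [bsgn]

theorem second_code {F : Type*} [Field F] [Fintype F] [DecidableEq F] (h2 : (2 : F) ≠ 0)
    (h t m : ℕ) (hh : 1 ≤ h) (htm : t < m) (ht : 1 ≤ t)
    (hm : 2 * m ≤ Fintype.card F - 1) (hhq : 2 * h ≤ Fintype.card F - 1) :
    ExistsOptimalLRC F (2 * h * m) (2 * t + 1) (2 * h * (m - t)) 2 (2 * h - 1) := by
  classical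
  obtain ⟨x, hx0, hx⟩ := exists_sq_distinct (F := F) m hm
  obtain ⟨β, hβ0, hβ⟩ := exists_sq_distinct (F := F) h hhq
  let M := (degreeLT F (t + 1)) × (degreeLT F t)
  let E : M →ₗ[F] (Fin m × (Fin h × Bool) → F) :=
    LinearMap.pi fun p =>
      ((leval (x p.1 ^ 2)).comp ((degreeLT F (t + 1)).subtype)).comp (LinearMap.fst F _ _)
      + (bsgn p.2.2 * β p.2.1 * x p.1) •
        ((leval (x p.1 ^ 2)).comp ((degreeLT F t).subtype)).comp (LinearMap.snd F _ _)
  have hE : ∀ (v : M) p, E v p = (v.1 : F[X]).eval (x p.1 ^ 2)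
      + (bsgn p.2.2 * β p.2.1 * x p.1) * (v.2 : F[X]).eval (x p.1 ^ 2) := by
    intro v p
    simp [E, leval]
    rfl
  have hcι : Fintype.card (Fin h × Bool) = 2 * h := by simp [mul_comm]
  apply generic_lrc (M := M) h t m 2 (2 * h - 1) hcι E
  · rw [Module.finrank_prod, (degreeLTEquiv F _).finrank_eq, (degreeLTEquiv F _).finrank_eq]
    simp; omega
  · intro v hv
    -- polynomial for each i
    let P : Fin h → F[X] := fun i => expand F 2 (v.1 : F[X]) + C (β i) * (X * expand F 2 (v.2 : F[X]))
    have hP : ∀ i, P i ≠ 0 := by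
      intro i hi
      apply hv
      have c0 : ∀ n, (v.1 : F[X]).coeff n = 0 := by
        intro n
        have := congrArg (fun p => coeff p (2 * n)) hi
        simp only [P, coeff_add, coeff_C_mul, coeff_zero] at this
        rw [coeff_expand_mul' (by norm_num)] at this
        rcases n with _ | n
        · simpa using this
        · rw [show 2 * (n + 1) = (2 * n + 1) + 1 by ring, coeff_X_mul, coeff_expand (by norm_num),
            if_neg (by omega)] at this
          simpa using this
      have c1 : ∀ n, (v.2 : F[X]).coeff n = 0 := by
        intro n
        have := congrArg (fun p => coeff p (2 * n + 1)) hi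
        simp only [P, coeff_add, coeff_C_mul, coeff_zero] at this
        rw [coeff_X_mul, coeff_expand_mul' (by norm_num), coeff_expand (by norm_num),
            if_neg (by omega)] at this
        simpa [hβ0] using this
      refine Prod.ext (Subtype.ext (Polynomial.ext ?_)) (Subtype.ext (Polynomial.ext ?_))
      · simpa using c0
      · simpa using c1
    have hPd : ∀ i, (P i).natDegree ≤ 2 * t := by
      intro i
      refine (natDegree_add_le _ _).trans (max_le ?_ ?_)
      · rw [natDegree_expand]
        have := v.1.2
        rw [mem_degreeLT] at this
        by_cases hA : (v.1 : F[X]) = 0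
        · simp [hA]
        have := (natDegree_lt_iff_degree_lt hA).2 this
        omega
      · refine (natDegree_C_mul_le _ _).trans ?_
        by_cases hB : (v.2 : F[X]) = 0
        · simp [hB]
        refine (natDegree_mul_le).trans ?_
        rw [natDegree_expand, natDegree_X]
        have := v.2.2
        rw [mem_degreeLT, degree_eq_natDegree hB] at this
        have : (v.2 : F[X]).natDegree < t := by exact_mod_cast this
        omega
    have hval : ∀ p, E v p = (P p.2.1).eval (bsgn p.2.2 * x p.1) := by
      intro p
      rw [hE]
      simp only [P, eval_add, eval_mul, eval_C, eval_X, expand_eval, mul_pow, bsgn_sq, one_mul]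
      ring
    have := Finset.card_eq_sum_card_fiberwise (s := Finset.univ.filter (fun p => E v p = 0))
      (t := (Finset.univ : Finset (Fin h))) (f := fun p => p.2.1) (by intro; simp)
    rw [this]
    have hle : ∀ i ∈ (Finset.univ : Finset (Fin h)),
      ((Finset.univ.filter (fun p => E v p = 0)).filter (fun p => p.2.1 = i)).card ≤ 2 * t := by
      intro i _
      refine le_trans ?_ ((P i).card_roots'.trans (hPd i))
      refine le_trans ?_ (Multiset.toFinset_card_le _)
      apply Finset.card_le_card_of_injOn (fun p => bsgn p.2.2 * x p.1)
      · rintro ⟨j, i', b⟩ hp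
        simp only [Finset.coe_filter, Finset.mem_filter, Finset.mem_univ, true_and, Set.mem_ofPred_eq, hval] at hp
        obtain ⟨hp, rfl⟩ := hp
        simp [hP, hp]
      · rintro ⟨j, i1, b⟩ hp ⟨j', i2, b'⟩ hp' hab
        simp only [Finset.coe_filter, Finset.mem_filter, Set.mem_ofPred_eq] at hp hp' hab
        obtain ⟨_, rfl⟩ := hp
        obtain ⟨_, rfl⟩ := hp'
        have hsq := congrArg (fun z => z ^ 2) hab
        simp only [mul_pow, bsgn_sq, one_mul] at hsq
        obtain rfl := hx _ _ hsq
        rw [bsgn_inj h2 (hx0 j) hab]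
    refine (Finset.sum_le_sum hle).trans ?_
    simp; apply le_of_eq; ring
  · let J : Finset (Fin m) := Finset.univ.filter (fun j => j.val < t)
    have hJ : J.card = t := by
      have := Fin.card_filter_val_lt (n := m) (m := t)
      simp only [J]; rw [this]; omega
    let A : F[X] := ∏ j ∈ J, (X - C (x j ^ 2))
    have hAm : A.Monic := monic_prod_of_monic _ _ (fun j _ => monic_X_sub_C _)
    have hAd : A ∈ degreeLT F (t + 1) := by
      rw [mem_degreeLT, degree_eq_natDegree hAm.ne_zero]
      have : A.natDegree = t := by
        simp only [A]; rw [natDegree_prod_of_monic _ _ (fun j _ => monic_X_sub_C _)]; simp [-map_pow, hJ]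
      rw [this]; exact_mod_cast Nat.lt_succ_self t
    refine ⟨(⟨A, hAd⟩, 0), ?_, ?_⟩
    · intro h0
      have := congrArg (fun v : M => (v.1 : F[X])) h0
      exact hAm.ne_zero (by simpa using this)
    · have : (Finset.univ.filter (fun p => E ((⟨A, hAd⟩, 0) : M) p = 0)) = J ×ˢ Finset.univ := by
        ext ⟨j, i⟩
        simp only [Finset.mem_filter, Finset.mem_univ, true_and, hE, Finset.mem_product, and_true]
        simp only [A, Submodule.coe_zero, eval_zero, mul_zero, add_zero, eval_prod,
          Finset.prod_eq_zero_iff, eval_sub, eval_X, eval_C]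
        constructor
        · rintro ⟨k, hk, hk'⟩
          rwa [hx _ _ (sub_eq_zero.1 hk')]
        · intro hj; exact ⟨j, hj, by simp⟩
      rw [this, Finset.card_product, hJ, Finset.card_univ, hcι]; ring
  · rintro v j ⟨i0, hi0⟩
    have hsplit := Finset.card_filter_add_card_filter_not (s := (Finset.univ : Finset (Fin h × Bool)))
      (fun i => E v (j, i) = 0)
    rw [Finset.card_univ, hcι] at hsplit
    have : (Finset.univ.filter (fun i => E v (j, i) = 0)).card ≤ 1 := by
      rw [Finset.card_le_one]
      rintro ⟨i, b⟩ hi ⟨i', b'⟩ hi'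
      simp only [Finset.mem_filter, Finset.mem_univ, true_and, hE] at hi hi'
      by_contra hne
      have hb : (v.2 : F[X]).eval (x j ^ 2) = 0 := by
        by_contra hb
        have h3 : (bsgn b * β i * x j - bsgn b' * β i' * x j) * (v.2 : F[X]).eval (x j ^ 2) = 0 := by
          linear_combination hi - hi'
        have h4 := (mul_eq_zero.1 h3).resolve_right hb
        have h5 : bsgn b * β i = bsgn b' * β i' :=
          mul_right_cancel₀ (hx0 j) (by linear_combination h4)
        have hsq := congrArg (fun z => z ^ 2) h5
        simp only [mul_pow, bsgn_sq, one_mul] at hsq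
        obtain rfl := hβ _ _ hsq
        exact hne (by rw [bsgn_inj h2 (hβ0 i) h5])
      rw [hb] at hi
      apply hi0
      rw [hE, hb]
      simpa using hi
    simp only [ne_eq]
    omega
  · norm_num
  · omega
  · omega
  · exact htm

end Part2

section Part3
open Polynomial WeierstrassCurve

set_option linter.all false
section ZeroLemma
variable {F : Type*} [Field F] [DecidableEq F] {W : WeierstrassCurve.Affine F}

noncomputable def evA {x y : F} (h : W.Equation x y) : W.CoordinateRing →+* F :=
  AdjoinRoot.evalEval h

theorem evA_smul {x y : F} (h : W.Equation x y) (a b : F[X]) :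
    evA h (a • 1 + b • Affine.CoordinateRing.mk W X) = a.eval x + b.eval x * y := by
  have : (a • 1 + b • Affine.CoordinateRing.mk W X : W.CoordinateRing)
      = Affine.CoordinateRing.mk W (C a + C b * X) := by
    rw [Affine.CoordinateRing.smul, Affine.CoordinateRing.smul]; simp
  rw [this, evA]
  refine (AdjoinRoot.evalEval_mk h _).trans ?_
  simp [evalEval]

theorem evA_algebraMap {x y : F} (h : W.Equation x y) (a : F) :
    evA h (algebraMap F W.CoordinateRing a) = a := by
  have := evA_smul h (C a) 0
  simp only [zero_smul, add_zero, eval_C, eval_zero, zero_mul] at this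
  have h3 : algebraMap F W.CoordinateRing a = C a • 1 := by
    rw [Algebra.algebraMap_eq_smul_one, ← algebraMap_smul F[X] a (1 : W.CoordinateRing)]; rfl
  rw [h3, this]

theorem evA_surj {x y : F} (h : W.Equation x y) : Function.Surjective (evA h) :=
  fun a => ⟨_, evA_algebraMap h a⟩

theorem ker_evA {x y : F} (h : W.Equation x y) :
    RingHom.ker (evA h) = Affine.CoordinateRing.XYIdeal W x (C y) := by
  have hmax : (Affine.CoordinateRing.XYIdeal W x (C y)).IsMaximal := by
    apply Ideal.Quotient.maximal_of_isField
    exact (Affine.CoordinateRing.quotientXYIdealEquiv (W' := W) (x := x) (y := C y) h).toMulEquiv.isField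
      (Field.toIsField F)
  symm
  apply hmax.eq_of_le (RingHom.ker_ne_top _)
  rw [Affine.CoordinateRing.XYIdeal, Ideal.span_le]
  rintro z (rfl | rfl)
  · change evA h _ = 0
    have := evA_smul h (X - C x) 0
    simp at this
    rw [← this]; congr 1
    rw [Affine.CoordinateRing.smul]; simp [Affine.CoordinateRing.XClass]
  · change evA h _ = 0
    have := evA_smul h (-C y) 1
    simp at this
    rw [← this]; congr 1
    rw [Affine.CoordinateRing.smul]; simp [Affine.CoordinateRing.YClass]; ring

variable {ι : Type*} [Fintype ι] {x y : ι → F}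

theorem isCoprime_XY (hns : ∀ i, W.Equation (x i) (y i))
    (hinj : ∀ i j, x i = x j → y i = y j → i = j) {i j : ι} (hij : i ≠ j) :
    IsCoprime (RingHom.ker (evA (hns i))) (RingHom.ker (evA (hns j))) := by
  rw [Ideal.isCoprime_iff_sup_eq]
  have hmi : (RingHom.ker (evA (hns i))).IsMaximal :=
    RingHom.ker_isMaximal_of_surjective _ (evA_surj _)
  have hmj : (RingHom.ker (evA (hns j))).IsMaximal :=
    RingHom.ker_isMaximal_of_surjective _ (evA_surj _)
  apply Ideal.IsMaximal.coprime_of_ne hmi hmj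
  intro h
  apply hij
  apply hinj
  · have h1 : ((X - C (x i)) • 1 + (0 : F[X]) • Affine.CoordinateRing.mk W X) ∈ RingHom.ker (evA (hns i)) := by
      rw [RingHom.mem_ker, evA_smul]; simp
    rw [h, RingHom.mem_ker, evA_smul] at h1
    simp at h1
    linear_combination -h1
  · have h1 : ((-C (y i)) • 1 + (1 : F[X]) • Affine.CoordinateRing.mk W X) ∈ RingHom.ker (evA (hns i)) := by
      rw [RingHom.mem_ker, evA_smul]; simp
    rw [h, RingHom.mem_ker, evA_smul] at h1
    simp at h1
    linear_combination -h1

theorem zero_lemma (hns : ∀ i, W.Nonsingular (x i) (y i))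
    (hinj : ∀ i j, x i = x j → y i = y j → i = j)
    {f : W.CoordinateRing} (hf : f ≠ 0) (hz : ∀ i, evA (hns i).1 f = 0) :
    Fintype.card ι ≤ (Algebra.norm F[X] f).natDegree ∧
    (Fintype.card ι = (Algebra.norm F[X] f).natDegree →
      ∑ i, Affine.Point.some _ _ (hns i) = 0) := by
  classical
  by_cases hemp : IsEmpty ι
  · constructor
    · simp
    · intro _; simp
  rw [not_isEmpty_iff] at hemp
  have hfr := finrank_quotient_span_eq_natDegree_norm (Affine.CoordinateRing.basis W) hf
  have hnpos : 0 < (Algebra.norm F[X] f).natDegree := by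
    obtain ⟨i⟩ := hemp
    obtain ⟨a, b, hab⟩ := Affine.CoordinateRing.exists_smul_basis_eq f
    have hne : Algebra.norm F[X] f ≠ 0 := (Algebra.norm_ne_zero_iff_of_basis (Affine.CoordinateRing.basis W)).2 hf
    have h2 : (Algebra.norm F[X] f).eval (x i) = 0 := by
      have h6 := hz i
      rw [← hab, evA_smul] at h6
      have h7 := (Affine.equation_iff _ _).1 (hns i).1
      rw [← hab, Affine.CoordinateRing.norm_smul_basis]
      simp only [eval_sub, eval_mul, eval_pow, eval_add, eval_C, eval_X]
      linear_combination (a.eval (x i) - b.eval (x i) * y i - b.eval (x i) * (W.a₁ * x i + W.a₃)) * h6 + b.eval (x i) ^ 2 * h7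
    by_contra h0
    have h0 : (Algebra.norm F[X] f).natDegree = 0 := by omega
    rw [eq_C_of_natDegree_eq_zero h0] at h2 hne
    simp at h2
    simp [h2] at hne
  have hfin : Module.Finite F (W.CoordinateRing ⧸ Ideal.span ({f} : Set W.CoordinateRing)) := by
    apply Module.finite_of_finrank_pos
    rw [hfr]; exact hnpos
  let ev : ∀ i, W.CoordinateRing →ₐ[F] F := fun i =>
    { evA (hns i).1 with commutes' := fun a => evA_algebraMap _ a }
  have hev : ∀ i r, ev i r = evA (hns i).1 r := fun i r => rfl
  let Φ : W.CoordinateRing →ₐ[F] (ι → F) := AlgHom.pi ev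
  have hΦs : Function.Surjective Φ := by
    intro v
    have hcop : Pairwise (Function.onFun IsCoprime (fun i => RingHom.ker (evA (hns i).1))) :=
      fun i j hij => isCoprime_XY (fun i => (hns i).1) hinj hij
    obtain ⟨r, hr⟩ := Ideal.exists_forall_sub_mem_ideal hcop (fun i => algebraMap F W.CoordinateRing (v i))
    refine ⟨r, funext fun i => ?_⟩
    have := hr i
    rw [RingHom.mem_ker, map_sub, evA_algebraMap, sub_eq_zero] at this
    exact this
  have hker : ∀ a ∈ Ideal.span ({f} : Set W.CoordinateRing), Φ a = 0 := by
    intro a ha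
    obtain ⟨c, rfl⟩ := Ideal.mem_span_singleton'.1 ha
    rw [map_mul]
    have : Φ f = 0 := funext fun i => hz i
    rw [this, mul_zero]
  let Ψ := Ideal.Quotient.liftₐ (Ideal.span ({f} : Set W.CoordinateRing)) Φ hker
  have hΨs : Function.Surjective Ψ := Ideal.Quotient.lift_surjective_of_surjective _ hker hΦs
  constructor
  · rw [← hfr, ← Module.finrank_fintype_fun_eq_card F]
    exact LinearMap.finrank_le_finrank_of_surjective (f := Ψ.toLinearMap) hΨs
  · intro heq
    have hinjΨ : Function.Injective Ψ.toLinearMap := by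
      rw [LinearMap.injective_iff_surjective_of_finrank_eq_finrank]
      · exact hΨs
      · rw [hfr, Module.finrank_fintype_fun_eq_card, heq]
    have hspan : Ideal.span ({f} : Set W.CoordinateRing) = ⨅ i ∈ (Finset.univ : Finset ι), Affine.CoordinateRing.XYIdeal W (x i) (C (y i)) := by
      ext a
      simp only [Finset.mem_univ, iInf_pos, Submodule.mem_iInf]
      constructor
      · intro ha i
        rw [← ker_evA (hns i).1]
        exact congrFun (hker a ha) i
      · intro ha
        rw [← Ideal.Quotient.eq_zero_iff_mem]
        apply hinjΨ
        rw [map_zero]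
        change Φ a = 0
        funext i
        have := ha i
        rw [← ker_evA (hns i).1] at this
        exact this
    rw [← Ideal.prod_eq_iInf_of_pairwise_isCoprime] at hspan
    · rw [← Affine.Point.toClass_eq_zero, map_sum]
      simp_rw [Affine.Point.toClass_some]
      have h1 : (∑ i, (Additive.ofMul (ClassGroup.mk W.FunctionField (Affine.CoordinateRing.XYIdeal' (W := W) (hns i))) : Additive (ClassGroup W.CoordinateRing)))
          = Additive.ofMul (ClassGroup.mk W.FunctionField (∏ i, Affine.CoordinateRing.XYIdeal' (W := W) (hns i))) := by
        rw [map_prod, ofMul_prod]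
      refine h1.trans ?_
      have h2 : ClassGroup.mk W.FunctionField (∏ i, Affine.CoordinateRing.XYIdeal' (W := W) (hns i)) = 1 := by
        refine (ClassGroup.mk_eq_one_of_coe_ideal (I' := Ideal.span {f}) ?_).2 ⟨f, hf, rfl⟩
        rw [hspan, Units.coe_prod]
        simp_rw [Affine.CoordinateRing.XYIdeal'_eq]
        exact (map_prod (FractionalIdeal.coeIdealHom _ _) _ _).symm
      rw [h2]; rfl
    · intro i _ j _ hij
      simp only [Function.onFun, ← ker_evA (hns _).1]
      exact isCoprime_XY (fun i => (hns i).1) hinj hij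

end ZeroLemma

end Part3

section Part4
open Polynomial WeierstrassCurve
set_option linter.all false

section Velu
variable {F : Type*} [Field F] [DecidableEq F] {W : WeierstrassCurve.Affine F}

def px : W.Point → F
  | .zero => 0
  | .some x _ _ => x
def py : W.Point → F
  | .zero => 0
  | .some _ y _ => y

theorem zl (S : Finset W.Point) (hS : (0 : W.Point) ∉ S) (n : ℕ) (a b : F[X]) (hab : ¬ (a = 0 ∧ b = 0))
    (ha : a.natDegree ≤ n) (hb : b = 0 ∨ b.natDegree + 2 ≤ n)
    (hz : ∀ P ∈ S, a.eval (px P) + b.eval (px P) * py P = 0) :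
    S.card ≤ 2 * n ∧ (S.card = 2 * n → ∑ P ∈ S, P = 0) := by
  classical
  have hsome : ∀ P : S, ∃ h : W.Nonsingular (px P.1) (py P.1), P.1 = .some _ _ h := by
    rintro ⟨P, hP⟩
    rcases P with _ | ⟨x, y, h⟩
    · exact absurd hP hS
    · exact ⟨h, rfl⟩
  choose hns hP using hsome
  set f : W.CoordinateRing := a • 1 + b • Affine.CoordinateRing.mk W X with hfdef
  have hf : f ≠ 0 := by
    intro h0
    exact hab (Affine.CoordinateRing.smul_basis_eq_zero h0)
  have hdeg : (Algebra.norm F[X] f).natDegree ≤ 2 * n := by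
    apply natDegree_le_of_degree_le
    rw [hfdef, Affine.CoordinateRing.degree_norm_smul_basis]
    apply max_le
    · have : a.degree ≤ n := degree_le_of_natDegree_le ha
      calc 2 • a.degree ≤ 2 • (n : WithBot ℕ) := by gcongr
        _ = _ := by push_cast; rw [two_nsmul, two_mul]
    · rcases hb with rfl | hb
      · simp [two_nsmul]
      · have h1 : b.degree ≤ (b.natDegree : WithBot ℕ) := degree_le_natDegree
        calc 2 • b.degree + 3 ≤ 2 • (b.natDegree : WithBot ℕ) + 3 := by gcongr
          _ = ((2 * b.natDegree + 3 : ℕ) : WithBot ℕ) := by push_cast; rw [two_nsmul, two_mul]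
          _ ≤ _ := by exact_mod_cast (by omega)
  have := zero_lemma (W := W) (ι := S) (x := fun P => px P.1) (y := fun P => py P.1) hns
    (by
      intro P Q h1 h2
      apply Subtype.ext
      rw [hP P, hP Q]
      simp only [Affine.Point.some.injEq]
      exact ⟨h1, h2⟩) hf (fun P => by rw [evA_smul]; exact hz P.1 P.2)
  rw [Fintype.card_coe] at this
  refine ⟨this.1.trans hdeg, fun h => ?_⟩
  have h2 := this.2 (le_antisymm this.1 (h ▸ hdeg))
  rw [← Finset.sum_coe_sort]
  rw [← h2]
  exact Finset.sum_congr rfl (fun P _ => hP P)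

theorem px_neg (P : W.Point) : px (-P) = px P := by
  rcases P with _ | ⟨x, y, h⟩ <;> rfl

theorem py_neg (h1 : W.a₁ = 0) (h3 : W.a₃ = 0) (P : W.Point) : py (-P) = - py P := by
  rcases P with _ | ⟨x, y, h⟩
  · simp [py, ← Affine.Point.zero_def]
  · simp [py, Affine.negY, h1, h3]

theorem px_eq {P Q : W.Point} (hP : P ≠ 0) (hQ : Q ≠ 0) (h : px P = px Q) : P = Q ∨ P = -Q := by
  rcases P with _ | ⟨x, y, h⟩
  · exact absurd rfl hP
  rcases Q with _ | ⟨x', y', h'⟩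
  · exact absurd rfl hQ
  exact Affine.Point.X_eq_iff.1 h

theorem py_ne (h1 : W.a₁ = 0) (h3 : W.a₃ = 0) {P : W.Point} (hP : P + P ≠ 0) : py P ≠ 0 := by
  intro h
  apply hP
  rcases P with _ | ⟨x, y, h'⟩
  · exact add_zero _
  · simp only [py] at h
    rw [Affine.Point.add_self_of_Y_eq]
    simp [Affine.negY, h, h1, h3]

theorem curve_eq (h1 : W.a₁ = 0) (h3 : W.a₃ = 0) {P : W.Point} (hP : P ≠ 0) :
    py P ^ 2 = px P ^ 3 + W.a₂ * px P ^ 2 + W.a₄ * px P + W.a₆ := by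
  rcases P with _ | ⟨x, y, h'⟩
  · exact absurd rfl hP
  · have := (Affine.equation_iff _ _).1 h'.1
    simp only [px, py]
    rw [h1, h3] at this
    linear_combination this

theorem px_add (h1 : W.a₁ = 0) (h3 : W.a₃ = 0) {P Q : W.Point} (hP : P ≠ 0) (hQ : Q ≠ 0)
    (h : px P ≠ px Q) :
    px (P + Q) = ((py P - py Q) / (px P - px Q)) ^ 2 - W.a₂ - px P - px Q := by
  rcases P with _ | ⟨x, y, h'⟩
  · exact absurd rfl hP
  rcases Q with _ | ⟨x', y', h''⟩
  · exact absurd rfl hQ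
  simp only [px] at h
  rw [Affine.Point.add_of_X_ne h]
  simp only [px, py]
  rw [Affine.slope_of_X_ne h, Affine.addX, h1]
  ring

theorem px_add_add_px_sub (h1 : W.a₁ = 0) (h3 : W.a₃ = 0) {P Q : W.Point} (hP : P ≠ 0) (hQ : Q ≠ 0)
    (h : px P ≠ px Q) :
    px (P + Q) + px (P - Q) = 2 * ((px P + px Q) * (px P * px Q + W.a₄) + 2 * W.a₂ * px Q * px P + 2 * W.a₆)
      / (px P - px Q) ^ 2 := by
  have h0 : px P - px Q ≠ 0 := sub_ne_zero.2 h
  rw [px_add h1 h3 hP hQ h, sub_eq_add_neg P Q, px_add h1 h3 hP (neg_ne_zero.2 hQ) (by rwa [px_neg]), px_neg,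
    py_neg h1 h3]
  have e1 := curve_eq h1 h3 hP
  have e2 := curve_eq h1 h3 hQ
  field_simp
  linear_combination 2 * e1 + 2 * e2

variable (G : AddSubgroup W.Point) [Fintype G]

noncomputable def psiP : F[X] := ∏ g ∈ (Finset.univ : Finset G).erase 0, (X - C (px g.1))
noncomputable def SP (g : W.Point) : F[X] :=
  (X + C (px g)) * (C (px g) * X + C W.a₄) + C (2 * W.a₂ * px g) * X + C (2 * W.a₆)
noncomputable def chiP : F[X] := X * psiP G + ∑ g ∈ (Finset.univ : Finset G).erase 0,
  SP g.1 * ∏ k ∈ ((Finset.univ.erase 0).erase g).erase (-g), (X - C (px k.1))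
noncomputable def TP (P : W.Point) : F := ∑ g : G, px (P + g.1)

theorem psiP_monic : (psiP G).Monic := monic_prod_of_monic _ _ (fun _ _ => monic_X_sub_C _)
theorem psiP_natDegree : (psiP G).natDegree + 1 = Fintype.card G := by
  rw [psiP, natDegree_prod_of_monic _ _ (fun _ _ => monic_X_sub_C _)]
  simp only [natDegree_X_sub_C, Finset.sum_const, smul_eq_mul, mul_one]
  rw [Finset.card_erase_add_one (Finset.mem_univ _), Finset.card_univ]

theorem SP_natDegree (g : W.Point) : (SP g).natDegree ≤ 2 := by
  unfold SP; compute_degree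

theorem chiP_aux (h2G : ∀ g : G, g + g = 0 → g = 0) :
    (∑ g ∈ (Finset.univ : Finset G).erase 0,
  SP g.1 * ∏ k ∈ ((Finset.univ.erase 0).erase g).erase (-g), (X - C (px k.1))).natDegree < Fintype.card G := by
  have : 0 < Fintype.card G := Fintype.card_pos
  rw [Nat.lt_iff_le_pred this]
  apply natDegree_sum_le_of_forall_le
  intro g hg
  have hg0 := Finset.ne_of_mem_erase hg
  refine natDegree_mul_le.trans ?_
  rw [natDegree_prod_of_monic _ _ (fun _ _ => monic_X_sub_C _)]
  simp only [natDegree_X_sub_C, Finset.sum_const, smul_eq_mul, mul_one]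
  have hm1 : -g ∈ (Finset.univ.erase (0:G)).erase g := by
    simp only [Finset.mem_erase, Finset.mem_univ, and_true]
    refine ⟨fun h => hg0 (h2G g ?_), neg_ne_zero.2 hg0⟩
    nth_rewrite 2 [← h]; exact add_neg_cancel g
  have c1 := Finset.card_erase_add_one hm1
  have c2 := Finset.card_erase_add_one hg
  have c3 := Finset.card_erase_add_one (Finset.mem_univ (0:G))
  rw [Finset.card_univ] at c3
  have := SP_natDegree g.1
  omega

theorem chiP_natDegree (h2G : ∀ g : G, g + g = 0 → g = 0) : (chiP G).natDegree = Fintype.card G := by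
  have h1 : (X * psiP G).natDegree = Fintype.card G := by
    rw [natDegree_X_mul (psiP_monic G).ne_zero, psiP_natDegree]
  rw [chiP, natDegree_add_eq_left_of_natDegree_lt, h1]
  rw [h1]; exact chiP_aux G h2G

theorem velu (h1 : W.a₁ = 0) (h3 : W.a₃ = 0) (h2 : (2 : F) ≠ 0)
    (h2G : ∀ g : G, g + g = 0 → g = 0) {P : W.Point} (hP : P ∉ G) :
    (psiP G).eval (px P) ≠ 0 ∧ (chiP G).eval (px P) = (psiP G).eval (px P) * TP G P := by
  have hP0 : P ≠ 0 := fun h => hP (h ▸ G.zero_mem)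
  have hne : ∀ g : G, g ≠ 0 → px P - px g.1 ≠ 0 := by
    intro g hg h
    rcases px_eq hP0 (fun h => hg (Subtype.ext h)) (sub_eq_zero.1 h) with h | h
    · exact hP (h ▸ g.2)
    · exact hP (h ▸ G.neg_mem g.2)
  constructor
  · rw [psiP, eval_prod, Finset.prod_ne_zero_iff]
    intro g hg
    simpa using hne g (Finset.ne_of_mem_erase hg)
  have hT : TP G P = px P + ∑ g ∈ (Finset.univ : Finset G).erase 0, (SP g.1).eval (px P) / (px P - px g.1) ^ 2 := by
    have e1 : TP G P = px P + ∑ g ∈ (Finset.univ : Finset G).erase 0, px (P + g.1) := by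
      rw [TP, ← Finset.add_sum_erase _ _ (Finset.mem_univ (0 : G))]; simp
    have e2 : ∑ g ∈ (Finset.univ : Finset G).erase 0, px (P + g.1) = ∑ g ∈ (Finset.univ : Finset G).erase 0, px (P - g.1) := by
      apply Finset.sum_bij (fun g _ => -g)
      · intro a ha; simpa using ha
      · intro a _ b _ h; simpa using h
      · intro b hb; exact ⟨-b, by simpa using hb, by simp⟩
      · intro a _; simp
    have e3 : ∑ g ∈ (Finset.univ : Finset G).erase 0, px (P + g.1) + ∑ g ∈ (Finset.univ : Finset G).erase 0, px (P - g.1)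
        = 2 * ∑ g ∈ (Finset.univ : Finset G).erase 0, (SP g.1).eval (px P) / (px P - px g.1) ^ 2 := by
      rw [← Finset.sum_add_distrib, Finset.mul_sum]
      apply Finset.sum_congr rfl
      intro g hg
      have hg0 := Finset.ne_of_mem_erase hg
      rw [px_add_add_px_sub h1 h3 hP0 (fun h => hg0 (Subtype.ext h)) (sub_ne_zero.1 (hne g hg0)), mul_div_assoc]
      congr 2
      simp only [SP, eval_add, eval_mul, eval_C, eval_X]; ring
    rw [e1]; congr 1
    apply mul_left_cancel₀ h2
    rw [← e3, ← e2]; ring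
  rw [hT, chiP, eval_add, eval_mul, eval_X, mul_add, mul_comm (px P), eval_finset_sum, Finset.mul_sum]
  congr 1
  apply Finset.sum_congr rfl
  intro g hg
  have hg0 := Finset.ne_of_mem_erase hg
  have hm1 : -g ∈ (Finset.univ.erase (0:G)).erase g := by
    simp only [Finset.mem_erase, Finset.mem_univ, and_true]
    refine ⟨fun h => hg0 (h2G g ?_), neg_ne_zero.2 hg0⟩
    nth_rewrite 2 [← h]; exact add_neg_cancel g
  rw [psiP, ← Finset.mul_prod_erase _ _ hg, ← Finset.mul_prod_erase _ _ hm1]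
  have := hne g hg0
  simp only [eval_mul, eval_sub, eval_X, eval_C, AddSubgroup.coe_neg, px_neg]
  field_simp

theorem TP_add (P : W.Point) (g : G) : TP G (P + g.1) = TP G P := by
  unfold TP
  apply Fintype.sum_equiv (Equiv.addLeft g)
  intro k; simp [add_assoc]

theorem TP_neg (P : W.Point) : TP G (-P) = TP G P := by
  unfold TP
  apply Fintype.sum_equiv (Equiv.neg G)
  intro k
  rw [← px_neg]; simp [add_comm]

/-- phi polynomial of orbit of `c`. -/
noncomputable def phiP (c : W.Point) : F[X] := chiP G - C (TP G c) * psiP G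

theorem phiP_natDegree (h2G : ∀ g : G, g + g = 0 → g = 0) (c : W.Point) :
    (phiP G c).natDegree = Fintype.card G := by
  rw [phiP, natDegree_sub_eq_left_of_natDegree_lt, chiP_natDegree G h2G]
  rw [chiP_natDegree G h2G]
  have := psiP_natDegree G
  have := natDegree_C_mul_le (TP G c) (psiP G)
  omega

theorem phiP_ne (h2G : ∀ g : G, g + g = 0 → g = 0) (c : W.Point) :
    phiP G c ≠ 0 := by
  intro h
  have := phiP_natDegree G h2G c
  rw [h] at this
  have : 0 < Fintype.card G := Fintype.card_pos
  simp_all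

variable (h1 : W.a₁ = 0) (h3 : W.a₃ = 0) (h2 : (2 : F) ≠ 0) (h2G : ∀ g : G, g + g = 0 → g = 0)

theorem phiP_eval (h1 : W.a₁ = 0) (h3 : W.a₃ = 0) (h2 : (2 : F) ≠ 0) (h2G : ∀ g : G, g + g = 0 → g = 0)
    {P : W.Point} (hP : P ∉ G) (c : W.Point) :
    (phiP G c).eval (px P) = (psiP G).eval (px P) * (TP G P - TP G c) := by
  have := velu G h1 h3 h2 h2G hP
  rw [phiP, eval_sub, eval_mul, eval_C, this.2]; ring

theorem px_inj_coset {c : W.Point} (hc : c + c ∉ G) {g k : G} (h : px (c + g.1) = px (c + k.1)) : g = k := by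
  have hc' : ∀ g : G, c + g.1 ≠ 0 := by
    intro g hg
    apply hc
    rw [eq_neg_of_add_eq_zero_left hg]
    exact G.add_mem (G.neg_mem g.2) (G.neg_mem g.2)
  rcases px_eq (hc' g) (hc' k) h with h | h
  · exact Subtype.ext (add_left_cancel h)
  · exfalso; apply hc
    have : c + c = - k.1 - g.1 := by
      have h' : c = - (c + k.1) - g.1 := by rw [← h]; abel
      nth_rewrite 1 [h']; abel
    rw [this]; exact G.sub_mem (G.neg_mem k.2) g.2

/-- roots of a polynomial of degree ≤ h vanishing on the coset. -/
theorem root_coset {c : W.Point} (hc : c + c ∉ G) (p : F[X]) (hp : p ≠ 0) (hd : p.natDegree ≤ Fintype.card G)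
    (hz : ∀ g : G, p.eval (px (c + g.1)) = 0) :
    p.natDegree = Fintype.card G ∧ ∀ z, p.eval z = 0 → ∃ g : G, z = px (c + g.1) := by
  classical
  let R : Finset F := Finset.univ.image (fun g : G => px (c + g.1))
  have hR : R.card = Fintype.card G := by
    rw [Finset.card_image_of_injective _ (fun g k h => px_inj_coset G hc h), Finset.card_univ]
  have hsub : R ⊆ p.roots.toFinset := by
    intro z hz'
    obtain ⟨g, _, rfl⟩ := Finset.mem_image.1 hz'
    simp [hp, hz g]
  have hle : p.roots.toFinset.card ≤ p.natDegree := (Multiset.toFinset_card_le _).trans (p.card_roots')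
  have h1 := Finset.card_le_card hsub
  refine ⟨by omega, fun z hz' => ?_⟩
  have : R = p.roots.toFinset := Finset.eq_of_subset_of_card_le hsub (by omega)
  have hz2 : z ∈ R := by rw [this]; simp [hp, hz']
  obtain ⟨g, _, h⟩ := Finset.mem_image.1 hz2
  exact ⟨g, h.symm⟩

theorem coset_not_mem {c : W.Point} (hc : c ∉ G) (g : G) : c + g.1 ∉ G := by
  intro h; exact hc ((G.add_mem_cancel_right g.2).1 h)

theorem TP_inj (h1 : W.a₁ = 0) (h3 : W.a₃ = 0) (h2 : (2 : F) ≠ 0) (h2G : ∀ g : G, g + g = 0 → g = 0)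
    {c P : W.Point} (hc : c + c ∉ G) (hcG : c ∉ G) (hP : P ∉ G) (h : TP G P = TP G c) :
    P - c ∈ G ∨ P + c ∈ G := by
  have hr := root_coset G hc (phiP G c) (phiP_ne G h2G c) (phiP_natDegree G h2G c).le
    (fun g => by rw [phiP_eval G h1 h3 h2 h2G (coset_not_mem G hcG g), TP_add]; simp)
  obtain ⟨g, hg⟩ := hr.2 (px P) (by rw [phiP_eval G h1 h3 h2 h2G hP, h]; simp)
  have hP0 : P ≠ 0 := fun h => hP (h ▸ G.zero_mem)
  rcases px_eq hP0 (fun h => coset_not_mem G hcG g (by rw [h]; exact G.zero_mem)) hg with h | h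
  · left; rw [h]; simpa using g.2
  · right; rw [h]; simp

end Velu

end Part4

section Part5
open Polynomial WeierstrassCurve
set_option linter.all false

section Code
variable {F : Type*} [Field F]

noncomputable def cod (φ ψ : F[X]) : ℕ → ((ℕ → F[X]) →ₗ[F] F[X])
  | 0 => 0
  | (t + 1) => (LinearMap.mulLeft F φ).comp (cod φ ψ t) + (LinearMap.mulLeft F (ψ ^ t)).comp (LinearMap.proj t)

theorem cod_succ (φ ψ : F[X]) (t : ℕ) (u : ℕ → F[X]) :
    cod φ ψ (t + 1) u = φ * cod φ ψ t u + ψ ^ t * u t := by simp [cod]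

theorem cod_zero (φ ψ : F[X]) (u : ℕ → F[X]) : cod φ ψ 0 u = 0 := by simp [cod]

theorem cod_congr (φ ψ : F[X]) (t : ℕ) (u u' : ℕ → F[X]) (h : ∀ l < t, u l = u' l) :
    cod φ ψ t u = cod φ ψ t u' := by
  induction t with
  | zero => simp [cod]
  | succ t ih => rw [cod_succ, cod_succ, ih (fun l hl => h l (by omega)), h t (by omega)]

theorem cod_eval (φ ψ : F[X]) (t : ℕ) (u : ℕ → F[X]) (z ζ : F) (h : ψ.eval z = ζ * φ.eval z) :
    φ.eval z * (cod φ ψ t u).eval z = φ.eval z ^ t * ∑ l ∈ Finset.range t, ζ ^ l * (u l).eval z := by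
  induction t with
  | zero => simp [cod]
  | succ t ih =>
    rw [cod_succ, Finset.sum_range_succ, eval_add, eval_mul, eval_mul, eval_pow, h, mul_add, ih]
    ring

theorem cod_natDegree (φ ψ : F[X]) (t h : ℕ) (u : ℕ → F[X]) (hφ : φ.natDegree ≤ h) (hψ : ψ.natDegree ≤ h)
    (hu : ∀ l, (u l).natDegree ≤ h) : (cod φ ψ t u).natDegree ≤ h * t := by
  induction t with
  | zero => simp [cod]
  | succ t ih =>
    rw [cod_succ, mul_add, mul_one]
    refine (natDegree_add_le _ _).trans (max_le ?_ ?_)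
    · refine natDegree_mul_le.trans ?_
      omega
    · refine natDegree_mul_le.trans (add_le_add (natDegree_pow_le.trans ?_) (hu t))
      rw [mul_comm]; exact Nat.mul_le_mul_right t hψ

def Bd (n : ℕ) (b : F[X]) : Prop := b = 0 ∨ b.natDegree + 2 ≤ n

theorem Bd.add {n : ℕ} {a b : F[X]} (ha : Bd n a) (hb : Bd n b) : Bd n (a + b) := by
  rcases ha with rfl | ha
  · simpa using hb
  rcases hb with rfl | hb
  · right; simpa using ha
  right
  have := natDegree_add_le a b
  rcases le_max_iff.1 this with h | h <;> omega

theorem Bd.mul {n k : ℕ} {p b : F[X]} (hp : p.natDegree ≤ k) (hb : Bd n b) : Bd (k + n) (p * b) := by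
  rcases hb with rfl | hb
  · left; simp
  right
  have := natDegree_mul_le (p := p) (q := b)
  omega

theorem cod_Bd (φ ψ : F[X]) (t h : ℕ) (u : ℕ → F[X]) (hφ : φ.natDegree ≤ h) (hψ : ψ.natDegree ≤ h)
    (hu : ∀ l, Bd h (u l)) : Bd (h * t) (cod φ ψ t u) := by
  induction t with
  | zero => left; simp [cod]
  | succ t ih =>
    rw [cod_succ, mul_add, mul_one]
    refine Bd.add ?_ (Bd.mul ?_ (hu t))
    · rw [add_comm]; exact Bd.mul hφ ih
    · refine natDegree_pow_le.trans ?_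
      rw [mul_comm]; exact Nat.mul_le_mul_right t hψ

def shiftU (u : ℕ → F) : ℕ → F
  | 0 => 0
  | (l + 1) => u l

theorem cod_shift (φ ψ : F[X]) (t : ℕ) (u : ℕ → F) :
    cod φ ψ (t + 1) (fun l => C (shiftU u l) * φ) = ψ * cod φ ψ t (fun l => C (u l) * φ) := by
  induction t with
  | zero => simp [cod, shiftU]
  | succ t ih => rw [cod_succ, ih, cod_succ]; simp [shiftU]; ring

theorem prod_pencil (φ ψ : F[X]) (μ : ℕ → F) (t : ℕ) :
    ∃ (u : ℕ → F) (k : F), ∏ j ∈ Finset.range t, (φ + C (μ j) * ψ)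
      = cod φ ψ t (fun l => C (u l) * φ) + C k * ψ ^ t := by
  induction t with
  | zero => exact ⟨0, 1, by simp [cod]⟩
  | succ t ih =>
    obtain ⟨u, k, h⟩ := ih
    rw [Finset.prod_range_succ, h]
    refine ⟨(fun l => if l = t then k else u l) + μ t • shiftU u, μ t * k, ?_⟩
    have e1 : (fun l => C (((fun l => if l = t then k else u l) + μ t • shiftU u) l) * φ)
        = (fun l => C (if l = t then k else u l) * φ) + μ t • (fun l => C (shiftU u l) * φ) := by
      funext l; simp [smul_eq_C_mul]; ring
    have e2 : cod φ ψ t (fun l => C (if l = t then k else u l) * φ) = cod φ ψ t (fun l => C (u l) * φ) :=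
      cod_congr _ _ _ _ _ (fun l hl => by rw [if_neg (by omega)])
    rw [e1, map_add, map_smul, cod_shift, cod_succ, e2]
    generalize cod φ ψ t (fun l => C (u l) * φ) = D
    simp [smul_eq_C_mul]
    ring
end Code

section Code2
variable {F : Type*} [Field F] [DecidableEq F] {W : WeierstrassCurve.Affine F}
variable (G : AddSubgroup W.Point) [Fintype G]

/-- local evaluation -/
def cv (a b : F[X]) (P : W.Point) : F := a.eval (px P) + b.eval (px P) * py P

structure UProp (c0 : W.Point) (g0 : G) (a b : F[X]) : Prop where
  da : a.natDegree ≤ Fintype.card G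
  db : Bd (Fintype.card G) b
  z0 : cv a b c0 = 0
  z1 : cv a b (c0 + g0.1) = 0

/-- `a+by` in U vanishing on the orbit of c0 is a multiple of phi. -/
theorem mult_phi (h1 : W.a₁ = 0) (h3 : W.a₃ = 0) (h2 : (2 : F) ≠ 0) (h2G : ∀ g : G, g + g = 0 → g = 0)
    {c0 : W.Point} (hc : c0 + c0 ∉ G) (hcG : c0 ∉ G) (a b : F[X]) (da : a.natDegree ≤ Fintype.card G)
    (db : Bd (Fintype.card G) b)
    (hz : ∀ g : G, cv a b (c0 + g.1) = 0 ∧ cv a b (-(c0 + g.1)) = 0) :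
    b = 0 ∧ ∃ k, a = C k * phiP G c0 := by
  have hφ : ∀ g : G, (phiP G c0).eval (px (c0 + g.1)) = 0 :=
    fun g => by rw [phiP_eval G h1 h3 h2 h2G (coset_not_mem G hcG g), TP_add]; simp
  have hzz : ∀ g : G, a.eval (px (c0 + g.1)) = 0 ∧ b.eval (px (c0 + g.1)) = 0 := by
    intro g
    obtain ⟨e1, e2⟩ := hz g
    simp only [cv, px_neg, py_neg h1 h3] at e1 e2
    have hpy : py (c0 + g.1) ≠ 0 := by
      apply py_ne h1 h3
      intro h
      apply hc
      have : c0 + c0 = -g.1 - g.1 := by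
        have h' : c0 + c0 = (c0 + g.1 + (c0 + g.1)) - g.1 - g.1 := by abel
        rw [h', h]; abel
      rw [this]; exact G.sub_mem (G.neg_mem g.2) g.2
    have ea : a.eval (px (c0 + g.1)) = 0 := by
      apply (mul_eq_zero.1 (_ : 2 * a.eval (px (c0 + g.1)) = 0)).resolve_left h2
      linear_combination e1 + e2
    rw [ea, zero_add] at e1
    exact ⟨ea, (mul_eq_zero.1 e1).resolve_right hpy⟩
  have hb : b = 0 := by
    by_contra hb
    have := (root_coset G hc b hb (by rcases db with h | h; exact absurd h hb; omega) (fun g => (hzz g).2)).1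
    rcases db with h | h
    · exact hb h
    · omega
  refine ⟨hb, a.coeff (Fintype.card G) / (phiP G c0).leadingCoeff, ?_⟩
  have hne := phiP_ne G h2G c0
  have hlc : (phiP G c0).leadingCoeff ≠ 0 := leadingCoeff_ne_zero.2 hne
  set k := a.coeff (Fintype.card G) / (phiP G c0).leadingCoeff
  by_contra hcon
  have hsub : a - C k * phiP G c0 ≠ 0 := sub_ne_zero.2 hcon
  have hdeg : (a - C k * phiP G c0).natDegree ≤ Fintype.card G := by
    refine (natDegree_sub_le _ _).trans (max_le da ((natDegree_C_mul_le _ _).trans ?_))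
    exact (phiP_natDegree G h2G c0).le
  have := (root_coset G hc _ hsub hdeg (fun g => by simp [(hzz g).1, hφ g])).1
  have hl : (a - C k * phiP G c0).coeff (Fintype.card G) = 0 := by
    rw [coeff_sub, coeff_C_mul, sub_eq_zero]
    have : (phiP G c0).coeff (Fintype.card G) = (phiP G c0).leadingCoeff := by
      rw [leadingCoeff, phiP_natDegree G h2G]
    rw [this]; simp only [k]; field_simp
  rw [← this] at hl
  exact hsub (leadingCoeff_eq_zero.1 hl)

theorem code_inj (h1 : W.a₁ = 0) (h3 : W.a₃ = 0) (h2 : (2 : F) ≠ 0) (h2G : ∀ g : G, g + g = 0 → g = 0)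
    {c0 : W.Point} (hc : c0 + c0 ∉ G) (hcG : c0 ∉ G) (g0 : G) (t : ℕ) :
    ∀ (ua ub : ℕ → F[X]) (hu : ∀ l, UProp G c0 g0 (ua l) (ub l)) (k : F),
    cod (phiP G c0) (psiP G) t ua + C k * psiP G ^ t = 0 → cod (phiP G c0) (psiP G) t ub = 0 →
    k = 0 ∧ ∀ l < t, ua l = 0 ∧ ub l = 0 := by
  have hψ : ∀ P : W.Point, P ∉ G → (psiP G).eval (px P) ≠ 0 := fun P hP => (velu G h1 h3 h2 h2G hP).1
  have hφ : ∀ g : G, (phiP G c0).eval (px (c0 + g.1)) = 0 :=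
    fun g => by rw [phiP_eval G h1 h3 h2 h2G (coset_not_mem G hcG g), TP_add]; simp
  induction t with
  | zero => intro ua ub hu k e1 _; simpa [cod] using e1
  | succ t ih =>
    intro ua ub hu k e1 e2
    have key : ∀ z, (phiP G c0).eval z = 0 → (psiP G).eval z ≠ 0 →
        (ua t).eval z + k * (psiP G).eval z = 0 ∧ (ub t).eval z = 0 := by
      intro z hz1 hz2
      rw [cod_succ] at e1 e2
      have f1 := congrArg (eval z) e1
      have f2 := congrArg (eval z) e2
      simp only [eval_add, eval_mul, eval_pow, eval_C, hz1, zero_mul, zero_add, eval_zero] at f1 f2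
      have hp := pow_ne_zero t hz2
      constructor
      · apply (mul_eq_zero.1 (_ : (psiP G).eval z ^ t * _ = 0)).resolve_left hp
        linear_combination f1
      · exact (mul_eq_zero.1 f2).resolve_left hp
    have hk : k = 0 := by
      have hφ0 := hφ 0
      simp only [AddSubgroup.coe_zero, add_zero] at hφ0
      have := key (px c0) hφ0 (hψ _ hcG)
      have hz := (hu t).z0
      rw [cv, this.2] at hz
      have : k * (psiP G).eval (px c0) = 0 := by linear_combination this.1 - hz
      exact (mul_eq_zero.1 this).resolve_right (hψ _ hcG)
    subst hk
    have hm := mult_phi G h1 h3 h2 h2G hc hcG (ua t) (ub t) (hu t).da (hu t).db (by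
      intro g
      have := key _ (hφ g) (hψ _ (coset_not_mem G hcG g))
      simp only [cv, px_neg, this.2]
      simp at this
      simp [this.1])
    obtain ⟨hb, k', hk'⟩ := hm
    have hφne := phiP_ne G h2G c0
    have := ih ua ub hu k' (by
      rw [cod_succ, hk'] at e1
      apply (mul_eq_zero.1 (_ : phiP G c0 * _ = 0)).resolve_left hφne
      simp only [C_0, zero_mul, add_zero] at e1
      linear_combination e1) (by
      rw [cod_succ, hb, mul_zero, add_zero] at e2
      exact (mul_eq_zero.1 e2).resolve_left hφne)
    refine ⟨rfl, fun l hl => ?_⟩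
    rcases Nat.lt_succ_iff_lt_or_eq.1 hl with h | rfl
    · exact this.2 l h
    · rw [hk', this.1, hb]; simp

/-- points of orbit -/
def opt (c : W.Point) (i : Bool × G) : W.Point := if i.1 then c + i.2.1 else -(c + i.2.1)

theorem opt_px (c : W.Point) (i : Bool × G) : px (opt G c i) = px (c + i.2.1) := by
  unfold opt; split_ifs; rfl; rw [px_neg]

theorem opt_not_mem {c : W.Point} (hc : c ∉ G) (i : Bool × G) : opt G c i ∉ G := by
  unfold opt; split_ifs
  · exact coset_not_mem G hc _
  · rw [G.neg_mem_iff]; exact coset_not_mem G hc _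

theorem opt_TP (c : W.Point) (i : Bool × G) : TP G (opt G c i) = TP G c := by
  unfold opt; split_ifs
  · exact TP_add _ _ _
  · rw [TP_neg, TP_add]

theorem opt_inj {c : W.Point} (hc : c + c ∉ G) : Function.Injective (opt G c) := by
  rintro ⟨b, g⟩ ⟨b', g'⟩ h
  have hg : g = g' := px_inj_coset G hc (by rw [← opt_px G c (b, g), h, opt_px])
  subst hg
  have hne : c + g.1 ≠ -(c + g.1) := by
    intro h
    apply hc
    have : c + c = -g.1 - g.1 := by
      have h' : c + c = c + (c + g.1) - g.1 := by abel
      rw [h', h]; abel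
    rw [this]; exact G.sub_mem (G.neg_mem g.2) g.2
  cases b <;> cases b' <;> simp only [opt, if_true, if_false, Bool.false_eq_true] at h ⊢
  · exact absurd h.symm hne
  · exact absurd h hne

theorem opt_sum (c : W.Point) : ∑ i, opt G c i = 0 := by
  rw [Fintype.sum_prod_type]
  simp only [opt, Fintype.sum_bool, if_true, if_false, Bool.false_eq_true, Finset.sum_neg_distrib]
  exact add_neg_cancel _

theorem opt_mod (c : W.Point) (i : Bool × G) : opt G c i - c ∈ G ∨ opt G c i + c ∈ G := by
  unfold opt; split_ifs
  · left; simp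
  · right
    have : -(c + i.2.1) + c = - i.2.1 := by abel
    rw [this]; exact G.neg_mem i.2.2

theorem local_zero (h1 : W.a₁ = 0) (h3 : W.a₃ = 0) (h2 : (2 : F) ≠ 0) (h2G : ∀ g : G, g + g = 0 → g = 0)
    {c0 c : W.Point} (hc : c + c ∉ G) (hcG : c ∉ G) (hc0 : c0 + c0 ∉ G) (hcG0 : c0 ∉ G)
    (hd1 : c0 - c ∉ G) (hd2 : c0 + c ∉ G)
    (hd3 : c0 + c0 - (c + c) ∉ G) (hd4 : c0 + c0 + (c + c) ∉ G)
    (g0 : G) (hg0 : g0 ≠ 0) (a b : F[X]) (hab : ¬ (a = 0 ∧ b = 0)) (hu : UProp G c0 g0 a b) :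
    3 ≤ (Finset.univ.filter (fun i => cv a b (opt G c i) ≠ 0)).card := by
  classical
  set Z := Finset.univ.filter (fun i => cv a b (opt G c i) = 0) with hZ
  set N := Finset.univ.filter (fun i => cv a b (opt G c i) ≠ 0) with hN
  have hcard : Z.card + N.card = 2 * Fintype.card G := by
    rw [hZ, hN, Finset.card_filter_add_card_filter_not, Finset.card_univ]; simp
  have hnot : ∀ (k : G) i, c0 + k.1 ≠ opt G c i := by
    intro k i h
    rcases opt_mod G c i with h' | h'
    · rw [← h] at h'; apply hd1
      have : c0 - c = (c0 + k.1 - c) - k.1 := by abel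
      rw [this]; exact G.sub_mem h' k.2
    · rw [← h] at h'; apply hd2
      have : c0 + c = (c0 + k.1 + c) - k.1 := by abel
      rw [this]; exact G.sub_mem h' k.2
  let S0 : Finset W.Point := Z.image (opt G c)
  have hS0 : S0.card = Z.card := Finset.card_image_of_injective _ (opt_inj G hc)
  have hm0 : c0 ∉ insert (c0 + g0.1) S0 := by
    rw [Finset.mem_insert, not_or]
    constructor
    · intro h; exact hg0 (Subtype.ext (by simpa using h))
    · intro h
      obtain ⟨i, _, hi⟩ := Finset.mem_image.1 h
      exact hnot 0 i (by simpa using hi.symm)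
  have hm1 : c0 + g0.1 ∉ S0 := by
    intro h
    obtain ⟨i, _, hi⟩ := Finset.mem_image.1 h
    exact hnot g0 i hi.symm
  have := zl (insert c0 (insert (c0 + g0.1) S0)) (by
      simp only [Finset.mem_insert, not_or]
      refine ⟨fun h => hcG0 (h ▸ G.zero_mem), fun h => coset_not_mem G hcG0 g0 (h ▸ G.zero_mem), ?_⟩
      intro h
      obtain ⟨i, _, hi⟩ := Finset.mem_image.1 h
      exact opt_not_mem G hcG i (hi ▸ G.zero_mem)) (Fintype.card G) a b hab hu.da hu.db (by
      intro P hP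
      rcases Finset.mem_insert.1 hP with rfl | hP
      · exact hu.z0
      rcases Finset.mem_insert.1 hP with rfl | hP
      · exact hu.z1
      obtain ⟨i, hi, rfl⟩ := Finset.mem_image.1 hP
      exact (Finset.mem_filter.1 hi).2)
  rw [Finset.card_insert_of_notMem hm0, Finset.card_insert_of_notMem hm1, hS0,
    Finset.sum_insert hm0, Finset.sum_insert hm1] at this
  by_contra hlt
  have hN2 : N.card = 2 := by omega
  have hsum := this.2 (by omega)
  rw [Finset.sum_image (fun i _ j _ h => opt_inj G hc h)] at hsum
  have hsplit := Finset.sum_filter_add_sum_filter_not Finset.univ (fun i => cv a b (opt G c i) = 0) (opt G c)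
  rw [opt_sum] at hsplit
  obtain ⟨i, j, hij, hNij⟩ := Finset.card_eq_two.1 hN2
  rw [← hZ] at hsplit
  have hN' : Finset.univ.filter (fun i => ¬ cv a b (opt G c i) = 0) = {i, j} := hNij
  rw [hN', Finset.sum_pair hij] at hsplit
  have hfin : c0 + c0 = opt G c i + opt G c j - g0.1 := by
    have e1 : ∑ x ∈ Z, opt G c x = -(opt G c i + opt G c j) := eq_neg_of_add_eq_zero_left hsplit
    rw [e1] at hsum
    have : c0 + c0 = (c0 + (c0 + g0.1 + -(opt G c i + opt G c j))) + (opt G c i + opt G c j) - g0.1 := by abel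
    rw [this, hsum, zero_add]
  rcases opt_mod G c i with hi | hi <;> rcases opt_mod G c j with hj | hj
  · apply hd3
    have : c0 + c0 - (c + c) = (opt G c i - c) + (opt G c j - c) - g0.1 := by rw [hfin]; abel
    rw [this]; exact G.sub_mem (G.add_mem hi hj) g0.2
  · apply hc0
    have : c0 + c0 = (opt G c i - c) + (opt G c j + c) - g0.1 := by rw [hfin]; abel
    rw [this]; exact G.sub_mem (G.add_mem hi hj) g0.2
  · apply hc0
    have : c0 + c0 = (opt G c i + c) + (opt G c j - c) - g0.1 := by rw [hfin]; abel
    rw [this]; exact G.sub_mem (G.add_mem hi hj) g0.2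
  · apply hd4
    have : c0 + c0 + (c + c) = (opt G c i + c) + (opt G c j + c) - g0.1 := by rw [hfin]; abel
    rw [this]; exact G.sub_mem (G.add_mem hi hj) g0.2

end Code2

end Part5

section Part6
open Polynomial WeierstrassCurve
set_option linter.all false

section Code3
variable {F : Type*} [Field F] [DecidableEq F] {W : WeierstrassCurve.Affine F}
variable (G : AddSubgroup W.Point) [Fintype G]

noncomputable def cvL (P : W.Point) : (F[X] × F[X]) →ₗ[F] F :=
  (leval (px P)).comp (LinearMap.fst F _ _) + (py P) • (leval (px P)).comp (LinearMap.snd F _ _)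

theorem cvL_apply (P : W.Point) (v : F[X] × F[X]) : cvL P v = cv v.1 v.2 P := by
  simp [cvL, cv, leval, mul_comm]

/-- The space U as a submodule. -/
noncomputable def USp (c0 : W.Point) (g0 : G) : Submodule F (degreeLT F (Fintype.card G + 1) × degreeLT F (Fintype.card G - 1)) :=
  LinearMap.ker (((cvL c0).prod (cvL (c0 + g0.1))).comp
    (((degreeLT F (Fintype.card G + 1)).subtype).prodMap ((degreeLT F (Fintype.card G - 1)).subtype)))

theorem mem_USp {c0 : W.Point} {g0 : G} (v) : v ∈ USp G c0 g0 ↔ cv v.1.1 v.2.1 c0 = 0 ∧ cv v.1.1 v.2.1 (c0 + g0.1) = 0 := by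
  unfold USp
  rw [LinearMap.mem_ker, ← cvL_apply c0 (v.1.1, v.2.1), ← cvL_apply (c0 + g0.1) (v.1.1, v.2.1)]
  exact Prod.ext_iff

theorem USp_finrank {c0 : W.Point} (hc : c0 + c0 ∉ G) (g0 : G) (hg0 : g0 ≠ 0) (hcard : 3 ≤ Fintype.card G) :
    Module.finrank F (USp G c0 g0) = 2 * Fintype.card G - 2 := by
  set L := (((cvL c0).prod (cvL (c0 + g0.1))).comp
    (((degreeLT F (Fintype.card G + 1)).subtype).prodMap ((degreeLT F (Fintype.card G - 1)).subtype))) with hL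
  have hpx : px (c0 + g0.1) - px c0 ≠ 0 := by
    intro h
    apply hg0
    apply px_inj_coset G hc
    simpa using sub_eq_zero.1 h
  have hsurj : Function.Surjective L := by
    rintro ⟨r, s⟩
    refine ⟨(⟨C (r) + C ((s - r) / (px (c0 + g0.1) - px c0)) * (X - C (px c0)), ?_⟩, 0), ?_⟩
    · rw [mem_degreeLT]
      refine lt_of_le_of_lt (b := (1 : WithBot ℕ)) ?_ ?_
      · compute_degree
      · exact_mod_cast (by omega : 1 < Fintype.card G + 1)
    · have e : ∀ v, L v = (cv v.1.1 v.2.1 c0, cv v.1.1 v.2.1 (c0 + g0.1)) := fun v =>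
        Prod.ext (cvL_apply c0 _) (cvL_apply (c0 + g0.1) _)
      rw [e]
      refine Prod.ext ?_ ?_
      · simp [cv]
      · simp [cv]; field_simp; ring
  have h1 := L.finrank_range_add_finrank_ker
  rw [LinearMap.range_eq_top.2 hsurj, finrank_top, Module.finrank_prod, Module.finrank_prod, Module.finrank_self,
    (degreeLTEquiv F _).finrank_eq, (degreeLTEquiv F _).finrank_eq] at h1
  simp only [Module.finrank_fin_fun] at h1
  have : Module.finrank F (USp G c0 g0) = Module.finrank F (LinearMap.ker L) := rfl
  omega

theorem USp_UProp {c0 : W.Point} {g0 : G} (v : USp G c0 g0) :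
    UProp G c0 g0 v.1.1.1 v.1.2.1 := by
  have hv := (mem_USp G v.1).1 v.2
  refine ⟨?_, ?_, hv.1, hv.2⟩
  · have := v.1.1.2
    rw [mem_degreeLT] at this
    by_cases h0 : v.1.1.1 = 0
    · rw [h0]; simp
    · have := (natDegree_lt_iff_degree_lt h0).2 this
      omega
  · have := v.1.2.2
    rw [mem_degreeLT] at this
    by_cases h0 : v.1.2.1 = 0
    · left; exact h0
    · right
      have := (natDegree_lt_iff_degree_lt h0).2 this
      omega

/-- extension by zero -/
noncomputable def extA (t : ℕ) (c0 : W.Point) (g0 : G) : (Fin t → USp G c0 g0) →ₗ[F] (ℕ → F[X]) :=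
  LinearMap.pi fun l => if h : l < t then
    ((degreeLT F (Fintype.card G + 1)).subtype.comp ((LinearMap.fst F _ _).comp (USp G c0 g0).subtype)).comp
      (LinearMap.proj ⟨l, h⟩) else 0
noncomputable def extB (t : ℕ) (c0 : W.Point) (g0 : G) : (Fin t → USp G c0 g0) →ₗ[F] (ℕ → F[X]) :=
  LinearMap.pi fun l => if h : l < t then
    ((degreeLT F (Fintype.card G - 1)).subtype.comp ((LinearMap.snd F _ _).comp (USp G c0 g0).subtype)).comp
      (LinearMap.proj ⟨l, h⟩) else 0

theorem extA_apply (t : ℕ) (c0 : W.Point) (g0 : G) (v : Fin t → USp G c0 g0) (l : ℕ) (h : l < t) :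
    extA G t c0 g0 v l = (v ⟨l, h⟩).1.1.1 := by simp [extA, h]
theorem extB_apply (t : ℕ) (c0 : W.Point) (g0 : G) (v : Fin t → USp G c0 g0) (l : ℕ) (h : l < t) :
    extB G t c0 g0 v l = (v ⟨l, h⟩).1.2.1 := by simp [extB, h]

theorem ext_UProp (t : ℕ) (c0 : W.Point) (g0 : G) (v : Fin t → USp G c0 g0) (l : ℕ) :
    UProp G c0 g0 (extA G t c0 g0 v l) (extB G t c0 g0 v l) := by
  by_cases h : l < t
  · rw [extA_apply _ _ _ _ _ _ h, extB_apply _ _ _ _ _ _ h]; exact USp_UProp G _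
  · have e1 : extA G t c0 g0 v l = 0 := by simp [extA, h]
    have e2 : extB G t c0 g0 v l = 0 := by simp [extB, h]
    rw [e1, e2]
    exact ⟨by simp, Or.inl rfl, by simp [cv], by simp [cv]⟩

theorem UProp_sum (c0 : W.Point) (g0 : G) (t : ℕ) (ua ub : ℕ → F[X]) (hu : ∀ l, UProp G c0 g0 (ua l) (ub l)) (s : ℕ → F) :
    UProp G c0 g0 (∑ l ∈ Finset.range t, C (s l) * ua l) (∑ l ∈ Finset.range t, C (s l) * ub l) := by
  induction t with
  | zero => simp only [Finset.range_zero, Finset.sum_empty]; exact ⟨by simp, Or.inl rfl, by simp [cv], by simp [cv]⟩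
  | succ t ih =>
    rw [Finset.sum_range_succ, Finset.sum_range_succ]
    refine ⟨?_, ?_, ?_, ?_⟩
    · exact (natDegree_add_le _ _).trans (max_le ih.da ((natDegree_C_mul_le _ _).trans (hu t).da))
    · refine Bd.add ih.db ?_
      have := Bd.mul (p := C (s t)) (k := 0) (by simp) (hu t).db
      simpa using this
    · have e1 := ih.z0
      have e2 := (hu t).z0
      simp only [cv, eval_add, eval_mul, eval_C] at e1 e2 ⊢
      linear_combination e1 + s t * e2
    · have e1 := ih.z1
      have e2 := (hu t).z1
      simp only [cv, eval_add, eval_mul, eval_C] at e1 e2 ⊢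
      linear_combination e1 + s t * e2

theorem first_code (h1 : W.a₁ = 0) (h3 : W.a₃ = 0) (h2 : (2 : F) ≠ 0) (h2G : ∀ g : G, g + g = 0 → g = 0)
    (t m : ℕ) (htm : t < m) (hcard : 3 ≤ Fintype.card G) (c0 : W.Point) (c : Fin m → W.Point)
    (hc0 : c0 + c0 ∉ G) (hcG0 : c0 ∉ G) (hc : ∀ j, c j + c j ∉ G) (hcG : ∀ j, c j ∉ G)
    (hd1 : ∀ j, c0 - c j ∉ G) (hd2 : ∀ j, c0 + c j ∉ G)
    (hd3 : ∀ j, c0 + c0 - (c j + c j) ∉ G) (hd4 : ∀ j, c0 + c0 + (c j + c j) ∉ G)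
    (hd5 : ∀ i j, i ≠ j → c i - c j ∉ G) (hd6 : ∀ i j, i ≠ j → c i + c j ∉ G) :
    ExistsOptimalLRC F (2 * Fintype.card G * m) ((2 * Fintype.card G - 2) * t + 1)
      (2 * Fintype.card G * (m - t)) (2 * Fintype.card G - 2) 3 := by
  classical
  obtain ⟨g0, hg0⟩ : ∃ g0 : G, g0 ≠ 0 := by
    have : Nontrivial G := Fintype.one_lt_card_iff_nontrivial.1 (by omega)
    exact exists_ne 0
  set φ := phiP G c0 with hφdef
  set ψ := psiP G with hψdef
  let M := (Fin t → USp G c0 g0) × F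
  let Aa : M →ₗ[F] F[X] := ((cod φ ψ t).comp (extA G t c0 g0)).comp (LinearMap.fst F _ _)
    + ((LinearMap.mulLeft F (ψ ^ t)).comp (Polynomial.monomial 0)).comp (LinearMap.snd F _ _)
  let Bb : M →ₗ[F] F[X] := ((cod φ ψ t).comp (extB G t c0 g0)).comp (LinearMap.fst F _ _)
  have hA : ∀ v : M, Aa v = cod φ ψ t (extA G t c0 g0 v.1) + C v.2 * ψ ^ t := by
    intro v
    simp only [Aa, LinearMap.add_apply, LinearMap.comp_apply, LinearMap.mulLeft_apply]
    rw [mul_comm]; rfl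
  have hB : ∀ v : M, Bb v = cod φ ψ t (extB G t c0 g0 v.1) := fun v => rfl
  let E : M →ₗ[F] (Fin m × (Bool × G) → F) :=
    LinearMap.pi fun p => (cvL (opt G (c p.1) p.2)).comp (Aa.prod Bb)
  have hE : ∀ v p, E v p = cv (Aa v) (Bb v) (opt G (c p.1) p.2) := by
    intro v p; exact cvL_apply _ _
  have hφd : φ.natDegree = Fintype.card G := phiP_natDegree G h2G c0
  have hψd : ψ.natDegree ≤ Fintype.card G := by rw [hψdef]; have := psiP_natDegree G; omega
  have hAd : ∀ v, (Aa v).natDegree ≤ Fintype.card G * t := by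
    intro v
    rw [hA]
    refine (natDegree_add_le _ _).trans (max_le ?_ ?_)
    · exact cod_natDegree _ _ _ _ _ hφd.le hψd (fun l => (ext_UProp G t c0 g0 v.1 l).da)
    · refine (natDegree_C_mul_le _ _).trans (natDegree_pow_le.trans ?_)
      rw [mul_comm]; exact Nat.mul_le_mul_right t hψd
  have hBd : ∀ v, Bd (Fintype.card G * t) (Bb v) := by
    intro v
    rw [hB]
    exact cod_Bd _ _ _ _ _ hφd.le hψd (fun l => (ext_UProp G t c0 g0 v.1 l).db)
  have hinj : ∀ v, v ≠ 0 → ¬ (Aa v = 0 ∧ Bb v = 0) := by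
    rintro v hv ⟨e1, e2⟩
    rw [hA] at e1
    rw [hB] at e2
    obtain ⟨f1, f2⟩ := code_inj G h1 h3 h2 h2G hc0 hcG0 g0 t _ _ (ext_UProp G t c0 g0 v.1) v.2 e1 e2
    apply hv
    refine Prod.ext (funext fun l => Subtype.ext (Prod.ext (Subtype.ext ?_) (Subtype.ext ?_))) f1
    · have := (f2 l.1 l.2).1
      rwa [extA_apply _ _ _ _ _ _ l.2] at this
    · have := (f2 l.1 l.2).2
      rwa [extB_apply _ _ _ _ _ _ l.2] at this
  have hptinj : Function.Injective (fun p : Fin m × (Bool × G) => opt G (c p.1) p.2) := by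
    rintro ⟨j, i⟩ ⟨j', i'⟩ h
    simp only at h
    have hjj : j = j' := by
      by_contra hne
      have hT : TP G (c j) = TP G (c j') := by rw [← opt_TP G (c j) i, h, opt_TP]
      rcases TP_inj G h1 h3 h2 h2G (hc j') (hcG j') (hcG j) hT with h | h
      · exact hd5 _ _ hne h
      · exact hd6 _ _ hne h
    subst hjj
    rw [opt_inj G (hc j) h]
  have hφne : ∀ j i, φ.eval (px (opt G (c j) i)) ≠ 0 := by
    intro j i h
    rw [hφdef, phiP_eval G h1 h3 h2 h2G (opt_not_mem G (hcG j) i)] at h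
    have h' := (mul_eq_zero.1 h).resolve_left (velu G h1 h3 h2 h2G (opt_not_mem G (hcG j) i)).1
    rw [opt_TP] at h'
    rcases TP_inj G h1 h3 h2 h2G (hc j) (hcG j) hcG0 (sub_eq_zero.1 h').symm with h | h
    · exact hd1 _ h
    · exact hd2 _ h
  have hcι : Fintype.card (Bool × G) = 2 * Fintype.card G := by simp
  apply generic_lrc (M := M) (Fintype.card G) t m (2 * Fintype.card G - 2) 3 hcι E
  · haveI : Module.Free F (USp G c0 g0) :=
      @Module.Free.of_divisionRing F (USp G c0 g0) _ (Submodule.addCommGroup _) (Submodule.module _)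
    haveI : Module.Finite F (USp G c0 g0) := Module.finite_of_finrank_pos (by
      rw [USp_finrank G hc0 g0 hg0 hcard]; omega)
    rw [Module.finrank_prod, Module.finrank_pi_fintype]
    simp only [USp_finrank G hc0 g0 hg0 hcard, Module.finrank_self]
    simp [mul_comm]
  · intro v hv
    have := zl ((Finset.univ.filter (fun p => E v p = 0)).image (fun p : Fin m × (Bool × G) => opt G (c p.1) p.2))
      (by
        intro h
        obtain ⟨p, _, hp⟩ := Finset.mem_image.1 h
        exact opt_not_mem G (hcG p.1) p.2 (hp ▸ G.zero_mem)) (Fintype.card G * t) (Aa v) (Bb v) (hinj v hv)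
      (hAd v) (hBd v) (by
        intro P hP
        obtain ⟨p, hp, rfl⟩ := Finset.mem_image.1 hP
        have := (Finset.mem_filter.1 hp).2
        rwa [hE] at this)
    rw [Finset.card_image_of_injective _ hptinj] at this
    have := this.1
    rw [mul_assoc]; exact this
  · obtain ⟨u, k, huk⟩ := prod_pencil φ ψ (fun j => if h : j < m then TP G c0 - TP G (c ⟨j, h⟩) else 0) t
    have hφU : ∀ s : F, ((⟨C s * φ, by
        rw [mem_degreeLT]
        refine lt_of_le_of_lt (degree_le_natDegree.trans (c := ((Fintype.card G : ℕ) : WithBot ℕ)) ?_) ?_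
        · exact_mod_cast (natDegree_C_mul_le _ _).trans hφd.le
        · exact_mod_cast Nat.lt_succ_self _⟩, 0) :
        degreeLT F (Fintype.card G + 1) × degreeLT F (Fintype.card G - 1)) ∈ USp G c0 g0 := by
      intro s
      rw [mem_USp]
      have e0 := phiP_eval G h1 h3 h2 h2G hcG0 c0
      have e1 := phiP_eval G h1 h3 h2 h2G (coset_not_mem G hcG0 g0) c0
      rw [TP_add] at e1
      simp [cv, e0, e1, hφdef]
    let v : M := (fun l => ⟨_, hφU (u l)⟩, k)
    have hvA : Aa v = ∏ j ∈ Finset.range t, (φ + C (if h : j < m then TP G c0 - TP G (c ⟨j, h⟩) else 0) * ψ) := by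
      rw [hA, huk]
      congr 1
      apply cod_congr
      intro l hl
      rw [extA_apply _ _ _ _ _ _ hl]
    have hvB : Bb v = 0 := by
      rw [hB]
      have : cod φ ψ t (extB G t c0 g0 v.1) = cod φ ψ t 0 := by
        apply cod_congr
        intro l hl
        rw [extB_apply _ _ _ _ _ _ hl]
        rfl
      rw [this, map_zero]
    have hfac : ∀ (j : ℕ) (hj : j < m) (j' : Fin m) i,
        (φ + C (if h : j < m then TP G c0 - TP G (c ⟨j, h⟩) else 0) * ψ).eval (px (opt G (c j') i)) = 0 ↔ j'.val = j := by
      intro j hj j' i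
      rw [dif_pos hj, eval_add, eval_mul, eval_C, hφdef, phiP_eval G h1 h3 h2 h2G (opt_not_mem G (hcG j') i), opt_TP]
      have hψ0 := (velu G h1 h3 h2 h2G (opt_not_mem G (hcG j') i)).1
      constructor
      · intro h
        have h' : (psiP G).eval (px (opt G (c j') i)) * (TP G (c j') - TP G (c ⟨j, hj⟩)) = 0 := by
          rw [← h]; ring
        have hT := sub_eq_zero.1 ((mul_eq_zero.1 h').resolve_left hψ0)
        by_contra hne
        have hne' : j' ≠ ⟨j, hj⟩ := fun h => hne (congrArg Fin.val h)
        rcases TP_inj G h1 h3 h2 h2G (hc ⟨j, hj⟩) (hcG _) (hcG j') hT with h | h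
        · exact hd5 _ _ hne' h
        · exact hd6 _ _ hne' h
      · rintro rfl
        ring
    have hEv : ∀ p, E v p = 0 ↔ p.1.val < t := by
      intro p
      rw [hE, cv, hvB, hvA, eval_prod]
      simp only [eval_zero, zero_mul, add_zero, Finset.prod_eq_zero_iff, Finset.mem_range]
      constructor
      · rintro ⟨j, hj, h⟩
        rw [hfac j (by omega)] at h; omega
      · intro h
        exact ⟨p.1.val, h, (hfac _ (by omega) _ _).2 rfl⟩
    refine ⟨v, ?_, ?_⟩
    · intro h0
      have hlast := hEv (⟨t, htm⟩, (true, 0))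
      rw [h0] at hlast
      simp at hlast
    · have : Finset.univ.filter (fun p => E v p = 0)
          = (Finset.univ.filter (fun j : Fin m => j.val < t)) ×ˢ (Finset.univ : Finset (Bool × G)) := by
        ext p; simp [hEv]
      rw [this, Finset.card_product, Finset.card_univ, hcι, Fin.card_filter_val_lt, min_eq_right htm.le]
      ring
  · rintro v j ⟨i0, hi0⟩
    -- ζ
    set ζ : F := (TP G (c j) - TP G c0)⁻¹ with hζ
    have hT : TP G (c j) - TP G c0 ≠ 0 := by
      have := hφne j i0
      rw [hφdef, phiP_eval G h1 h3 h2 h2G (opt_not_mem G (hcG j) i0), opt_TP] at this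
      exact right_ne_zero_of_mul this
    have hζe : ∀ i, ψ.eval (px (opt G (c j) i)) = ζ * φ.eval (px (opt G (c j) i)) := by
      intro i
      rw [hφdef, phiP_eval G h1 h3 h2 h2G (opt_not_mem G (hcG j) i), opt_TP, hζ]
      field_simp
      rfl
    set a : F[X] := ∑ l ∈ Finset.range t, C (ζ ^ l) * extA G t c0 g0 v.1 l + C (v.2 * ζ ^ t) * φ with ha
    set b : F[X] := ∑ l ∈ Finset.range t, C (ζ ^ l) * extB G t c0 g0 v.1 l with hb
    have hφz : ∀ k : G, φ.eval (px (c0 + k.1)) = 0 := fun k => by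
      rw [hφdef, phiP_eval G h1 h3 h2 h2G (coset_not_mem G hcG0 k), TP_add]; simp
    have hu0 := UProp_sum G c0 g0 t _ _ (ext_UProp G t c0 g0 v.1) (fun l => ζ ^ l)
    have hu : UProp G c0 g0 a b := by
      refine ⟨?_, hu0.db, ?_, ?_⟩
      · exact (natDegree_add_le _ _).trans (max_le hu0.da ((natDegree_C_mul_le _ _).trans hφd.le))
      · have e1 := hu0.z0
        have e2 := hφz 0
        simp only [AddSubgroup.coe_zero, add_zero] at e2
        simp only [cv] at e1 ⊢
        rw [ha, eval_add, eval_mul, e2, mul_zero, add_zero]; exact e1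
      · have e1 := hu0.z1
        have e2 := hφz g0
        simp only [cv] at e1 ⊢
        rw [ha, eval_add, eval_mul, e2, mul_zero, add_zero]; exact e1
    have hrel : ∀ i, φ.eval (px (opt G (c j) i)) * E v (j, i)
        = φ.eval (px (opt G (c j) i)) ^ t * cv a b (opt G (c j) i) := by
      intro i
      rw [hE, cv, hA, hB, cv, ha, hb]
      have e1 := cod_eval φ ψ t (extA G t c0 g0 v.1) _ ζ (hζe i)
      have e2 := cod_eval φ ψ t (extB G t c0 g0 v.1) _ ζ (hζe i)
      simp only [eval_add, eval_mul, eval_C, eval_pow, hζe, eval_finset_sum]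
      rw [mul_pow]
      linear_combination e1 + py (opt G (c j) i) * e2
    have hiff : ∀ i, E v (j, i) ≠ 0 ↔ cv a b (opt G (c j) i) ≠ 0 := by
      intro i
      have := hrel i
      have h0 := hφne j i
      have h0' := pow_ne_zero t h0
      constructor
      · intro h h'
        rw [h', mul_zero] at this
        exact (mul_ne_zero h0 h) this
      · intro h h'
        rw [h', mul_zero] at this
        exact (mul_ne_zero h0' h) this.symm
    simp only [hiff]
    refine local_zero G h1 h3 h2 h2G (hc j) (hcG j) hc0 hcG0 (hd1 j) (hd2 j) (hd3 j) (hd4 j) g0 hg0 a b ?_ hu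
    rintro ⟨ha0, hb0⟩
    apply (hiff i0).1 hi0
    simp [cv, ha0, hb0]
  · omega
  · omega
  · omega
  · exact htm

end Code3

end Part6

section Part7
open Polynomial WeierstrassCurve
set_option linter.all false

section Code4
variable {F : Type*} [Field F] [DecidableEq F] {W : WeierstrassCurve.Affine F}

theorem first_from_point (h1 : W.a₁ = 0) (h3 : W.a₃ = 0) (h2 : (2 : F) ≠ 0) (P : W.Point) (h k t m : ℕ)
    (hP : addOrderOf P = h * k) (hodd : Odd (h * k)) (hh : 3 ≤ h) (hm : 2 * m + 3 ≤ k) (htm : t < m) :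
    ExistsOptimalLRC F (2 * h * m) ((2 * h - 2) * t + 1) (2 * h * (m - t)) (2 * h - 2) 3 := by
  classical
  obtain ⟨ho, ko⟩ := Nat.odd_mul.1 hodd
  set G : AddSubgroup W.Point := AddSubgroup.zmultiples ((k : ℕ) • P) with hG
  have hcardN : Nat.card G = h := by
    rw [hG, Nat.card_zmultiples, addOrderOf_nsmul' P (by omega), hP, Nat.gcd_eq_right (Dvd.intro_left _ rfl),
      Nat.mul_div_cancel _ (by omega)]
  haveI : Finite G := Nat.finite_of_card_ne_zero (by omega)
  letI : Fintype G := Fintype.ofFinite G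
  have hcard : Fintype.card G = h := by rw [← Nat.card_eq_fintype_card, hcardN]
  have hmem : ∀ a : ℤ, a • P ∈ G → (k : ℤ) ∣ a := by
    intro a ha
    obtain ⟨b, hb⟩ := AddSubgroup.mem_zmultiples_iff.1 ha
    have : (a - b * k) • P = 0 := by
      rw [sub_zsmul, ← hb, mul_zsmul]; simp
    rw [← addOrderOf_dvd_iff_zsmul_eq_zero, hP] at this
    push_cast at this
    have h' : (k : ℤ) ∣ a - b * k := (Dvd.intro_left _ rfl).trans this
    have := dvd_add h' (Dvd.intro_left b rfl : (k : ℤ) ∣ b * k)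
    simpa using this
  have hnm : ∀ a : ℤ, a ≠ 0 → |a| < k → a • P ∉ G := fun a h0 hl hm =>
    h0 (Int.eq_zero_of_abs_lt_dvd (hmem a hm) hl)
  have hnm2 : ∀ a : ℤ, a ≠ 0 → |a| < k → (2 * a) • P ∉ G := fun a h0 hl hm => by
    have := hmem _ hm
    have hc : IsCoprime (k : ℤ) 2 := by
      rw [Int.isCoprime_iff_gcd_eq_one]
      have := Nat.Coprime.symm (Nat.coprime_two_left.2 ko)
      exact_mod_cast this
    exact h0 (Int.eq_zero_of_abs_lt_dvd (hc.dvd_of_dvd_mul_left this) hl)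
  have := first_code G h1 h3 h2 (by
      intro g hg
      have h5 : addOrderOf g ∣ 2 := by
        rw [addOrderOf_dvd_iff_nsmul_eq_zero, two_nsmul, hg]
      have h6 : addOrderOf g ∣ h := by rw [← hcardN]; exact addOrderOf_dvd_natCard g
      have : addOrderOf g ∣ 1 := by
        have hco : Nat.Coprime 2 h := Nat.coprime_two_left.2 ho
        rw [← hco.gcd_eq_one]; exact Nat.dvd_gcd h5 h6
      rwa [Nat.dvd_one, AddMonoid.addOrderOf_eq_one_iff] at this) t m htm (by omega)
    (((m : ℤ) + 1) • P) (fun j : Fin m => ((j : ℤ) + 1) • P)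
    (by rw [← add_zsmul, ← two_mul]; exact hnm2 _ (by omega) (by rw [abs_lt]; omega))
    (hnm _ (by omega) (by rw [abs_lt]; omega))
    (fun j => by rw [← add_zsmul, ← two_mul]; exact hnm2 _ (by omega) (by rw [abs_lt]; omega))
    (fun j => hnm _ (by omega) (by rw [abs_lt]; omega))
    (fun j => by rw [← sub_smul]; exact hnm _ (by omega) (by rw [abs_lt]; omega))
    (fun j => by rw [← add_zsmul]; exact hnm _ (by omega) (by rw [abs_lt]; omega))
    (fun j => by
      rw [← add_zsmul, ← add_zsmul, ← sub_smul, ← two_mul, ← two_mul, ← mul_sub]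
      exact hnm2 _ (by omega) (by rw [abs_lt]; omega))
    (fun j => by
      rw [← add_zsmul, ← add_zsmul, ← add_zsmul, ← two_mul, ← two_mul, ← mul_add]
      exact hnm2 _ (by omega) (by rw [abs_lt]; omega))
    (fun i j hij => by
      have : (i : ℕ) ≠ j := fun h => hij (Fin.ext h)
      rw [← sub_smul]; exact hnm _ (by omega) (by rw [abs_lt]; omega))
    (fun i j hij => by
      rw [← add_zsmul]; exact hnm _ (by omega) (by rw [abs_lt]; omega))
  rw [hcard] at this
  exact this


theorem stmt_from_point (p : ℕ) (hp : p.Prime) (hodd : Odd p)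
    (s : ℕ) (hs : 0 < s) (q : ℕ) (hq : q = p ^ (2 * s))
    (h : ℕ) (hh : 3 ≤ h) (hdvd : h ∣ q + 2 * p ^ s)
    (t m : ℕ) (ht : 1 ≤ t) (htm : t < m)
    (hm : (m : ℚ) ≤ ((q : ℚ) + 2 * (p : ℚ) ^ s - (h : ℚ)) / (2 * (h : ℚ)) - 1)
    (F : Type*) [Field F] [Fintype F] [DecidableEq F] (hF : Fintype.card F = q)
    (hex : ∃ W : WeierstrassCurve.Affine F, W.a₁ = 0 ∧ W.a₃ = 0 ∧ ∃ P : W.Point, addOrderOf P = p ^ s * (p ^ s + 2)) :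
    ExistsOptimalLRC F (2 * h * m) ((2 * h - 2) * t + 1) (2 * h * (m - t)) (2 * h - 2) 3 ∧
    ExistsOptimalLRC F (2 * h * m) (2 * t + 1) (2 * h * (m - t)) 2 (2 * h - 1) := by
  have hq' : q = p ^ s * p ^ s := by rw [hq, two_mul, pow_add]
  obtain ⟨k, hk⟩ := hdvd
  have hN : p ^ s * (p ^ s + 2) = h * k := by rw [← hk, hq']; ring
  have hq0odd : Odd (p ^ s) := hodd.pow
  have hNodd : Odd (h * k) := by
    rw [← hN]; exact hq0odd.mul (hq0odd.add_even (by decide))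
  have hq03 : 3 ≤ p ^ s := by
    have h1 : 2 ≤ p := hp.two_le
    have h2 : p ≤ p ^ s := Nat.le_self_pow hs.ne' p
    rcases hq0odd with ⟨r, hr⟩
    omega
  have hkm : 2 * m + 3 ≤ k := by
    have hh0 : (0 : ℚ) < 2 * h := by positivity
    have hk' : (q : ℚ) + 2 * (p : ℚ) ^ s = h * k := by exact_mod_cast hk
    rw [hk', le_sub_iff_add_le, le_div_iff₀ hh0] at hm
    have hh1 : (0 : ℚ) < h := by positivity
    have : (h : ℚ) * (2 * m + 3) ≤ h * k := by linarith
    exact_mod_cast le_of_mul_le_mul_left this hh1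
  have h2 : (2 : F) ≠ 0 := by
    have hr : ringChar F ≠ 2 := by
      intro hr
      have : Odd (Fintype.card F) := by rw [hF, hq']; exact hq0odd.mul hq0odd
      have h7 := FiniteField.even_card_of_char_two hr
      rw [Nat.odd_iff] at this; omega
    exact Ring.two_ne_zero hr
  refine ⟨?_, ?_⟩
  · obtain ⟨W, h1, h3, P, hP⟩ := hex
    exact first_from_point h1 h3 h2 P h k t m (hP.trans hN) hNodd hh hkm htm
  · have e1 : 3 * p ^ s ≤ q := by rw [hq']; exact Nat.mul_le_mul_right _ hq03
    have e2 : h * k ≤ 2 * q := by omega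
    have e3 : h * 7 ≤ h * k := Nat.mul_le_mul_left _ (by omega)
    have e4 : 3 * k ≤ h * k := Nat.mul_le_mul_right _ hh
    exact second_code h2 h t m (by omega) htm ht (by rw [hF]; omega) (by rw [hF]; omega)
end Code4

end Part7

section Part8
open Filter Topology
set_option linter.all false

section LdCalc

/-- `f` behaves like `c (z-z0)^n` near `z0` (c may vanish). -/
def Ld (f : ℂ → ℂ) (z0 : ℂ) (n : ℤ) (c : ℂ) : Prop :=
  ∃ g : ℂ → ℂ, AnalyticAt ℂ g z0 ∧ g z0 = c ∧ ∀ᶠ z in 𝓝[≠] z0, f z = (z - z0) ^ n * g z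

theorem ev_ne (z0 : ℂ) : ∀ᶠ z in 𝓝[≠] z0, z - z0 ≠ 0 := by
  filter_upwards [self_mem_nhdsWithin] with z hz
  exact sub_ne_zero.2 hz

theorem Ld.congr {f f' : ℂ → ℂ} {z0 n c} (h : Ld f z0 n c) (hf : ∀ᶠ z in 𝓝[≠] z0, f' z = f z) : Ld f' z0 n c := by
  obtain ⟨g, a, b, d⟩ := h
  exact ⟨g, a, b, by filter_upwards [d, hf] with z h1 h2; rw [h2, h1]⟩

theorem Ld.mul {f g : ℂ → ℂ} {z0 : ℂ} {n m : ℤ} {c d : ℂ} (hf : Ld f z0 n c) (hg : Ld g z0 m d) :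
    Ld (fun z => f z * g z) z0 (n + m) (c * d) := by
  obtain ⟨u, a, rfl, h⟩ := hf
  obtain ⟨v, a', rfl, h'⟩ := hg
  refine ⟨fun z => u z * v z, a.mul a', rfl, ?_⟩
  filter_upwards [h, h', ev_ne z0] with z h1 h2 h3
  rw [h1, h2, zpow_add₀ h3]; ring

theorem Ld.pow2 {f : ℂ → ℂ} {z0 : ℂ} {n : ℤ} {c : ℂ} (hf : Ld f z0 n c) :
    Ld (fun z => f z ^ 2) z0 (2 * n) (c ^ 2) := by
  have := hf.mul hf
  rw [← two_mul, ← sq] at this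
  simpa [sq] using this

theorem Ld.inv {f : ℂ → ℂ} {z0 : ℂ} {n : ℤ} {c : ℂ} (hf : Ld f z0 n c) (hc : c ≠ 0) :
    Ld (fun z => (f z)⁻¹) z0 (-n) c⁻¹ := by
  obtain ⟨u, a, rfl, h⟩ := hf
  refine ⟨fun z => (u z)⁻¹, a.inv hc, rfl, ?_⟩
  filter_upwards [h] with z h1
  rw [h1, mul_inv, zpow_neg]

theorem Ld.div {f g : ℂ → ℂ} {z0 : ℂ} {n m : ℤ} {c d : ℂ} (hf : Ld f z0 n c) (hg : Ld g z0 m d) (hd : d ≠ 0) :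
    Ld (fun z => f z / g z) z0 (n - m) (c / d) := by
  simpa [div_eq_mul_inv, sub_eq_add_neg] using hf.mul (hg.inv hd)

theorem Ld.mono {f : ℂ → ℂ} {z0 : ℂ} {n m : ℤ} {c : ℂ} (hf : Ld f z0 n c) (hm : m < n) : Ld f z0 m 0 := by
  obtain ⟨u, a, rfl, h⟩ := hf
  obtain ⟨k, rfl⟩ : ∃ k : ℕ, n = m + (k + 1) := ⟨(n - m - 1).toNat, by omega⟩
  refine ⟨fun z => (z - z0) ^ (k + 1) * u z, by fun_prop, by simp, ?_⟩
  filter_upwards [h, ev_ne z0] with z h1 h3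
  rw [h1, zpow_add₀ h3, ← mul_assoc]
  norm_cast

theorem Ld.mono' {f : ℂ → ℂ} {z0 : ℂ} {n m : ℤ} {c : ℂ} (hf : Ld f z0 n c) (hm : m ≤ n) : ∃ d, Ld f z0 m d := by
  rcases hm.lt_or_eq with h | rfl
  · exact ⟨0, hf.mono h⟩
  · exact ⟨c, hf⟩

theorem Ld.add {f g : ℂ → ℂ} {z0 : ℂ} {n : ℤ} {c d : ℂ} (hf : Ld f z0 n c) (hg : Ld g z0 n d) :
    Ld (fun z => f z + g z) z0 n (c + d) := by
  obtain ⟨u, a, rfl, h⟩ := hf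
  obtain ⟨v, a', rfl, h'⟩ := hg
  refine ⟨fun z => u z + v z, a.add a', rfl, ?_⟩
  filter_upwards [h, h'] with z h1 h2
  rw [h1, h2]; ring

theorem Ld.neg {f : ℂ → ℂ} {z0 : ℂ} {n : ℤ} {c : ℂ} (hf : Ld f z0 n c) :
    Ld (fun z => - f z) z0 n (-c) := by
  obtain ⟨u, a, rfl, h⟩ := hf
  refine ⟨fun z => - u z, a.neg, rfl, ?_⟩
  filter_upwards [h] with z h1
  rw [h1]; ring

theorem Ld.of_analytic {f : ℂ → ℂ} {z0 : ℂ} (hf : AnalyticAt ℂ f z0) : Ld f z0 0 (f z0) :=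
  ⟨f, hf, rfl, by simp⟩

theorem Ld.of_zero {f : ℂ → ℂ} {z0 : ℂ} (hf : AnalyticAt ℂ f z0) (h0 : f z0 = 0) : Ld f z0 1 (deriv f z0) := by
  refine ⟨dslope f z0, ?_, by simp, ?_⟩
  · obtain ⟨p, hp⟩ := hf
    exact ⟨_, hp.has_fpower_series_dslope_fslope⟩
  · filter_upwards [self_mem_nhdsWithin] with z hz
    rw [dslope_of_ne _ hz, slope_def_field, h0, sub_zero, zpow_one]
    field_simp [sub_ne_zero.2 hz]

theorem Ld.unfactor {f : ℂ → ℂ} {z0 : ℂ} {n : ℤ} {c : ℂ} (hf : Ld f z0 n c) (hc : c ≠ 0) : ∀ᶠ z in 𝓝[≠] z0, f z ≠ 0 := by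
  obtain ⟨u, a, rfl, h⟩ := hf
  have := (a.continuousAt.eventually_ne hc).filter_mono (nhdsWithin_le_nhds (s := {z0}ᶜ))
  filter_upwards [h, this, ev_ne z0] with z h1 h2 h3
  rw [h1]; exact mul_ne_zero (zpow_ne_zero _ h3) h2

theorem Ld.shift {f : ℂ → ℂ} {z0 w : ℂ} {n : ℤ} {c : ℂ} (hf : Ld f (z0 + w) n c) : Ld (fun z => f (z + w)) z0 n c := by
  obtain ⟨u, a, rfl, h⟩ := hf
  refine ⟨fun z => u (z + w), ?_, rfl, ?_⟩
  · exact AnalyticAt.comp (g := u) (f := fun z => z + w) a (by fun_prop)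
  · have ht : Tendsto (fun z => z + w) (𝓝[≠] z0) (𝓝[≠] (z0 + w)) := by
      apply tendsto_nhdsWithin_of_tendsto_nhds_of_eventually_within
      · exact ((continuous_id.add continuous_const).tendsto z0).mono_left nhdsWithin_le_nhds
      · filter_upwards [self_mem_nhdsWithin] with z hz
        simpa using hz
    filter_upwards [ht.eventually h] with z hz
    rw [hz]; congr 2; ring

theorem Ld.scale {f : ℂ → ℂ} {z0 β : ℂ} (hβ : β ≠ 0) {n : ℤ} {c : ℂ} (hf : Ld f (β * z0) n c) :
    Ld (fun z => f (β * z)) z0 n (β ^ n * c) := by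
  obtain ⟨u, a, rfl, h⟩ := hf
  refine ⟨fun z => β ^ n * u (β * z), ?_, rfl, ?_⟩
  · have : AnalyticAt ℂ (fun z => u (β * z)) z0 := AnalyticAt.comp (g := u) (f := fun z => β * z) a (by fun_prop)
    fun_prop
  · have ht : Tendsto (fun z => β * z) (𝓝[≠] z0) (𝓝[≠] (β * z0)) := by
      apply tendsto_nhdsWithin_of_tendsto_nhds_of_eventually_within
      · exact ((continuous_const.mul continuous_id).tendsto z0).mono_left nhdsWithin_le_nhds
      · filter_upwards [self_mem_nhdsWithin] with z hz
        simpa [hβ] using hz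
    filter_upwards [ht.eventually h] with z hz
    rw [hz, ← mul_sub, mul_zpow]; ring

theorem Ld.deriv {f : ℂ → ℂ} {z0 : ℂ} {n : ℤ} {c : ℂ} (hf : Ld f z0 n c) : Ld (deriv f) z0 (n - 1) (n * c) := by
  obtain ⟨u, a, rfl, h⟩ := hf
  refine ⟨fun z => n * u z + (z - z0) * _root_.deriv u z, ?_, by simp, ?_⟩
  · have := a.deriv; fun_prop
  · have h' := eventually_eventually_nhdsWithin.2 h
    have ha := (a.eventually_analyticAt).filter_mono (nhdsWithin_le_nhds (s := {z0}ᶜ))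
    filter_upwards [h', ha, ev_ne z0, self_mem_nhdsWithin] with z h1 h2 h3 h4
    have h5 : f =ᶠ[𝓝 z] fun z => (z - z0) ^ n * u z := by
      have := (eventually_nhdsWithin_iff.1 h1)
      filter_upwards [this, isOpen_ne.mem_nhds h4] with y h6 h7
      exact h6 h7
    rw [h5.deriv_eq]
    have h6 : HasDerivAt (fun z => (z - z0) ^ n) (n * (z - z0) ^ (n - 1)) z := by
      have := (hasDerivAt_zpow n (z - z0) (Or.inl h3)).comp z ((hasDerivAt_id z).sub_const z0)
      rw [mul_one] at this
      exact this
    have h7 : HasDerivAt (fun z => (z - z0) ^ n * u z) _ z := h6.mul h2.differentiableAt.hasDerivAt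
    rw [h7.deriv]
    rw [zpow_sub_one₀ h3]; field_simp

theorem Ld.prod {ι : Type*} (s : Finset ι) (f : ι → ℂ → ℂ) (z0 : ℂ) (n : ι → ℤ) (c : ι → ℂ)
    (h : ∀ i ∈ s, Ld (f i) z0 (n i) (c i)) : Ld (fun z => ∏ i ∈ s, f i z) z0 (∑ i ∈ s, n i) (∏ i ∈ s, c i) := by
  classical
  induction s using Finset.induction_on with
  | empty => simpa using Ld.of_analytic (f := fun _ => 1) (z0 := z0) analyticAt_const
  | insert a s ha ih =>
    simp only [Finset.prod_insert ha, Finset.sum_insert ha]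
    exact (h a (Finset.mem_insert_self _ _)).mul (ih fun i hi => h i (Finset.mem_insert_of_mem hi))

theorem Ld.tendsto {f : ℂ → ℂ} {z0 c : ℂ} (h : Ld f z0 0 c) : Tendsto f (𝓝[≠] z0) (𝓝 c) := by
  obtain ⟨u, a, rfl, h⟩ := h
  have := a.continuousAt.tendsto.mono_left (nhdsWithin_le_nhds (s := {z0}ᶜ))
  exact this.congr' (by filter_upwards [h] with z hz; simp [hz])

theorem Ld.uniq {f : ℂ → ℂ} {z0 c d : ℂ} {n : ℤ} (h : Ld f z0 n c) (h' : Ld f z0 n d) : c = d := by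
  obtain ⟨u, a, rfl, h⟩ := h
  obtain ⟨v, a', rfl, h'⟩ := h'
  have t1 := a.continuousAt.tendsto.mono_left (nhdsWithin_le_nhds (s := {z0}ᶜ))
  have t2 := a'.continuousAt.tendsto.mono_left (nhdsWithin_le_nhds (s := {z0}ᶜ))
  refine tendsto_nhds_unique (t1.congr' ?_) t2
  filter_upwards [h, h', ev_ne z0] with z h1 h2 h3
  exact mul_left_cancel₀ (zpow_ne_zero n h3) (h1.symm.trans h2)

/-- Liouville. -/
theorem liouville (L : PeriodPair) (f : ℂ → ℂ) (hp : ∀ l ∈ L.lattice, ∀ z, f (z + l) = f z)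
    (h : ∀ z, ∃ c, Ld f z 0 c) : ∃ C, ∀ z, Ld f z 0 C := by
  choose g hg using h
  have hgp : ∀ l ∈ L.lattice, ∀ z, g (z + l) = g z := by
    intro l hl z
    have h1 := (hg (z + l)).shift
    simp only [hp l hl] at h1
    exact h1.uniq (hg z)
  have hga : ∀ z0, AnalyticAt ℂ g z0 := by
    intro z0
    obtain ⟨u, a, hu, h⟩ := hg z0
    have h' := eventually_eventually_nhdsWithin.2 h
    have ha := (a.eventually_analyticAt)
    have : g =ᶠ[𝓝 z0] u := by
      rw [eventually_nhdsWithin_iff] at h'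
      filter_upwards [h', ha] with z h1 h2
      by_cases hz : z = z0
      · rw [hz, hu]
      · have h3 := h1 hz
        have h4 : ∀ᶠ y in 𝓝[≠] z, f y = (y - z) ^ (0 : ℤ) * u y := by
          have := (eventually_nhdsWithin_iff.1 h3)
          have h5 : ∀ᶠ y in 𝓝 z, f y = u y := by
            filter_upwards [this, isOpen_ne.mem_nhds hz] with y h6 h7
            simpa using h6 h7
          filter_upwards [h5.filter_mono nhdsWithin_le_nhds] with y hy
          simp [hy]
        exact (hg z).uniq ⟨u, h2, rfl, h4⟩
    exact a.congr this.symm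
  have hd : Differentiable ℂ g := fun z => (hga z).differentiableAt
  have hb : Bornology.IsBounded (Set.range g) := (IsZLattice.isCompact_range_of_periodic L.lattice g hd.continuous
    (fun z w hw => hgp w hw z)).isBounded
  refine ⟨g 0, fun z => ?_⟩
  rw [← hd.apply_eq_apply_of_bounded hb z 0]
  exact hg z

theorem Ld.eq_of_analytic {f : ℂ → ℂ} {z0 c : ℂ} (h : Ld f z0 0 c) (hf : AnalyticAt ℂ f z0) : f z0 = c :=
  (Ld.of_analytic hf).uniq h

end LdCalc

end Part8

section Part9
open Filter Topology
open scoped PeriodPair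
set_option linter.all false

section WP
variable (L : PeriodPair)

theorem Ld.bump {f : ℂ → ℂ} {z0 : ℂ} {n : ℤ} (hf : Ld f z0 n 0) : ∃ d, Ld f z0 (n + 1) d := by
  obtain ⟨u, a, h0, h⟩ := hf
  obtain ⟨v, a', e, h'⟩ := Ld.of_zero a h0
  refine ⟨_, v, a', e, ?_⟩
  filter_upwards [h, h', ev_ne z0] with z h1 h2 h3
  rw [h1, h2, zpow_add₀ h3]; ring

theorem ld_P {l : ℂ} (hl : l ∈ L.lattice) : Ld ℘[L] l (-2) 1 := by
  refine ⟨fun z ↦ (z - l) ^ 2 * ℘[L - l] z + 1 - (z - l) ^ 2 / l ^ 2, ?_, ?_, ?_⟩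
  · have : AnalyticAt ℂ ℘[L - l] l := L.analyticOnNhd_weierstrassPExcept l l (by simp)
    suffices AnalyticAt ℂ (fun z ↦ (z - l) ^ 2 / l ^ 2) l by fun_prop
    by_cases hl₀ : l = 0
    · simpa [hl₀] using analyticAt_const
    · fun_prop (disch := simpa)
  · simp
  · filter_upwards [self_mem_nhdsWithin] with z (hz : _ ≠ _)
    have : (z - l) ^ 2 ≠ 0 := by simpa [sub_eq_zero]
    simp [← L.ite_eq_one_sub_sq_mul_weierstrassP l hl,
        if_neg hz, inv_mul_cancel_left₀ this, zpow_ofNat]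

theorem ld_dP {l : ℂ} (hl : l ∈ L.lattice) : Ld ℘'[L] l (-3) (-2) := by
  have := (ld_P L hl).deriv
  rw [L.deriv_weierstrassP] at this
  norm_num at this
  exact this

theorem anP {z : ℂ} (hz : z ∉ L.lattice) : AnalyticAt ℂ ℘[L] z := L.analyticOnNhd_weierstrassP z hz
theorem andP {z : ℂ} (hz : z ∉ L.lattice) : AnalyticAt ℂ ℘'[L] z := L.analyticOnNhd_derivWeierstrassP z hz

theorem perP {l : ℂ} (hl : l ∈ L.lattice) (z : ℂ) : ℘[L] (z + l) = ℘[L] z := L.weierstrassP_add_coe z ⟨l, hl⟩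
theorem perP' {z w : ℂ} (h : z - w ∈ L.lattice) : ℘[L] z = ℘[L] w := by
  have := perP L h w; rwa [add_sub_cancel] at this
theorem perP'' {z w : ℂ} (h : z + w ∈ L.lattice) : ℘[L] z = ℘[L] w := by
  rw [← L.weierstrassP_neg w]; apply perP'; simpa using h
theorem perdP {l : ℂ} (hl : l ∈ L.lattice) (z : ℂ) : ℘'[L] (z + l) = ℘'[L] z := L.derivWeierstrassP_add_coe z ⟨l, hl⟩

theorem nm_shift {l : ℂ} (hl : l ∈ L.lattice) (z : ℂ) : z + l ∈ L.lattice ↔ z ∈ L.lattice :=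
  Submodule.add_mem_iff_left _ hl

theorem ldP_pole {z0 w : ℂ} (h : z0 + w ∈ L.lattice) (c : ℂ) : Ld (fun z => ℘[L] (z + w) - c) z0 (-2) 1 := by
  have h1 := (ld_P L h).shift
  have h2 := (Ld.of_analytic (f := fun _ => -c) (z0 := z0) analyticAt_const).mono (m := -2) (by norm_num)
  simpa [sub_eq_add_neg] using h1.add h2

theorem anPs {z0 w : ℂ} (h : z0 + w ∉ L.lattice) : AnalyticAt ℂ (fun z => ℘[L] (z + w)) z0 :=
  AnalyticAt.comp (g := ℘[L]) (f := fun z => z + w) (anP L h) (by fun_prop)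

theorem ldP_reg {z0 w : ℂ} (h : z0 + w ∉ L.lattice) (c : ℂ) : Ld (fun z => ℘[L] (z + w) - c) z0 0 (℘[L] (z0 + w) - c) :=
  Ld.of_analytic ((anPs L h).sub analyticAt_const)

theorem ldP_zero {z0 w : ℂ} (h : z0 + w ∉ L.lattice) (c : ℂ) (h0 : ℘[L] (z0 + w) = c) :
    Ld (fun z => ℘[L] (z + w) - c) z0 1 (℘'[L] (z0 + w)) := by
  have h1 := Ld.of_zero (f := fun z => ℘[L] z - c) ((anP L h).sub analyticAt_const) (by simp [h0])
  have := h1.shift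
  rwa [deriv_sub_const, L.deriv_weierstrassP] at this

/-- half period -/
def Half (w : ℂ) : Prop := w ∉ L.lattice ∧ w + w ∈ L.lattice

theorem dP_half {w : ℂ} (h : w + w ∈ L.lattice) : ℘'[L] w = 0 := by
  have h1 := perdP L h (-w)
  rw [L.derivWeierstrassP_neg] at h1
  simp only [neg_add_cancel_left] at h1
  have : (2 : ℂ) * ℘'[L] w = 0 := by linear_combination h1
  simpa using this

theorem P_not_const (c : ℂ) (z0 : ℂ) : ¬ ∀ᶠ z in 𝓝[≠] z0, ℘[L] z - c = 0 := by
  intro h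
  have hm : Meromorphic (fun z => ℘[L] z - c) := L.meromorphic_weierstrassP.sub (fun x => MeromorphicAt.const c x)
  have h1 : meromorphicOrderAt (fun z => ℘[L] z - c) z0 = ⊤ := meromorphicOrderAt_eq_top_iff.2 h
  have h2 : meromorphicOrderAt (fun z => ℘[L] z - c) 0 ≠ ⊤ := by
    rw [Ne, meromorphicOrderAt_eq_top_iff]
    intro h3
    have h4 := (ldP_pole L (z0 := 0) (w := 0) (by simp) c).unfactor one_ne_zero
    simp only [add_zero] at h4
    obtain ⟨z, h5, h6⟩ := (h3.and h4).exists
    exact h6 h5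
  exact (MeromorphicOn.meromorphicOrderAt_ne_top_of_isPreconnected (U := Set.univ) (x := 0) (fun x _ => hm x) isPreconnected_univ
    (Set.mem_univ _) (Set.mem_univ z0) h2) h1

/-- translation by half period -/
theorem Tr_aux {w : ℂ} (hw : Half L w) : ∃ b : ℂ, b ≠ 0 ∧ (∀ z, z ∉ L.lattice → z + w ∉ L.lattice →
    (℘[L] z - ℘[L] w) * (℘[L] (z + w) - ℘[L] w) = b) := by
  obtain ⟨h1, h2⟩ := hw
  have hl2 : ∀ u : ℂ, u + w ∈ L.lattice → ∃ d, Ld (fun z => ℘[L] z - ℘[L] w) u 2 d := by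
    intro u hu
    have hu' : u ∉ L.lattice := fun h => h1 (by simpa using L.lattice.sub_mem hu h)
    have e1 : ℘[L] u = ℘[L] w := perP'' L hu
    have := ldP_zero L (z0 := u) (w := 0) (by simpa using hu') (℘[L] w) (by simpa using e1)
    have h3 : u + u ∈ L.lattice := by
      have := L.lattice.sub_mem (L.lattice.add_mem hu hu) h2
      convert this using 1; ring
    simp only [add_zero] at this
    rw [dP_half L h3] at this
    exact this.bump
  obtain ⟨C, hC⟩ := liouville L (fun z => (℘[L] z - ℘[L] w) * (℘[L] (z + w) - ℘[L] w)) (by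
      intro l hl z
      simp only [perP L hl, add_right_comm z l w]) (by
      intro z
      by_cases hz : z ∈ L.lattice
      · have hz' : z + w + w ∈ L.lattice := by rw [add_assoc]; exact L.lattice.add_mem hz h2
        obtain ⟨d, hd⟩ := hl2 _ hz'
        have a1 := ldP_pole L (z0 := z) (w := 0) (by simpa using hz) (℘[L] w)
        simp only [add_zero] at a1
        have := a1.mul hd.shift
        exact ⟨_, this⟩
      · by_cases hz' : z + w ∈ L.lattice
        · obtain ⟨d, hd⟩ := hl2 _ hz'
          have := hd.mul (ldP_pole L hz' (℘[L] w))
          exact ⟨_, this⟩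
        · have a1 := ldP_reg L (z0 := z) (w := 0) (by simpa using hz) (℘[L] w)
          simp only [add_zero] at a1
          exact ⟨_, a1.mul (ldP_reg L hz' (℘[L] w))⟩)
  refine ⟨C, ?_, ?_⟩
  · rintro rfl
    obtain ⟨u, a, e, h⟩ := hC 0
    have hL := hC
    -- product tends to 0 everywhere; use regular points
    have key : ∀ z, z ∉ L.lattice → z + w ∉ L.lattice → (℘[L] z - ℘[L] w) * (℘[L] (z + w) - ℘[L] w) = 0 := by
      intro z hz hz'
      exact (hC z).eq_of_analytic (((anP L hz).sub analyticAt_const).mul ((anPs L hz').sub analyticAt_const))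
    apply P_not_const L (℘[L] w) w
    have hP := (ldP_pole L (z0 := w) (w := w) h2 (℘[L] w)).unfactor one_ne_zero
    have o1 : ∀ᶠ z in 𝓝[≠] w, z ∉ L.lattice := mem_nhdsWithin_of_mem_nhds (L.isClosed_lattice.isOpen_compl.mem_nhds h1)
    have o2 : ∀ᶠ z in 𝓝[≠] w, z + w ∉ L.lattice := by
      have := L.compl_lattice_sdiff_singleton_mem_nhds (w + w)
      have ht : Tendsto (fun z => z + w) (𝓝[≠] w) (𝓝 (w + w)) :=
        ((continuous_id.add continuous_const).tendsto w).mono_left nhdsWithin_le_nhds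
      filter_upwards [ht this, self_mem_nhdsWithin] with z h3 h4 h5
      exact h3 ⟨h5, by simpa using h4⟩
    filter_upwards [hP, o1, o2] with z h3 h4 h5
    exact (mul_eq_zero.1 (key z h4 h5)).resolve_right h3
  · intro z hz hz'
    exact (hC z).eq_of_analytic (((anP L hz).sub analyticAt_const).mul ((anPs L hz').sub analyticAt_const))

theorem P_eq_half {w z : ℂ} (hw : Half L w) (hz : z ∉ L.lattice) (h : ℘[L] z = ℘[L] w) : z + w ∈ L.lattice := by
  obtain ⟨b, hb, ht⟩ := Tr_aux L hw
  by_contra hn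
  have := ht z hz hn
  rw [h, sub_self, zero_mul] at this
  exact hb this.symm

/-- exact order 2 at half periods -/
theorem ldP_half {w z0 v : ℂ} (hw : Half L w) (h : z0 + v + w ∈ L.lattice) :
    ∃ d, d ≠ 0 ∧ Ld (fun z => ℘[L] (z + v) - ℘[L] w) z0 2 d := by
  obtain ⟨b, hb, ht⟩ := Tr_aux L hw
  set u := z0 + v with hu
  have hu1 : u ∉ L.lattice := fun h' => hw.1 (by simpa using L.lattice.sub_mem h h')
  suffices ∃ d, d ≠ 0 ∧ Ld (fun z => ℘[L] z - ℘[L] w) u 2 d by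
    obtain ⟨d, hd, h'⟩ := this
    exact ⟨d, hd, h'.shift⟩
  have hp := ldP_pole L h (℘[L] w)
  have h1 := (Ld.of_analytic (f := fun _ => b) (z0 := u) analyticAt_const).div hp one_ne_zero
  refine ⟨b, hb, ?_⟩
  norm_num at h1
  apply h1.congr
  have o1 : ∀ᶠ z in 𝓝[≠] u, z ∉ L.lattice := mem_nhdsWithin_of_mem_nhds (L.isClosed_lattice.isOpen_compl.mem_nhds hu1)
  have o2 : ∀ᶠ z in 𝓝[≠] u, z + w ∉ L.lattice := by
      have := L.compl_lattice_sdiff_singleton_mem_nhds (u + w)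
      have ht : Tendsto (fun z => z + w) (𝓝[≠] u) (𝓝 (u + w)) :=
        ((continuous_id.add continuous_const).tendsto u).mono_left nhdsWithin_le_nhds
      filter_upwards [ht this, self_mem_nhdsWithin] with z h3 h4 h5
      exact h3 ⟨h5, by simpa using h4⟩
  filter_upwards [o1, o2, hp.unfactor one_ne_zero] with z h2 h3 h4
  rw [eq_div_iff h4]; exact ht z h2 h3

end WP

end Part9

section Part10
open Filter Topology
open scoped PeriodPair
set_option linter.all false

section WP2
variable (L : PeriodPair)

structure HP (T : Fin 3 → ℂ) : Prop where
  half : ∀ i, Half L (T i)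
  inj : ∀ i j, i ≠ j → T i - T j ∉ L.lattice
  sum : ∀ i j k, i ≠ j → j ≠ k → i ≠ k → T i + T j + T k ∈ L.lattice

variable {L} {T : Fin 3 → ℂ} (hT : HP L T)
include hT

theorem HP.e_inj {i j : Fin 3} (hij : i ≠ j) : ℘[L] (T i) ≠ ℘[L] (T j) := by
  intro h
  have := P_eq_half L (hT.half j) (hT.half i).1 h
  apply hT.inj i j hij
  have h2 := L.lattice.sub_mem this (hT.half j).2
  convert h2 using 1; ring

theorem HP.Tr {i j k : Fin 3} (hij : i ≠ j) (hjk : j ≠ k) (hik : i ≠ k) {z : ℂ} (hz : z ∉ L.lattice) (hz' : z + T i ∉ L.lattice) :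
    (℘[L] z - ℘[L] (T i)) * (℘[L] (z + T i) - ℘[L] (T i)) =
      (℘[L] (T j) - ℘[L] (T i)) * (℘[L] (T k) - ℘[L] (T i)) := by
  obtain ⟨b, hb, h⟩ := Tr_aux L (hT.half i)
  have hs := hT.sum j i k hij.symm hik hjk
  rw [h z hz hz', ← h (T j) (hT.half j).1 (by
    intro h'
    apply (hT.half k).1
    simpa using L.lattice.sub_mem hs h'), perP'' L hs]

theorem HP.ode {z : ℂ} (hz : z ∉ L.lattice) :
    ℘'[L] z ^ 2 = 4 * ((℘[L] z - ℘[L] (T 0)) * (℘[L] z - ℘[L] (T 1)) * (℘[L] z - ℘[L] (T 2))) := by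
  have h := L.derivWeierstrassP_sq z hz
  have h0 := L.derivWeierstrassP_sq (T 0) (hT.half 0).1
  have h1 := L.derivWeierstrassP_sq (T 1) (hT.half 1).1
  have h2 := L.derivWeierstrassP_sq (T 2) (hT.half 2).1
  rw [dP_half L (hT.half _).2] at h0 h1 h2
  have d01 := sub_ne_zero.2 (hT.e_inj (show (0 : Fin 3) ≠ 1 by decide))
  have d02 := sub_ne_zero.2 (hT.e_inj (show (0 : Fin 3) ≠ 2 by decide))
  have d12 := sub_ne_zero.2 (hT.e_inj (show (1 : Fin 3) ≠ 2 by decide))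
  rw [h]
  generalize ℘[L] z = x at *
  generalize ℘[L] (T 0) = a at *
  generalize ℘[L] (T 1) = b at *
  generalize ℘[L] (T 2) = c at *
  generalize L.g₂ = g2 at *
  generalize L.g₃ = g3 at *
  have e1 : 4 * (a ^ 2 + a * b + b ^ 2) - g2 = 0 := by
    apply mul_left_cancel₀ d01; linear_combination h1 - h0
  have e2 : 4 * (a ^ 2 + a * c + c ^ 2) - g2 = 0 := by
    apply mul_left_cancel₀ d02; linear_combination h2 - h0
  have e3 : a + b + c = 0 := by
    apply mul_left_cancel₀ d12; linear_combination (e1 - e2) / 4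
  have hc : c = -a - b := by linear_combination e3
  subst hc
  linear_combination (x - a) * e1 - h0

theorem HP.dP_zero {z : ℂ} (hz : z ∉ L.lattice) (h : ℘'[L] z = 0) : ∃ i, z + T i ∈ L.lattice := by
  have := hT.ode hz
  rw [h] at this
  have : (℘[L] z - ℘[L] (T 0)) * (℘[L] z - ℘[L] (T 1)) * (℘[L] z - ℘[L] (T 2)) = 0 := by
    have h4 : (4 : ℂ) ≠ 0 := by norm_num
    apply mul_left_cancel₀ h4; rw [← this]; ring
  rcases mul_eq_zero.1 this with h | h
  · rcases mul_eq_zero.1 h with h | h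
    · exact ⟨0, P_eq_half L (hT.half 0) hz (sub_eq_zero.1 h)⟩
    · exact ⟨1, P_eq_half L (hT.half 1) hz (sub_eq_zero.1 h)⟩
  · exact ⟨2, P_eq_half L (hT.half 2) hz (sub_eq_zero.1 h)⟩

theorem HP.dbl_of {z : ℂ} {i : Fin 3} (h : z + T i ∈ L.lattice) : z + z ∈ L.lattice := by
  have := L.lattice.sub_mem (L.lattice.add_mem h h) (hT.half i).2
  convert this using 1; ring

theorem HP.dP_ne {z : ℂ} (hz : z + z ∉ L.lattice) : ℘'[L] z ≠ 0 := by
  intro h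
  have hz' : z ∉ L.lattice := fun h => hz (L.lattice.add_mem h h)
  obtain ⟨i, hi⟩ := hT.dP_zero hz' h
  exact hz (hT.dbl_of hi)

theorem HP.ld_dP_half {z : ℂ} {i : Fin 3} (h : z + T i ∈ L.lattice) : ∃ d, d ≠ 0 ∧ Ld ℘'[L] z 1 d := by
  obtain ⟨d, hd, h1⟩ := ldP_half L (v := 0) (z0 := z) (hT.half i) (by simpa using h)
  have h2 := h1.deriv
  simp only [add_zero] at h2
  have e : deriv (fun z => ℘[L] z - ℘[L] (T i)) = ℘'[L] := by
    funext z; rw [deriv_sub_const, L.deriv_weierstrassP]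
  rw [e] at h2
  norm_num at h2
  exact ⟨2 * d, by simpa using hd, h2⟩

theorem anf {z w : ℂ} (h1 : z + w ∉ L.lattice) (h2 : z - w ∉ L.lattice) :
    AnalyticAt ℂ (fun z => ℘[L] (z + w) - ℘[L] (z - w)) z := by
  have := anPs L (z0 := z) (w := -w) (by simpa [sub_eq_add_neg] using h2)
  exact (anPs L h1).sub (by simpa [sub_eq_add_neg] using this)

theorem ldf {z w : ℂ} : ∃ c, Ld (fun z => ℘[L] (z + w) - ℘[L] (z - w)) z (-2) c := by
  have key : ∀ w : ℂ, ∃ c, Ld (fun z => ℘[L] (z + w) - 0) z (-2) c := by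
    intro w
    by_cases h : z + w ∈ L.lattice
    · exact ⟨_, ldP_pole L h 0⟩
    · exact ⟨_, (ldP_reg L h 0).mono (by norm_num)⟩
  obtain ⟨c, hc⟩ := key w
  obtain ⟨d, hd⟩ := key (-w)
  have := hc.add hd.neg
  simp only [sub_zero, ← sub_eq_add_neg] at this
  exact ⟨_, this⟩

theorem HP.Diff {z w : ℂ} (hz : z ∉ L.lattice) (hw : w ∉ L.lattice) (h1 : z + w ∉ L.lattice) (h2 : z - w ∉ L.lattice) :
    (℘[L] (z + w) - ℘[L] (z - w)) * (℘[L] z - ℘[L] w) ^ 2 = - (℘'[L] z * ℘'[L] w) := by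
  by_cases hww : w + w ∈ L.lattice
  · rw [dP_half L hww, perP' L (z := z + w) (w := z - w) (by convert hww using 1; ring)]; ring
  by_cases hzz : z + z ∈ L.lattice
  · rw [dP_half L hzz, perP'' L (z := z + w) (w := z - w) (by convert hzz using 1; ring)]; ring
  have hval : ∀ z, z ∈ L.lattice → Ld (fun z => (℘[L] (z + w) - ℘[L] (z - w)) * (℘[L] z - ℘[L] w) ^ 2 / ℘'[L] z) z 0 (-℘'[L] w) := by
    intro z hz
    have g1 : z + w ∉ L.lattice := by rw [add_comm, nm_shift L hz]; exact hw
    have g2 : z - w ∉ L.lattice := fun h => hw (by simpa using L.lattice.sub_mem hz h)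
    have a1 := Ld.of_zero (anf hT g1 g2) (by
      rw [sub_eq_zero]; apply perP''; convert L.lattice.add_mem hz hz using 1; ring)
    have hd1 : HasDerivAt (fun z => ℘[L] (z + w)) (℘'[L] (z + w)) z := by
      have := (anP L g1).differentiableAt.hasDerivAt.comp_add_const z w
      rwa [L.deriv_weierstrassP] at this
    have hd2 : HasDerivAt (fun z => ℘[L] (z - w)) (℘'[L] (z - w)) z := by
      have := (anP L g2).differentiableAt.hasDerivAt.comp_sub_const z w
      rwa [L.deriv_weierstrassP] at this
    have hd3 : HasDerivAt (fun z => ℘[L] (z + w) - ℘[L] (z - w)) _ z := hd1.sub hd2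
    have e : ℘'[L] (z - w) = -℘'[L] w := by rw [sub_eq_neg_add, perdP L hz, L.derivWeierstrassP_neg]
    rw [hd3.deriv, e, add_comm z w, perdP L hz] at a1
    have a2 := (ldP_pole L (z0 := z) (w := 0) (by simpa using hz) (℘[L] w)).pow2
    simp only [add_zero] at a2
    have a3 := (a1.mul a2).div (ld_dP L hz) (by norm_num)
    norm_num at a3
    convert a3 using 1
    ring
  obtain ⟨C, hC⟩ := liouville L (fun z => (℘[L] (z + w) - ℘[L] (z - w)) * (℘[L] z - ℘[L] w) ^ 2 / ℘'[L] z) (by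
      intro l hl z
      have e1 : z + l + w = (z + w) + l := by ring
      have e2 : z + l - w = (z - w) + l := by ring
      simp only [perP L hl, e1, e2, perdP L hl]) (by
      intro z
      by_cases hz : z ∈ L.lattice
      · exact ⟨_, hval z hz⟩
      have a2 := (ldP_reg L (z0 := z) (w := 0) (by simpa using hz) (℘[L] w))
      simp only [add_zero] at a2
      by_cases hzT : ∃ i, z + T i ∈ L.lattice
      · obtain ⟨i, hi⟩ := hzT
        have hzz := hT.dbl_of hi
        have g1 : z + w ∉ L.lattice := fun h => hww (by
          have := L.lattice.sub_mem (L.lattice.add_mem h h) hzz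
          convert this using 1; ring)
        have g2 : z - w ∉ L.lattice := fun h => hww (by
          have := L.lattice.sub_mem hzz (L.lattice.add_mem h h)
          convert this using 1; ring)
        have a1 := Ld.of_zero (anf hT g1 g2) (by
          rw [sub_eq_zero]; apply perP''; convert hzz using 1; ring)
        obtain ⟨d, hd, a3⟩ := hT.ld_dP_half hi
        have := (a1.mul a2.pow2).div a3 hd
        norm_num at this
        exact ⟨_, this⟩
      have hdz : ℘'[L] z ≠ 0 := fun h => hzT (hT.dP_zero hz h)
      have a3 := Ld.of_analytic (andP L hz)
      by_cases hp : z + w ∈ L.lattice ∨ z - w ∈ L.lattice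
      · have he : ℘[L] z = ℘[L] w := hp.elim (perP'' L) (perP' L)
        have a2 := (ldP_zero L (z0 := z) (w := 0) (by simpa using hz) (℘[L] w) (by simpa using he))
        simp only [add_zero] at a2
        obtain ⟨c, a1⟩ := ldf hT (z := z) (w := w)
        have := (a1.mul a2.pow2).div a3 hdz
        norm_num at this
        exact ⟨_, this⟩
      · push Not at hp
        have := ((Ld.of_analytic (anf hT hp.1 hp.2)).mul a2.pow2).div a3 hdz
        norm_num at this
        exact ⟨_, this⟩)
  have hCv : C = -℘'[L] w := (hC 0).uniq (hval 0 L.lattice.zero_mem)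
  have hdz := hT.dP_ne hzz
  have := (hC z).eq_of_analytic (((anf hT h1 h2).mul (((anP L hz).sub analyticAt_const).pow 2)).div (andP L hz) hdz)
  rw [hCv, div_eq_iff hdz] at this
  rw [this]; ring

theorem HP.P_inj {z w : ℂ} (hz : z ∉ L.lattice) (hw : w ∉ L.lattice) (h : ℘[L] z = ℘[L] w) :
    z + w ∈ L.lattice ∨ z - w ∈ L.lattice := by
  by_contra hn
  push Not at hn
  have := hT.Diff hz hw hn.1 hn.2
  rw [h, sub_self] at this
  have h0 : ℘'[L] z * ℘'[L] w = 0 := by linear_combination this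
  have key : ∀ z w : ℂ, z ∉ L.lattice → w ∉ L.lattice → ℘[L] z = ℘[L] w → ℘'[L] z = 0 → z + w ∈ L.lattice := by
    intro z w hz hw he h
    obtain ⟨i, hi⟩ := hT.dP_zero hz h
    have := P_eq_half L (w := z) (z := w) ⟨hz, hT.dbl_of hi⟩ hw he.symm
    rwa [add_comm]
  rcases mul_eq_zero.1 h0 with h' | h'
  · exact hn.1 (key z w hz hw h h')
  · exact hn.1 (by rw [add_comm]; exact key w z hw hz h.symm h')

end WP2

end Part10

section Part11
open Filter Topology
open scoped PeriodPair
set_option linter.all false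

section WP3
variable {L : PeriodPair} {T : Fin 3 → ℂ} (hT : HP L T)
include hT

theorem HP.dTr {i : Fin 3} {z : ℂ} (hz : z ∉ L.lattice) (hz' : z + T i ∉ L.lattice) :
    ℘'[L] z * (℘[L] (z + T i) - ℘[L] (T i)) + (℘[L] z - ℘[L] (T i)) * ℘'[L] (z + T i) = 0 := by
  obtain ⟨b, hb, h⟩ := Tr_aux L (hT.half i)
  have hd1 : HasDerivAt (fun z => ℘[L] (z + T i)) (℘'[L] (z + T i)) z := by
    have := (anP L hz').differentiableAt.hasDerivAt.comp_add_const z (T i)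
    rwa [L.deriv_weierstrassP] at this
  have hd2 : HasDerivAt (fun z => ℘[L] z) (℘'[L] z) z := by
    have := (anP L hz).differentiableAt.hasDerivAt
    rwa [L.deriv_weierstrassP] at this
  have h3 : HasDerivAt (fun z => (℘[L] z - ℘[L] (T i)) * (℘[L] (z + T i) - ℘[L] (T i))) _ z :=
    (hd2.sub_const _).mul (hd1.sub_const _)
  have o1 : ∀ᶠ z in 𝓝 z, z ∉ L.lattice := (L.isClosed_lattice.isOpen_compl.mem_nhds hz)
  have o2 : ∀ᶠ z in 𝓝 z, z + T i ∉ L.lattice :=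
    ((continuous_id.add continuous_const).tendsto z).eventually (L.isClosed_lattice.isOpen_compl.mem_nhds hz')
  have h4 : (fun z => (℘[L] z - ℘[L] (T i)) * (℘[L] (z + T i) - ℘[L] (T i))) =ᶠ[𝓝 z] fun _ => b := by
    filter_upwards [o1, o2] with y h1 h2
    exact h y h1 h2
  have h5 := h3.congr_of_eventuallyEq h4.symm
  exact h5.unique (hasDerivAt_const z b)

theorem HP.Dbl {i j k : Fin 3} (hij : i ≠ j) (hjk : j ≠ k) (hik : i ≠ k) {z : ℂ} (hz : z + z ∉ L.lattice) :
    (℘[L] (z + z) - ℘[L] (T i)) * ℘'[L] z ^ 2 = ((℘[L] z - ℘[L] (T i)) ^ 2 -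
      (℘[L] (T j) - ℘[L] (T i)) * (℘[L] (T k) - ℘[L] (T i))) ^ 2 := by
  have hz1 : z ∉ L.lattice := fun h => hz (L.lattice.add_mem h h)
  have hz2 : z + T i ∉ L.lattice := fun h => hz (hT.dbl_of h)
  have ht := hT.Tr hij hjk hik hz1 hz2
  have hdt := hT.dTr hz1 hz2
  have hTi := (hT.half i)
  by_cases h2 : z + z + T i ∈ L.lattice
  · rw [perP'' L h2, perP'' L (z := z + T i) (w := z) (by convert h2 using 1; ring)] at *
    rw [← ht]; ring
  have h3 := hT.Diff hz1 hz2 (by rwa [← add_assoc]) (by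
    intro h; apply hTi.1; convert L.lattice.neg_mem h using 1; ring)
  have h4 := hT.Tr hij hjk hik hz h2
  rw [← add_assoc] at h3
  have e : ℘[L] (z - (z + T i)) = ℘[L] (T i) := by
    rw [show z - (z + T i) = - T i by ring, L.weierstrassP_neg]
  rw [e] at h3
  have hb : (℘[L] (T j) - ℘[L] (T i)) * (℘[L] (T k) - ℘[L] (T i)) ≠ 0 :=
    mul_ne_zero (sub_ne_zero.2 (hT.e_inj hij.symm)) (sub_ne_zero.2 (hT.e_inj hik.symm))
  generalize (℘[L] (T j) - ℘[L] (T i)) * (℘[L] (T k) - ℘[L] (T i)) = b at *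
  generalize ℘[L] (T i) = a at *
  generalize ℘[L] (z + T i) = X' at *
  generalize ℘'[L] (z + T i) = Y' at *
  generalize ℘[L] (z + z + T i) = A' at *
  generalize ℘[L] (z + z) = A at *
  generalize ℘[L] z = X at *
  generalize ℘'[L] z = Y at *
  have k1 : b * Y + (X - a) ^ 2 * Y' = 0 := by linear_combination (X - a) * hdt - Y * ht
  have k2 : (X - X') * (X - a) = (X - a) ^ 2 - b := by linear_combination -ht
  apply mul_left_cancel₀ hb
  rw [← k2]
  linear_combination ((A - a) * Y) * k1 + (X - a) ^ 2 * (A - a) * h3 * (-1) + (X - X') ^ 2 * (X - a) ^ 2 * h4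

theorem HP.Prod_half {i j k : Fin 3} (hij : i ≠ j) (hjk : j ≠ k) (hik : i ≠ k) {z w : ℂ} (l : Fin 3) (hwl : w + T l ∈ L.lattice)
    (hz : z ∉ L.lattice)
    (h1 : z + w ∉ L.lattice) (h2 : z - w ∉ L.lattice) :
    (℘[L] (z + w) - ℘[L] (T i)) * (℘[L] (z - w) - ℘[L] (T i)) * (℘[L] z - ℘[L] w) ^ 2 =
      ((℘[L] z - ℘[L] (T i)) * (℘[L] w - ℘[L] (T i)) - (℘[L] (T j) - ℘[L] (T i)) * (℘[L] (T k) - ℘[L] (T i))) ^ 2 := by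
  have hww := hT.dbl_of hwl
  have e1 : ℘[L] (z - w) = ℘[L] (z + T l) := by
    apply perP'; convert L.lattice.neg_mem hwl using 1; ring
  have e2 : ℘[L] (z + w) = ℘[L] (z + T l) := by
    apply perP'; convert L.lattice.sub_mem hww hwl using 1; ring
  have e3 := perP'' L hwl
  have hz' : z + T l ∉ L.lattice := by
    intro h; apply h2; convert L.lattice.sub_mem h hwl using 1; ring
  rw [e1, e2, e3]
  have hl : l = i ∨ l = j ∨ l = k := by omega
  rcases hl with rfl | rfl | rfl
  · have := hT.Tr hij hjk hik hz hz'
    rw [sub_self, mul_zero, ← this]; ring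
  · have := hT.Tr hij.symm hik hjk hz hz'
    have e : (℘[L] (z + T l) - ℘[L] (T i)) * (℘[L] z - ℘[L] (T l)) = (℘[L] (T l) - ℘[L] (T i)) * (℘[L] z - ℘[L] (T k)) := by
      linear_combination this
    calc _ = ((℘[L] (z + T l) - ℘[L] (T i)) * (℘[L] z - ℘[L] (T l))) ^ 2 := by ring
      _ = _ := by rw [e]; ring
  · have := hT.Tr hik.symm hij hjk.symm hz hz'
    have e : (℘[L] (z + T l) - ℘[L] (T i)) * (℘[L] z - ℘[L] (T l)) = (℘[L] (T l) - ℘[L] (T i)) * (℘[L] z - ℘[L] (T j)) := by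
      linear_combination this
    calc _ = ((℘[L] (z + T l) - ℘[L] (T i)) * (℘[L] z - ℘[L] (T l))) ^ 2 := by ring
      _ = _ := by rw [e]; ring

theorem HP.Prod {i j k : Fin 3} (hij : i ≠ j) (hjk : j ≠ k) (hik : i ≠ k) {z w : ℂ} (hz : z ∉ L.lattice) (hw : w ∉ L.lattice)
    (h1 : z + w ∉ L.lattice) (h2 : z - w ∉ L.lattice) :
    (℘[L] (z + w) - ℘[L] (T i)) * (℘[L] (z - w) - ℘[L] (T i)) * (℘[L] z - ℘[L] w) ^ 2 =
      ((℘[L] z - ℘[L] (T i)) * (℘[L] w - ℘[L] (T i)) - (℘[L] (T j) - ℘[L] (T i)) * (℘[L] (T k) - ℘[L] (T i))) ^ 2 := by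
  have h2' : w - z ∉ L.lattice := fun h => h2 (by convert L.lattice.neg_mem h using 1; ring)
  by_cases hwl : ∃ l, w + T l ∈ L.lattice
  · obtain ⟨l, hl⟩ := hwl
    exact hT.Prod_half hij hjk hik l hl hz h1 h2
  by_cases hzl : ∃ l, z + T l ∈ L.lattice
  · obtain ⟨l, hl⟩ := hzl
    have := hT.Prod_half hij hjk hik l hl hw (by rwa [add_comm]) h2'
    rw [add_comm w z, ← L.weierstrassP_neg (w - z), neg_sub] at this
    linear_combination this
  have dz : ℘'[L] z ≠ 0 := fun h => hzl (hT.dP_zero hz h)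
  have dw : ℘'[L] w ≠ 0 := fun h => hwl (hT.dP_zero hw h)
  have hz' : z + T i ∉ L.lattice := fun h => hzl ⟨i, h⟩
  have hw' : w + T i ∉ L.lattice := fun h => hwl ⟨i, h⟩
  have hTi := (hT.half i).2
  have ht := hT.Tr hij hjk hik hz hz'
  have hdt := hT.dTr hz hz'
  by_cases g1 : z + w + T i ∈ L.lattice
  · rw [perP'' L g1, ← perP'' L (z := z + T i) (w := w) (by convert g1 using 1; ring), ht]; ring
  by_cases g2 : z - w + T i ∈ L.lattice
  · rw [perP'' L g2, ← perP' L (z := z + T i) (w := w) (by convert g2 using 1; ring), ht]; ring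
  have c1 : z + T i + w = z + w + T i := by ring
  have c2 : z + T i - w = z - w + T i := by ring
  have D1 := hT.Diff hz hw h1 h2
  have D2 := hT.Diff hz' hw (by rwa [c1]) (by rwa [c2])
  rw [c1, c2] at D2
  have tA := hT.Tr hij hjk hik h1 g1
  have tB := hT.Tr hij hjk hik h2 g2
  have hb : (℘[L] (T j) - ℘[L] (T i)) * (℘[L] (T k) - ℘[L] (T i)) ≠ 0 :=
    mul_ne_zero (sub_ne_zero.2 (hT.e_inj hij.symm)) (sub_ne_zero.2 (hT.e_inj hik.symm))
  generalize (℘[L] (T j) - ℘[L] (T i)) * (℘[L] (T k) - ℘[L] (T i)) = b at *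
  generalize ℘[L] (T i) = a at *
  generalize ℘[L] (z + T i) = X' at *
  generalize ℘'[L] (z + T i) = Y' at *
  generalize ℘[L] (z + w + T i) = A' at *
  generalize ℘[L] (z + w) = A at *
  generalize ℘[L] (z - w + T i) = B' at *
  generalize ℘[L] (z - w) = B at *
  generalize ℘[L] z = X at *
  generalize ℘'[L] z = Y at *
  generalize ℘[L] w = W at *
  generalize ℘'[L] w = V at *
  have k1 : (X - a) ^ 2 * Y' = - (b * Y) := by linear_combination (X - a) * hdt - Y * ht
  have k2 : (X - a) * (X' - W) = b - (X - a) * (W - a) := by linear_combination ht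
  have k3 : (A - a) * (B - a) * (A' - B') = - (b * (A - B)) := by
    linear_combination (B - a) * tA - (A - a) * tB
  have k4 : (A - B) * ((X - a) * (X' - W)) ^ 2 * b = (A - a) * (B - a) * (- b * Y * V) := by
    linear_combination ((X - a) ^ 2 * (X' - W) ^ 2) * k3 - (A - a) * (B - a) * (X - a) ^ 2 * D2 + (A - a) * (B - a) * V * k1
  have k5 : A - B ≠ 0 := by
    intro h; rw [h, zero_mul] at D1
    exact neg_ne_zero.2 (mul_ne_zero dz dw) D1.symm
  apply mul_left_cancel₀ (mul_ne_zero k5 hb)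
  rw [k2] at k4
  linear_combination (-1) * k4 + (A - a) * (B - a) * b * D1

end WP3

section Iso
variable (L : PeriodPair)

theorem Iso_aux {β ρ : ℂ} {n : ℕ} (hβ : β ≠ 0) (hΛ : ∀ l ∈ L.lattice, β * l ∈ L.lattice)
    (hk : ∀ z, β * z ∈ L.lattice → ∃ k ∈ Finset.range (n + 1), z + k * ρ ∈ L.lattice)
    (hk' : β * ρ ∈ L.lattice)
    (hu : ∀ k < n, ((k + 1 : ℕ) : ℂ) * ρ ∉ L.lattice)
    {w w' : ℂ} (hw : Half L w) (hw' : Half L w') (hww : β * w - w' ∈ L.lattice) {z : ℂ} (hz : β * z ∉ L.lattice) :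
    ∏ k ∈ Finset.range (n + 1), (℘[L] (z + k * ρ) - ℘[L] w) =
      β ^ 2 * (∏ k ∈ Finset.range n, (℘[L] ((k + 1 : ℕ) * ρ) - ℘[L] w)) * (℘[L] (β * z) - ℘[L] w') := by
  have hkl : ∀ z : ℂ, ∀ k : ℕ, z + k * ρ ∈ L.lattice → β * z ∈ L.lattice := by
    intro z k h
    have := L.lattice.sub_mem (hΛ _ h) (L.lattice.smul_mem (k : ℤ) hk')
    simp only [zsmul_eq_mul, Int.cast_natCast] at this
    convert this using 1; ring
  -- uniqueness
  have hu2 : ∀ a b : ℕ, a < b → b < n + 1 → ∀ z : ℂ, z + a * ρ ∈ L.lattice → z + b * ρ ∉ L.lattice := by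
    intro a b hab hb z h1 h2
    apply hu (b - a - 1) (by omega)
    have := L.lattice.sub_mem h2 h1
    convert this using 1
    rw [show b - a - 1 + 1 = b - a by omega, Nat.cast_sub hab.le]; ring
  have hu3 : ∀ a b : ℕ, a ≠ b → a < n + 1 → b < n + 1 → ∀ z : ℂ, z + a * ρ ∈ L.lattice → z + b * ρ ∉ L.lattice := by
    intro a b hab ha hb z h1 h2
    rcases lt_or_gt_of_ne hab with h | h
    · exact hu2 a b h hb z h1 h2
    · exact hu2 b a h ha z h2 h1
  set F := fun z => (∏ k ∈ Finset.range (n + 1), (℘[L] (z + k * ρ) - ℘[L] w)) / (℘[L] (β * z) - ℘[L] w') with hF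
  have hden : ∀ z, β * z ∈ L.lattice → Ld (fun z => ℘[L] (β * z) - ℘[L] w') z (-2) (β ^ (-2 : ℤ)) := by
    intro z hz
    have := ldP_pole L (z0 := β * z) (w := 0) (by simpa using hz) (℘[L] w')
    simp only [add_zero] at this
    have := Ld.scale hβ this
    rwa [mul_one] at this
  have hreg2 : ∀ z, ∀ a ∈ Finset.range (n + 1), ∀ o c,
      Ld (fun z => ℘[L] (z + a * ρ) - ℘[L] w) z o c →
      (∀ b ∈ (Finset.range (n + 1)).erase a, z + b * ρ ∉ L.lattice) →
      Ld (fun z => ∏ k ∈ Finset.range (n + 1), (℘[L] (z + k * ρ) - ℘[L] w)) z o (c * ∏ k ∈ (Finset.range (n + 1)).erase a, (℘[L] (z + k * ρ) - ℘[L] w)) := by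
    intro z a ha o c h h'
    have h2 := Ld.prod ((Finset.range (n + 1)).erase a) (fun k z => ℘[L] (z + k * ρ) - ℘[L] w) z (fun _ => 0) _
      (fun b hb => ldP_reg L (h' b hb) _)
    have h3 := h.mul h2
    simp only [Finset.sum_const_zero, add_zero] at h3
    convert h3 using 2 with y
    exact (Finset.mul_prod_erase _ (fun k : ℕ => ℘[L] (y + k * ρ) - ℘[L] w) ha).symm
  have hpole : ∀ z, ∀ a ∈ Finset.range (n + 1), z + a * ρ ∈ L.lattice →
      Ld F z 0 (β ^ 2 * ∏ k ∈ (Finset.range (n + 1)).erase a, (℘[L] (z + k * ρ) - ℘[L] w)) := by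
    intro z a ha h
    have h1 := hreg2 z a ha _ _ (ldP_pole L h _) (fun b hb => by
      rw [Finset.mem_erase, Finset.mem_range] at hb
      exact hu3 a b hb.1.symm (Finset.mem_range.1 ha) hb.2 z h)
    have h2 := h1.div (hden z (hkl z a h)) (zpow_ne_zero _ hβ)
    simp only [sub_self, one_mul] at h2
    convert h2 using 1
    rw [zpow_neg, div_inv_eq_mul, mul_comm]; rfl
  have hβw : ∀ z, β * (z + w) ∈ L.lattice ↔ β * z + w' ∈ L.lattice := by
    intro z
    rw [show β * (z + w) = (β * z + w') + (β * w - w') by ring, nm_shift L hww]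
  have hper : ∀ l ∈ L.lattice, ∀ z, F (z + l) = F z := by
    intro l hl z
    simp only [hF, add_right_comm z l, perP L hl, mul_add, perP L (hΛ l hl)]
  obtain ⟨C, hC⟩ := liouville L F hper (by
    intro z
    by_cases hz : β * z ∈ L.lattice
    · obtain ⟨a, ha, h⟩ := hk z hz
      exact ⟨_, hpole z a ha h⟩
    have hno : ∀ b : ℕ, z + b * ρ ∉ L.lattice := fun b h => hz (hkl z b h)
    by_cases hq : β * z + w' ∈ L.lattice
    · obtain ⟨a, ha, h⟩ := hk _ ((hβw z).2 hq)
      obtain ⟨d, hd, h1⟩ := ldP_half L (z0 := z) (v := a * ρ) hw (by convert h using 1; ring)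
      have h2 := hreg2 z a ha _ _ h1 (fun b _ => hno b)
      obtain ⟨d', hd', h3⟩ := ldP_half L (z0 := β * z) (v := 0) hw' (by simpa using hq)
      simp only [add_zero] at h3
      have h4 := h2.div (Ld.scale hβ h3) (mul_ne_zero (zpow_ne_zero _ hβ) hd')
      exact ⟨_, h4⟩
    · have h2 := Ld.prod (Finset.range (n + 1)) (fun k z => ℘[L] (z + k * ρ) - ℘[L] w) z (fun _ => 0) _
        (fun b hb => ldP_reg L (hno b) _)
      have h3 := ldP_reg L (z0 := β * z) (w := 0) (by simpa using hz) (℘[L] w')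
      simp only [add_zero] at h3
      have h4 := h2.div (Ld.scale hβ h3) (by
        simp only [zpow_zero, one_mul]
        exact sub_ne_zero.2 fun he => hq (P_eq_half L hw' hz he))
      simp only [Finset.sum_const_zero, sub_zero] at h4
      exact ⟨_, h4⟩)
  have hCv := (hC 0).uniq (hpole 0 0 (by simp) (by simp))
  have e : ∏ k ∈ (Finset.range (n + 1)).erase 0, (℘[L] (0 + k * ρ) - ℘[L] w) = ∏ k ∈ Finset.range n, (℘[L] ((k + 1 : ℕ) * ρ) - ℘[L] w) := by
    rw [show (Finset.range (n + 1)).erase 0 = (Finset.range n).image Nat.succ by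
      rw [Finset.range_add_one']; simp [Finset.map_eq_image]; rfl]
    rw [Finset.prod_image (by intro a _ b _ h; simpa using h)]
    simp
  rw [e] at hCv
  rw [← hCv]
  have hno : ∀ b : ℕ, z + b * ρ ∉ L.lattice := fun b h => hz (hkl z b h)
  by_cases hq : β * z + w' ∈ L.lattice
  · obtain ⟨a, ha, h⟩ := hk _ ((hβw z).2 hq)
    rw [Finset.prod_eq_zero ha, perP'' L hq]
    · simp
    · rw [sub_eq_zero]; apply perP''; convert h using 1; ring
  have hne : ℘[L] (β * z) - ℘[L] w' ≠ 0 := sub_ne_zero.2 fun he => hq (P_eq_half L hw' hz he)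
  have an : AnalyticAt ℂ F z := by
    apply AnalyticAt.div
    · apply Finset.analyticAt_fun_prod
      intro k _
      exact (anPs L (hno k)).sub analyticAt_const
    · exact (AnalyticAt.comp (g := ℘[L]) (f := fun z => β * z) (anP L hz) (by fun_prop)).sub analyticAt_const
    · exact hne
  have := (hC z).eq_of_analytic an
  rw [← this, hF]
  exact (div_mul_cancel₀ _ hne).symm
end Iso

end Part11

section Part12
open Filter Topology
open scoped PeriodPair
set_option linter.all false

/-- elliptic functions on part of an elliptic curve -/
structure PE (K A : Type*) [Field K] [AddCommGroup A] where
  x : A → K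
  y : A → K
  e : Fin 3 → K
  e_inj : ∀ i j, i ≠ j → e i ≠ e j
  x_neg : ∀ z, x (-z) = x z
  y_neg : ∀ z, y (-z) = - y z
  ode : ∀ z, z ≠ 0 → y z ^ 2 = (x z - e 0) * (x z - e 1) * (x z - e 2)
  diff : ∀ z w, z ≠ 0 → w ≠ 0 → z + w ≠ 0 → z - w ≠ 0 →
    (x (z + w) - x (z - w)) * (x z - x w) ^ 2 = -4 * (y z * y w)
  prod : ∀ i z w, z ≠ 0 → w ≠ 0 → z + w ≠ 0 → z - w ≠ 0 →
    (x (z + w) - e i) * (x (z - w) - e i) * (x z - x w) ^ 2 =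
      ((x z - e i) * (x w - e i) - (e (i + 1) - e i) * (e (i + 2) - e i)) ^ 2
  dbl : ∀ i z, z + z ≠ 0 → (x (z + z) - e i) * (4 * y z ^ 2) =
      ((x z - e i) ^ 2 - (e (i + 1) - e i) * (e (i + 2) - e i)) ^ 2

structure EC (K A : Type*) [Field K] [AddCommGroup A] extends PE K A where
  T : Fin 3 → A
  T_ne : ∀ i, T i ≠ 0
  T_two : ∀ i, T i + T i = 0
  xT : ∀ i, x (T i) = e i
  tr : ∀ i z, z ≠ 0 → z + T i ≠ 0 → (x z - e i) * (x (z + T i) - e i) = (e (i + 1) - e i) * (e (i + 2) - e i)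

def PE.Iso {K A : Type*} [Field K] [AddCommGroup A] (E : PE K A) (φ : A →+ A) (C : K) (n : ℕ) (ρ : A) (τ : Fin 3) : Prop :=
  ∀ i z, φ z ≠ 0 → ∏ k ∈ Finset.range n, (E.x (z + k • ρ) - E.e i) =
    C * (∏ k ∈ Finset.Ico 1 n, (E.x (k • ρ) - E.e i)) * (E.x (φ z) - E.e (i + τ))

section
variable {K A : Type*} [Field K] [AddCommGroup A]

def PE.scale (E : PE K A) (a b c : K) (ha : a ≠ 0) (hc : c ^ 2 = a ^ 3) : PE K A where
  x := fun z => a * E.x z + b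
  y := fun z => c * E.y z
  e := fun i => a * E.e i + b
  e_inj := by
    intro i j hij h
    exact E.e_inj i j hij (mul_left_cancel₀ ha (add_right_cancel h))
  x_neg := by intro z; rw [E.x_neg]
  y_neg := by intro z; rw [E.y_neg]; ring
  ode := by intro z hz; rw [mul_pow, E.ode z hz, hc]; ring
  diff := by
    intro z w h1 h2 h3 h4
    have := E.diff z w h1 h2 h3 h4
    linear_combination a ^ 3 * this - 4 * E.y z * E.y w * hc * (-1)
  prod := by
    intro i z w h1 h2 h3 h4
    have := E.prod i z w h1 h2 h3 h4
    linear_combination a ^ 4 * this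
  dbl := by
    intro i z h
    have := E.dbl i z h
    linear_combination a ^ 4 * this + (a * E.x (z + z) - a * E.e i) * 4 * E.y z ^ 2 * hc

def EC.scale (E : EC K A) (a b c : K) (ha : a ≠ 0) (hc : c ^ 2 = a ^ 3) : EC K A where
  toPE := E.toPE.scale a b c ha hc
  T := E.T
  T_ne := E.T_ne
  T_two := E.T_two
  xT := by intro i; simp [PE.scale, E.xT]
  tr := by
    intro i z h1 h2
    have := E.tr i z h1 h2
    simp only [PE.scale]
    linear_combination a ^ 2 * this

theorem PE.Iso.scale {E : PE K A} {φ : A →+ A} {C : K} {n : ℕ} {ρ : A} {τ : Fin 3} (h : E.Iso φ C n ρ τ)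
    (hn : 0 < n) (a b c : K) (ha : a ≠ 0) (hc : c ^ 2 = a ^ 3) : (E.scale a b c ha hc).Iso φ C n ρ τ := by
  intro i z hz
  have := h i z hz
  simp only [PE.scale, add_sub_add_right_eq_sub, ← mul_sub, Finset.prod_mul_distrib, Finset.prod_const, Finset.card_range, Nat.card_Ico]
  obtain ⟨m, rfl⟩ : ∃ m, n = m + 1 := ⟨n - 1, by omega⟩
  rw [this, Nat.add_sub_cancel]; ring

end

section conc
variable {L : PeriodPair} {T : Fin 3 → ℂ}

abbrev Tor (L : PeriodPair) := ℂ ⧸ L.lattice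

theorem mk0 {z : ℂ} : (Submodule.Quotient.mk z : Tor L) = 0 ↔ z ∈ L.lattice := Submodule.Quotient.mk_eq_zero _

noncomputable def xQ (L : PeriodPair) (P : Tor L) : ℂ := ℘[L] P.out
noncomputable def yQ (L : PeriodPair) (P : Tor L) : ℂ := ℘'[L] P.out / 2

theorem out_sub (z : ℂ) : (Quotient.out (Submodule.Quotient.mk z : Tor L)) - z ∈ L.lattice := by
  have : (Submodule.Quotient.mk (Quotient.out (Submodule.Quotient.mk z : Tor L)) : Tor L) = Submodule.Quotient.mk z :=
    Quotient.out_eq _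
  exact (Submodule.Quotient.eq _).1 this

theorem xQ_mk (z : ℂ) : xQ L (Submodule.Quotient.mk z) = ℘[L] z := perP' L (out_sub z)
theorem yQ_mk (z : ℂ) : yQ L (Submodule.Quotient.mk z) = ℘'[L] z / 2 := by
  have := perdP L (out_sub (L := L) z) z
  rw [add_sub_cancel] at this
  rw [yQ, this]

theorem f3 (i : Fin 3) : i ≠ i + 1 ∧ i + 1 ≠ i + 2 ∧ i ≠ i + 2 := by decide +revert

noncomputable def HP.EC (hT : HP L T) : EC ℂ (Tor L) where
  x := xQ L
  y := yQ L
  e := fun i => ℘[L] (T i)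
  e_inj := fun i j h => hT.e_inj h
  x_neg := by
    intro z; induction z using Submodule.Quotient.induction_on with | _ z => ?_
    rw [← Submodule.Quotient.mk_neg, xQ_mk, xQ_mk, L.weierstrassP_neg]
  y_neg := by
    intro z; induction z using Submodule.Quotient.induction_on with | _ z => ?_
    rw [← Submodule.Quotient.mk_neg, yQ_mk, yQ_mk, L.derivWeierstrassP_neg]; ring
  ode := by
    intro z; induction z using Submodule.Quotient.induction_on with | _ z => ?_
    rw [Ne, mk0, xQ_mk, yQ_mk]
    intro h
    linear_combination (hT.ode h) / 4
  diff := by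
    intro z w
    induction z using Submodule.Quotient.induction_on with | _ z => ?_
    induction w using Submodule.Quotient.induction_on with | _ w => ?_
    rw [← Submodule.Quotient.mk_add, ← Submodule.Quotient.mk_sub]
    simp only [Ne, mk0, xQ_mk, yQ_mk]
    intro h1 h2 h3 h4
    linear_combination (hT.Diff h1 h2 h3 h4)
  prod := by
    intro i z w
    induction z using Submodule.Quotient.induction_on with | _ z => ?_
    induction w using Submodule.Quotient.induction_on with | _ w => ?_
    rw [← Submodule.Quotient.mk_add, ← Submodule.Quotient.mk_sub]
    simp only [Ne, mk0, xQ_mk, yQ_mk]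
    intro h1 h2 h3 h4
    exact (hT.Prod (f3 i).1 (f3 i).2.1 (f3 i).2.2 h1 h2 h3 h4)
  dbl := by
    intro i z
    induction z using Submodule.Quotient.induction_on with | _ z => ?_
    rw [← Submodule.Quotient.mk_add]
    simp only [Ne, mk0, xQ_mk, yQ_mk]
    intro h
    linear_combination (hT.Dbl (f3 i).1 (f3 i).2.1 (f3 i).2.2 h)
  T := fun i => Submodule.Quotient.mk (T i)
  T_ne := by intro i; rw [Ne, mk0]; exact (hT.half i).1
  T_two := by intro i; rw [← Submodule.Quotient.mk_add, mk0]; exact (hT.half i).2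
  xT := by intro i; rw [xQ_mk]
  tr := by
    intro i z
    induction z using Submodule.Quotient.induction_on with | _ z => ?_
    rw [← Submodule.Quotient.mk_add]
    simp only [Ne, mk0, xQ_mk, yQ_mk]
    intro h h'
    exact (hT.Tr (f3 i).1 (f3 i).2.1 (f3 i).2.2 h h')

/-- multiplication by `β` on the torus -/
noncomputable def mulT (β : ℂ) (hΛ : ∀ l ∈ L.lattice, β * l ∈ L.lattice) : Tor L →+ Tor L :=
  (Submodule.mapQ L.lattice L.lattice ((LinearMap.mulLeft ℂ β).restrictScalars ℤ) (fun l hl => hΛ l hl)).toAddMonoidHom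

theorem mulT_mk (β : ℂ) (hΛ : ∀ l ∈ L.lattice, β * l ∈ L.lattice) (z : ℂ) :
    mulT β hΛ (Submodule.Quotient.mk z) = Submodule.Quotient.mk (β * z) := rfl

theorem HP.iso (hT : HP L T) {β ρ : ℂ} {n : ℕ} (hn : 0 < n) (hβ : β ≠ 0) (hΛ : ∀ l ∈ L.lattice, β * l ∈ L.lattice)
    (hk : ∀ z, β * z ∈ L.lattice → ∃ k : ℕ, k < n ∧ z + k * ρ ∈ L.lattice)
    (hk' : β * ρ ∈ L.lattice)
    (hu : ∀ k : ℕ, 0 < k → k < n → (k : ℂ) * ρ ∉ L.lattice)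
    (τ : Fin 3) (hτ : ∀ i, β * T i - T (i + τ) ∈ L.lattice) :
    (hT.EC).toPE.Iso (mulT β hΛ) (β ^ 2) n (Submodule.Quotient.mk ρ) τ := by
  intro i z
  induction z using Submodule.Quotient.induction_on with | _ z => ?_
  obtain ⟨m, rfl⟩ : ∃ m, n = m + 1 := ⟨n - 1, by omega⟩
  rw [mulT_mk, Ne, mk0]
  intro h
  have key := Iso_aux L (n := m) hβ hΛ (fun z hz => by simpa using hk z hz) hk' (fun k hk => hu _ (by omega) (by omega)) (hT.half i) (hT.half (i + τ)) (hτ i) h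
  have hs : ∀ k : ℕ, k • (Submodule.Quotient.mk ρ : Tor L) = Submodule.Quotient.mk (k * ρ) := by
    intro k; rw [← Submodule.Quotient.mk_smul, nsmul_eq_mul]
  show ∏ k ∈ Finset.range (m + 1), (xQ L (Submodule.Quotient.mk z + k • Submodule.Quotient.mk ρ) - ℘[L] (T i)) = 
    β ^ 2 * (∏ k ∈ Finset.Ico 1 (m + 1), (xQ L (k • Submodule.Quotient.mk ρ) - ℘[L] (T i))) * (xQ L (Submodule.Quotient.mk (β * z)) - ℘[L] (T (i + τ)))
  simp only [hs, ← Submodule.Quotient.mk_add, xQ_mk]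
  rw [key, Finset.prod_Ico_eq_prod_range]
  simp [add_comm]

end conc

end Part12

section Part13
open Filter Topology
open scoped PeriodPair
set_option linter.all false

structure CMd (q0 : ℕ) (K A : Type*) [Field K] [AddCommGroup A] where
  E : EC K A
  α : A →+ A
  a : K
  ha : a ^ 2 = a - q0
  hα : ∀ P, α (α P) = α P - q0 • P
  αT : ∀ i, α (E.T i) = E.T (i + 1)
  ρ₁ : A
  ρ₂ : A
  ρ₃ : A
  o₁ : addOrderOf ρ₁ = q0
  o₂ : addOrderOf ρ₂ = q0 ^ 2
  o₃ : addOrderOf ρ₃ = q0 * (q0 + 2)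
  h₂₁ : q0 • ρ₂ = ρ₁
  h₃ : α (α ρ₃) = ρ₃
  ker : ∀ P, α P = 0 → ∃ k : ℕ, P + k • ρ₁ = 0
  iso₁ : E.Iso α (a ^ 2) q0 ρ₁ 1
  iso₂ : E.Iso (α.comp α) ((a ^ 2) ^ 2) (q0 ^ 2) ρ₂ 2
  iso₃ : E.Iso (α.comp α - AddMonoidHom.id A) ((a ^ 2 - 1) ^ 2) (q0 * (q0 + 2)) ρ₃ 1

section
variable (q0 : ℕ) (hq : 3 ≤ q0)

noncomputable def αC : ℂ := ⟨1 / 2, √(4 * q0 - 1) / 2⟩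

include hq in
theorem sq_pos' : 0 < √(4 * (q0 : ℝ) - 1) := by
  have : (3 : ℝ) ≤ q0 := by exact_mod_cast hq
  apply Real.sqrt_pos.2; linarith

include hq in
theorem αC_sq : αC q0 ^ 2 = αC q0 - q0 := by
  have : (3 : ℝ) ≤ q0 := by exact_mod_cast hq
  have h : √(4 * (q0 : ℝ) - 1) ^ 2 = 4 * q0 - 1 := Real.sq_sqrt (by linarith)
  apply Complex.ext
  · simp [αC, sq]; nlinarith
  · simp [αC, sq]; ring

include hq in
theorem αC_ind {u v : ℝ} (h : (u : ℂ) + v * αC q0 = 0) : u = 0 ∧ v = 0 := by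
  have h1 := congrArg Complex.im h
  have h2 := congrArg Complex.re h
  have := sq_pos' q0 hq
  simp [αC] at h1 h2
  have hv : v = 0 := by
    rcases h1 with h | h
    · exact h
    · exact absurd h this.ne'
  subst hv
  simpa using h2

noncomputable def LC (hq : 3 ≤ q0) : PeriodPair where
  ω₁ := 1
  ω₂ := αC q0
  indep := by
    rw [LinearIndependent.pair_iff]
    intro s t h
    apply αC_ind q0 hq
    simpa using h

theorem memLC {z : ℂ} : z ∈ (LC q0 hq).lattice ↔ ∃ m n : ℤ, (m : ℂ) + n * αC q0 = z := by
  rw [PeriodPair.mem_lattice]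
  simp [LC]

theorem LC_mul (a : ℤ) : ∀ l ∈ (LC q0 hq).lattice, (a + αC q0) * l ∈ (LC q0 hq).lattice := by
  intro l hl
  obtain ⟨m, n, rfl⟩ := (memLC q0 hq).1 hl
  apply (memLC q0 hq).2
  refine ⟨a * m - n * q0, a * n + m + n, ?_⟩
  push_cast
  linear_combination (-n : ℂ) * αC_sq q0 hq

noncomputable def TC : Fin 3 → ℂ := ![1 / 2, αC q0 / 2, (1 + αC q0) / 2]

include hq in
theorem half_not {u v : ℤ} (h : (u : ℂ) / 2 + v / 2 * αC q0 ∈ (LC q0 hq).lattice) : Even u ∧ Even v := by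
  obtain ⟨m, n, h⟩ := (memLC q0 hq).1 h
  have := αC_ind q0 hq (u := (m : ℝ) - u / 2) (v := (n : ℝ) - v / 2) (by push_cast; linear_combination h)
  constructor
  · exact ⟨m, by have : (u : ℝ) = m + m := by linarith
                 exact_mod_cast this⟩
  · exact ⟨n, by have : (v : ℝ) = n + n := by linarith
                 exact_mod_cast this⟩

theorem HPC : HP (LC q0 hq) (TC q0) where
  half := by
    intro i
    fin_cases i
    · refine ⟨fun h => ?_, (memLC q0 hq).2 ⟨1, 0, by simp [TC]; norm_num⟩⟩
      have := half_not q0 hq (u := 1) (v := 0) (by simpa [TC] using h)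
      simp at this
    · refine ⟨fun h => ?_, (memLC q0 hq).2 ⟨0, 1, by simp [TC]⟩⟩
      have := half_not q0 hq (u := 0) (v := 1) (by convert h using 1; simp [TC]; ring)
      simp at this
    · refine ⟨fun h => ?_, (memLC q0 hq).2 ⟨1, 1, by simp [TC]⟩⟩
      have := half_not q0 hq (u := 1) (v := 1) (by convert h using 1; simp [TC]; ring)
      simp at this
  inj := by
    intro i j hij h
    fin_cases i <;> fin_cases j <;> first | exact hij rfl | skip
    · have := half_not q0 hq (u := 1) (v := -1) (by convert h using 1; simp [TC]; ring)
      simp at this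
    · have := half_not q0 hq (u := 0) (v := -1) (by convert h using 1; simp [TC]; ring)
      simp at this
    · have := half_not q0 hq (u := -1) (v := 1) (by convert h using 1; simp [TC]; ring)
      simp at this
    · have := half_not q0 hq (u := -1) (v := 0) (by convert h using 1; simp [TC]; ring)
      simp at this
    · have := half_not q0 hq (u := 0) (v := 1) (by convert h using 1; simp [TC]; ring)
      simp at this
    · have := half_not q0 hq (u := 1) (v := 0) (by convert h using 1; simp [TC]; ring)
      simp at this
  sum := by
    have : TC q0 0 + TC q0 1 + TC q0 2 ∈ (LC q0 hq).lattice := (memLC q0 hq).2 ⟨1, 1, by simp [TC]; ring⟩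
    intro i j k h1 h2 h3
    fin_cases i <;> fin_cases j <;> fin_cases k <;> first | exact absurd rfl h1 | exact absurd rfl h2 | exact absurd rfl h3 | skip
    all_goals (convert this using 1; simp; try ring)

/-- α permutes half periods -/
theorem αT (hodd : Odd q0) (i : Fin 3) : αC q0 * TC q0 i - TC q0 (i + 1) ∈ (LC q0 hq).lattice := by
  have h2 := αC_sq q0 hq
  obtain ⟨r, hr⟩ := hodd
  have hr' : (q0 : ℂ) = 2 * r + 1 := by exact_mod_cast hr
  fin_cases i
  · exact (memLC q0 hq).2 ⟨0, 0, by simp [TC]; ring⟩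
  · exact (memLC q0 hq).2 ⟨-r - 1, 0, by simp [TC]; linear_combination -h2 / 2 + hr' / 2⟩
  · exact (memLC q0 hq).2 ⟨-r - 1, 1, by simp [TC]; linear_combination -h2 / 2 + hr' / 2⟩

variable (a : ℤ) (n : ℕ) (hn : (n : ℤ) = a ^ 2 + a + q0)

include hq hn in
theorem βbar : ((a : ℂ) + αC q0) * (a + 1 - αC q0) = n := by
  have : (n : ℂ) = a ^ 2 + a + q0 := by exact_mod_cast hn
  rw [this]; linear_combination -αC_sq q0 hq

include hq hn in
theorem n_pos : 0 < n := by
  have : (3 : ℤ) ≤ q0 := by exact_mod_cast hq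
  have : (0 : ℤ) < n := by rw [hn]; nlinarith [sq_nonneg (2 * a + 1)]
  exact_mod_cast this

include hq hn in
theorem β_ne : (a : ℂ) + αC q0 ≠ 0 := by
  intro h
  have := βbar q0 hq a n hn
  rw [h, zero_mul] at this
  have h2 := n_pos q0 hq a n hn
  exact h2.ne' (by exact_mod_cast this.symm)

include hq hn in
theorem nρ_mem : (n : ℂ) * ((a : ℂ) + αC q0)⁻¹ ∈ (LC q0 hq).lattice := by
  refine (memLC q0 hq).2 ⟨a + 1, -1, ?_⟩
  rw [← βbar q0 hq a n hn]
  field_simp [β_ne q0 hq a n hn]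
  push_cast; ring

include hq hn in
theorem kρ_not (k : ℕ) (h0 : 0 < k) (hk : k < n) : (k : ℂ) * ((a : ℂ) + αC q0)⁻¹ ∉ (LC q0 hq).lattice := by
  intro h
  obtain ⟨u, v, h⟩ := (memLC q0 hq).1 h
  have hb := βbar q0 hq a n hn
  have hne := β_ne q0 hq a n hn
  have e : (u + v * αC q0) * n = k * (a + 1 - αC q0) := by
    rw [h, ← hb]; field_simp
  have := αC_ind q0 hq (u := (u : ℝ) * n - k * (a + 1)) (v := (v : ℝ) * n + k) (by push_cast; linear_combination e)
  have h2 : v * n + k = 0 := by exact_mod_cast this.2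
  have : (n : ℤ) ∣ k := ⟨-v, by linear_combination h2⟩
  have := Int.le_of_dvd (by omega) this
  omega

include hq hn in
theorem ker_β (z : ℂ) (h : ((a : ℂ) + αC q0) * z ∈ (LC q0 hq).lattice) : ∃ k : ℕ, k < n ∧ z + k * ((a : ℂ) + αC q0)⁻¹ ∈ (LC q0 hq).lattice := by
  obtain ⟨m, l, h⟩ := (memLC q0 hq).1 h
  have hb := βbar q0 hq a n hn
  have hne := β_ne q0 hq a n hn
  have hn0 : (0 : ℤ) < n := by exact_mod_cast n_pos q0 hq a n hn
  have e : z = (m - l * a) * ((a : ℂ) + αC q0)⁻¹ + l := by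
    field_simp; linear_combination -h
  obtain ⟨k, hk⟩ := Int.eq_ofNat_of_zero_le (Int.emod_nonneg (-(m - l * a)) hn0.ne')
  refine ⟨k, ?_, ?_⟩
  · have := Int.emod_lt_of_pos (-(m - l * a)) hn0
    omega
  · have h1 := Int.emod_add_mul_ediv (-(m - l * a)) n
    rw [hk] at h1
    set d := -(m - l * a) / (n : ℤ)
    have h2 : (k : ℂ) + n * d = -(m - l * a) := by exact_mod_cast h1
    have h3 := (LC q0 hq).lattice.smul_mem (-d) (nρ_mem q0 hq a n hn)
    have h4 := (LC q0 hq).lattice.add_mem h3 ((memLC q0 hq).2 ⟨l, 0, by simp⟩ : (l : ℂ) ∈ _)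
    convert h4 using 1
    rw [e, zsmul_eq_mul]; push_cast
    linear_combination ((a : ℂ) + αC q0)⁻¹ * h2

noncomputable def mkρ : Tor (LC q0 hq) := Submodule.Quotient.mk ((a : ℂ) + αC q0)⁻¹

include hn in
theorem ord_ρ : addOrderOf (mkρ q0 hq a) = n := by
  rw [addOrderOf_eq_iff (n_pos q0 hq a n hn)]
  constructor
  · rw [mkρ, ← Submodule.Quotient.mk_smul, nsmul_eq_mul, mk0]; exact nρ_mem q0 hq a n hn
  · intro m hm h0
    rw [mkρ, ← Submodule.Quotient.mk_smul, nsmul_eq_mul, Ne, mk0]; exact kρ_not q0 hq a n hn m h0 hm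

include hn in
theorem iso_β (τ : Fin 3) (hτ : ∀ i, ((a : ℂ) + αC q0) * TC q0 i - TC q0 (i + τ) ∈ (LC q0 hq).lattice) :
    (HPC q0 hq).EC.toPE.Iso (mulT _ (LC_mul q0 hq a)) (((a : ℂ) + αC q0) ^ 2) n (mkρ q0 hq a) τ := by
  have hne := β_ne q0 hq a n hn
  apply HP.iso _ (n_pos q0 hq a n hn) hne
  · exact ker_β q0 hq a n hn
  · rw [mul_inv_cancel₀ hne]; exact (memLC q0 hq).2 ⟨1, 0, by simp⟩
  · exact kρ_not q0 hq a n hn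
  · exact hτ

noncomputable def theCM (hodd : Odd q0) : CMd q0 ℂ (Tor (LC q0 hq)) where
  E := (HPC q0 hq).EC
  α := mulT _ (LC_mul q0 hq 0)
  a := αC q0
  ha := αC_sq q0 hq
  hα := by
    intro P
    induction P using Submodule.Quotient.induction_on with | _ z => ?_
    simp only [mulT_mk, ← Submodule.Quotient.mk_smul, nsmul_eq_mul, ← Submodule.Quotient.mk_sub]
    congr 1; push_cast; linear_combination z * αC_sq q0 hq
  αT := by
    intro i
    show mulT _ (LC_mul q0 hq 0) (Submodule.Quotient.mk (TC q0 i)) = Submodule.Quotient.mk (TC q0 (i + 1))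
    rw [mulT_mk, Submodule.Quotient.eq]
    simpa using αT q0 hq hodd i
  ρ₁ := mkρ q0 hq 0
  ρ₂ := mkρ q0 hq (-q0)
  ρ₃ := mkρ q0 hq (-(1 + q0))
  o₁ := ord_ρ q0 hq _ _ (by ring)
  o₂ := ord_ρ q0 hq _ _ (by push_cast; ring)
  o₃ := ord_ρ q0 hq _ _ (by push_cast; ring)
  h₂₁ := by
    have h1 := β_ne q0 hq 0 q0 (by ring)
    have h2 := β_ne q0 hq (-q0) (q0 ^ 2) (by push_cast; ring)
    rw [mkρ, mkρ, ← Submodule.Quotient.mk_smul, nsmul_eq_mul, Submodule.Quotient.eq]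
    refine (memLC q0 hq).2 ⟨-1, 0, ?_⟩
    push_cast at *
    rw [zero_add] at *
    field_simp
    linear_combination -αC_sq q0 hq
  h₃ := by
    have h2 := β_ne q0 hq (-(1 + q0)) (q0 * (q0 + 2)) (by push_cast; ring)
    rw [mkρ]
    simp only [mulT_mk]
    rw [Submodule.Quotient.eq]
    refine (memLC q0 hq).2 ⟨1, 0, ?_⟩
    push_cast at *
    rw [zero_add]
    field_simp
    linear_combination -αC_sq q0 hq
  ker := by
    intro P
    induction P using Submodule.Quotient.induction_on with | _ z => ?_
    rw [mulT_mk, mk0]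
    intro h
    obtain ⟨k, -, hk⟩ := ker_β q0 hq 0 q0 (by ring) z h
    refine ⟨k, ?_⟩
    rw [mkρ, ← Submodule.Quotient.mk_smul, nsmul_eq_mul, ← Submodule.Quotient.mk_add, mk0]
    exact hk
  iso₁ := by
    have := iso_β q0 hq 0 q0 (by ring) 1 (by simpa using αT q0 hq hodd)
    simpa using this
  iso₂ := by
    have := iso_β q0 hq (-q0) (q0 ^ 2) (by push_cast; ring) 2 (by
      intro i
      have h1 := LC_mul q0 hq 0 _ (αT q0 hq hodd i)
      have h2 := (LC q0 hq).lattice.add_mem h1 (αT q0 hq hodd (i + 1))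
      rw [show i + 1 + 1 = i + 2 by rw [add_assoc]; rfl] at h2
      convert h2 using 1
      push_cast
      linear_combination -TC q0 i * αC_sq q0 hq)
    convert this using 1
    · ext P
      induction P using Submodule.Quotient.induction_on with | _ z => ?_
      simp only [AddMonoidHom.comp_apply, mulT_mk]
      congr 1; push_cast; linear_combination z * αC_sq q0 hq
    · congr 1; push_cast; linear_combination αC_sq q0 hq
  iso₃ := by
    have := iso_β q0 hq (-(1 + q0)) (q0 * (q0 + 2)) (by push_cast; ring) 1 (by
      intro i
      have h1 := (HPC q0 hq).half i
      have h5 := αT q0 hq hodd i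
      obtain ⟨r, hr⟩ : ∃ r, q0 = 2 * r + 1 := hodd
      have hr' : (q0 : ℂ) = 2 * r + 1 := by exact_mod_cast hr
      have h2 := (LC q0 hq).lattice.add_mem h5 ((LC q0 hq).lattice.smul_mem (-(r + 1) : ℤ) h1.2)
      convert h2 using 1
      rw [zsmul_eq_mul]
      push_cast
      linear_combination (-TC q0 i) * hr')
    convert this using 1
    · ext P
      induction P using Submodule.Quotient.induction_on with | _ z => ?_
      simp only [AddMonoidHom.sub_apply, AddMonoidHom.comp_apply, mulT_mk, AddMonoidHom.id_apply, ← Submodule.Quotient.mk_sub]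
      congr 1; push_cast; linear_combination z * αC_sq q0 hq
    · congr 1; push_cast; linear_combination αC_sq q0 hq
end

end Part13

section Part14
set_option linter.all false

section
variable {K A : Type*} [Field K] [AddCommGroup A]

theorem three_cases {i j k : Fin 3} (h1 : i ≠ j) (h2 : j ≠ k) (h3 : i ≠ k) :
    (i = j + 1 ∧ k = j + 2) ∨ (k = j + 1 ∧ i = j + 2) := by decide +revert

theorem EC.tr' (E : EC K A) {i j k : Fin 3} (h1 : i ≠ j) (h2 : j ≠ k) (h3 : i ≠ k) {z : A} (hz : z ≠ 0) (hz' : z + E.T j ≠ 0) :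
    (E.x (E.T j + z) - E.e i) * (E.x z - E.e j) = (E.e j - E.e i) * (E.x z - E.e k) := by
  have := E.tr j z hz hz'
  rw [add_comm (E.T j) z]
  rcases three_cases h1 h2 h3 with ⟨rfl, rfl⟩ | ⟨rfl, rfl⟩ <;> linear_combination this

/-- points of odd order -/
def OddO (P : A) : Prop := ∃ n : ℕ, Odd n ∧ n • P = 0

theorem OddO.add_T {E : EC K A} {P : A} (h : OddO P) (h0 : P ≠ 0) (i : Fin 3) : P + E.T i ≠ 0 := by
  intro h1
  obtain ⟨n, ⟨m, rfl⟩, hn⟩ := h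
  have h2 : P + P = 0 := by
    have : P = - E.T i := eq_neg_of_add_eq_zero_left h1
    rw [this, ← neg_add, E.T_two, neg_zero]
  apply h0
  rw [add_smul, mul_comm, mul_smul, two_smul, h2, smul_zero, zero_add, one_smul] at hn
  exact hn

theorem OddO.pow2 {P : A} (h : OddO P) : ∃ m : ℕ, 2 ^ (m + 1) • P = P := by
  obtain ⟨n, ho, hn⟩ := h
  have hpos : 0 < n := ho.pos
  refine ⟨n.totient - 1, ?_⟩
  rw [Nat.sub_add_cancel (Nat.totient_pos.2 hpos)]
  have h1 : 2 ^ n.totient ≡ 1 [MOD n] := Nat.ModEq.pow_totient (Nat.coprime_two_left.2 ho)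
  have h2 : 1 ≤ 2 ^ n.totient := Nat.one_le_two_pow
  obtain ⟨c, hc⟩ := (Nat.modEq_iff_dvd' h2).1 h1.symm
  have : 2 ^ n.totient = n * c + 1 := by omega
  rw [this, add_smul, mul_comm, mul_smul, hn, smul_zero, zero_add, one_smul]

theorem dbl_closed {S : A → Prop} (hS : ∀ P, S P → P + P ≠ 0 → S (P + P)) {P : A} (hP : S P) (m : ℕ) (h : 2 ^ m • P ≠ 0) : S (2 ^ m • P) := by
  induction m with
  | zero => simpa using hP
  | succ m ih =>
    have e : 2 ^ (m + 1) • P = 2 ^ m • P + 2 ^ m • P := by rw [pow_succ, mul_comm, mul_smul, two_smul]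
    rw [e] at h ⊢
    exact hS _ (ih (fun h0 => h (by rw [h0, add_zero]))) h

theorem dbl_back {S : A → Prop} (hS : ∀ P, S P → P + P ≠ 0 → S (P + P)) {P Q : A} (h0 : P ≠ 0) (ho : OddO P) (hQ : S Q)
    (h : Q + Q = P + P) : S P := by
  obtain ⟨m, hm⟩ := ho.pow2
  have e : 2 ^ (m + 1) • Q = P := by
    rw [pow_succ, mul_smul, two_smul, h, ← two_smul ℕ P, ← mul_smul, ← pow_succ, hm]
  rw [← e]
  exact dbl_closed hS hQ _ (by rw [e]; exact h0)

theorem dbl_back' {S : A → Prop} (hS : ∀ P, S P → P + P ≠ 0 → S (P + P)) {P : A} (h0 : P ≠ 0) (ho : OddO P) (hQ : S (P + P)) : S P := by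
  obtain ⟨m, hm⟩ := ho.pow2
  have e : 2 ^ m • (P + P) = P := by
    rw [← two_smul ℕ P, ← mul_smul, ← pow_succ, hm]
  rw [← e]
  exact dbl_closed hS hQ _ (by rw [e]; exact h0)

def EC.Y (E : EC K A) (n : ℕ) (ρ : A) (i : Fin 3) : K := ∏ k ∈ Finset.Ico 1 n, (E.x (k • ρ) - E.e i)

/-- n = order odd -/
theorem ord_facts {n : ℕ} {ρ : A} (ho : Odd n) (hρ : addOrderOf ρ = n) : ∀ k ∈ Finset.Ico 1 n, k • ρ ≠ 0 ∧ OddO (k • ρ) := by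
  intro k hk
  rw [Finset.mem_Ico] at hk
  refine ⟨fun h => ?_, n, ho, ?_⟩
  · exact absurd (Nat.le_of_dvd (by omega) (addOrderOf_dvd_of_nsmul_eq_zero h)) (by omega)
  · rw [← hρ, smul_comm, addOrderOf_nsmul_eq_zero, smul_zero]

theorem EC.x_ne_e (E : EC K A) {P : A} (h0 : P ≠ 0) (ho : OddO P) (i : Fin 3) : E.x P - E.e i ≠ 0 := by
  intro h
  have := E.tr i P h0 (ho.add_T h0 i)
  rw [h, zero_mul] at this
  exact mul_ne_zero (sub_ne_zero.2 (E.e_inj _ _ (f3 i).1.symm)) (sub_ne_zero.2 (E.e_inj _ _ (f3 i).2.2.symm)) this.symm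

theorem EC.Dform (E : EC K A) {φ : A →+ A} {C : K} {n : ℕ} {ρ : A} {τ : Fin 3} (h : E.Iso φ C n ρ τ) (ho : Odd n)
    (hρ : addOrderOf ρ = n) (hφ : ∀ i, φ (E.T i) = E.T (i + τ)) {i j k : Fin 3} (h1 : i ≠ j) (h2 : j ≠ k) (h3 : i ≠ k) :
    (E.e j - E.e i) ^ n * E.Y n ρ k = C * E.Y n ρ i * E.Y n ρ j * (E.e (j + τ) - E.e (i + τ)) := by
  have hn := ho.pos
  have key := h i (E.T j) (by rw [hφ]; exact E.T_ne _)
  rw [hφ, E.xT, Finset.range_eq_Ico, Finset.prod_eq_prod_Ico_succ_bot hn, zero_smul, add_zero, E.xT, zero_add] at key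
  have hof := ord_facts ho hρ
  have e : (∏ k ∈ Finset.Ico 1 n, (E.x (E.T j + k • ρ) - E.e i)) * E.Y n ρ j = (E.e j - E.e i) ^ (n - 1) * E.Y n ρ k := by
    rw [EC.Y, EC.Y, ← Finset.prod_mul_distrib, ← Nat.card_Ico, ← Finset.prod_const, ← Finset.prod_mul_distrib]
    apply Finset.prod_congr rfl
    intro m hm
    exact E.tr' h1 h2 h3 (hof m hm).1 ((hof m hm).2.add_T (hof m hm).1 j)
  obtain ⟨m, rfl⟩ : ∃ m, n = m + 1 := ⟨n - 1, by omega⟩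
  rw [Nat.add_sub_cancel] at e
  change _ = C * E.Y (m + 1) ρ i * _ at key
  rw [pow_succ]
  linear_combination E.Y (m + 1) ρ j * key - (E.e j - E.e i) * e

theorem EC.Y_ne (E : EC K A) {n : ℕ} {ρ : A} (ho : Odd n) (hρ : addOrderOf ρ = n) (i : Fin 3) : E.Y n ρ i ≠ 0 :=
  Finset.prod_ne_zero_iff.2 fun k hk => E.x_ne_e (ord_facts ho hρ k hk).1 (ord_facts ho hρ k hk).2 i

variable {Γ : Type*} [LinearOrderedCommGroupWithZero Γ] (v : Valuation K Γ)

theorem vsub_lt {a b : K} (h : v a < v b) : v (b - a) = v b := Valuation.map_sub_eq_of_lt_left v h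

theorem fin_e (E : PE K A) (z : A) (hz : z ≠ 0) (i : Fin 3) : E.y z ^ 2 = (E.x z - E.e i) * (E.x z - E.e (i + 1)) * (E.x z - E.e (i + 2)) := by
  rw [E.ode z hz]
  fin_cases i
  · rfl
  · show _ = (E.x z - E.e 1) * (E.x z - E.e 2) * (E.x z - E.e 0); ring
  · show _ = (E.x z - E.e 2) * (E.x z - E.e 0) * (E.x z - E.e 1); ring

variable (hv2 : v 2 = 1)
include hv2

theorem v4 : v 4 = 1 := by rw [show (4 : K) = 2 * 2 by norm_num, map_mul, hv2, one_mul]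

/-- bad reduction is impossible: auxiliary -/
theorem EC.bad1 (E : EC K A) (i : Fin 3) (h : v (E.e (i + 1) - E.e i) < v (E.e (i + 2) - E.e i)) {P : A}
    (hr : v (E.e (i + 2) - E.e i) ≤ v (E.x P - E.e i)) (h2 : P + P ≠ 0) :
    v (E.e (i + 2) - E.e i) ≤ v (E.x (P + P) - E.e i) := by
  have h0 : P ≠ 0 := by rintro rfl; simp at h2
  have hd := E.dbl i P h2
  have ho := fin_e E.toPE P h0 i
  set r := v (E.x P - E.e i) with hrdef
  set D := v (E.e (i + 2) - E.e i)
  have hDpos : 0 < D := lt_of_le_of_lt zero_le' h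
  have hrpos : 0 < r := lt_of_lt_of_le hDpos hr
  have e1 : v (E.x P - E.e (i + 1)) = r := by
    rw [show E.x P - E.e (i + 1) = (E.x P - E.e i) - (E.e (i + 1) - E.e i) by ring]
    exact vsub_lt v (lt_of_lt_of_le h hr)
  have e2 : v (E.x P - E.e (i + 2)) ≤ r := by
    rw [show E.x P - E.e (i + 2) = (E.x P - E.e i) - (E.e (i + 2) - E.e i) by ring]
    exact v.map_sub_le le_rfl hr
  have e3 : v ((E.x P - E.e i) ^ 2 - (E.e (i + 1) - E.e i) * (E.e (i + 2) - E.e i)) = r ^ 2 := by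
    rw [vsub_lt, map_pow]
    rw [map_mul, map_pow, sq]
    exact mul_lt_mul (lt_of_lt_of_le h hr) hr hDpos zero_le'
  have e4 := congrArg v hd
  rw [map_pow, e3, map_mul, map_mul, v4 v hv2, one_mul, ho, map_mul, map_mul, e1, ← hrdef] at e4
  by_contra hlt
  push Not at hlt
  have hX := lt_of_lt_of_le hlt hr
  have : v (E.x (P + P) - E.e i) * (r * r * v (E.x P - E.e (i + 2))) < (r ^ 2) ^ 2 := by
    calc _ ≤ v (E.x (P + P) - E.e i) * (r * r * r) := by gcongr
      _ < r * (r * r * r) := mul_lt_mul hX le_rfl (by positivity) zero_le'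
      _ = _ := by simp only [pow_two, mul_assoc]
  exact absurd e4 this.ne

/-- valuations agree on odd points -/
theorem EC.bad2 (E : EC K A) (i : Fin 3) (h : v (E.e (i + 1) - E.e i) < v (E.e (i + 2) - E.e i)) {P : A}
    (h0 : P ≠ 0) (ho : OddO P) : v (E.x P - E.e i) = v (E.x P - E.e (i + 1)) := by
  set D := v (E.e (i + 2) - E.e i) with hD
  have hDpos : 0 < D := lt_of_le_of_lt zero_le' h
  by_cases hc : v (E.e (i + 1) - E.e i) < v (E.x P - E.e i)
  · rw [show E.x P - E.e (i + 1) = (E.x P - E.e i) - (E.e (i + 1) - E.e i) by ring, vsub_lt v hc]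
  · push Not at hc
    exfalso
    have hT := ho.add_T (E := E) h0 i
    have key := congrArg v (E.tr i P h0 hT)
    rw [map_mul, map_mul] at key
    have hge : D ≤ v (E.x (P + E.T i) - E.e i) := by
      by_contra hlt
      push Not at hlt
      have hpos : 0 < v (E.e (i + 1) - E.e i) := by
        rw [zero_lt_iff, Valuation.ne_zero_iff]; exact sub_ne_zero.2 (E.e_inj _ _ (f3 i).1.symm)
      have : v (E.x P - E.e i) * v (E.x (P + E.T i) - E.e i) < v (E.e (i + 1) - E.e i) * D := by
        rw [mul_comm, mul_comm _ D]
        refine mul_lt_mul hlt hc ?_ zero_le'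
        rw [zero_lt_iff, Valuation.ne_zero_iff]; exact E.x_ne_e h0 ho i
      exact absurd key this.ne
    have := dbl_back (S := fun Q => D ≤ v (E.x Q - E.e i)) (fun Q hQ hQQ => E.bad1 v hv2 i h hQ hQQ) h0 ho hge
      (by rw [add_add_add_comm, E.T_two, add_zero])
    exact absurd (this.trans hc) (not_le.2 h)

theorem EC.good1 (E : EC K A) {φ : A →+ A} {C : K} {n : ℕ} {ρ : A} (hI : E.Iso φ C n ρ 1) (ho : Odd n)
    (hρ : addOrderOf ρ = n) (hφ : ∀ i, φ (E.T i) = E.T (i + 1)) (i : Fin 3) :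
    v (E.e (i + 2) - E.e i) ≤ v (E.e (i + 1) - E.e i) := by
  by_contra h
  push Not at h
  set D := v (E.e (i + 2) - E.e i) with hD
  have hDpos : 0 < D := lt_of_le_of_lt zero_le' h
  have hD2 : v (E.e (i + 2) - E.e (i + 1)) = D := by
    rw [show E.e (i + 2) - E.e (i + 1) = (E.e (i + 2) - E.e i) - (E.e (i + 1) - E.e i) by ring, vsub_lt v h]
  have hY : v (E.Y n ρ i) = v (E.Y n ρ (i + 1)) := by
    rw [EC.Y, EC.Y, map_prod, map_prod]
    exact Finset.prod_congr rfl fun k hk => E.bad2 v hv2 i h (ord_facts ho hρ k hk).1 (ord_facts ho hρ k hk).2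
  obtain ⟨f1, f2, f3'⟩ := f3 i
  have a1 := congrArg v (E.Dform hI ho hρ hφ f2 f3'.symm f1.symm)
  have a2 := congrArg v (E.Dform hI ho hρ hφ f3' f2.symm f1)
  have t1 : i + 2 + 1 = i := by clear * - ; decide +revert
  have t2 : i + 1 + 1 = i + 2 := by clear * - ; decide +revert
  simp only [map_mul, map_pow, t1, t2, hD2, ← hY, ← hD] at a1 a2
  rw [v.map_sub_swap, ← hD] at a1
  rw [v.map_sub_swap (E.e i), ] at a2
  rw [a1] at a2
  have hCY : v C * v (E.Y n ρ i) * v (E.Y n ρ (i + 2)) ≠ 0 := by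
    intro hz
    rw [hz, zero_mul] at a1
    exact mul_ne_zero (pow_ne_zero _ hDpos.ne') ((Valuation.ne_zero_iff v).2 (E.Y_ne ho hρ i)) a1
  exact absurd (mul_left_cancel₀ hCY a2) h.ne'

theorem EC.good (E : EC K A) {φ : A →+ A} {C : K} {n : ℕ} {ρ : A} (hI : E.Iso φ C n ρ 1) (ho : Odd n)
    (hρ : addOrderOf ρ = n) (hφ : ∀ i, φ (E.T i) = E.T (i + 1)) :
    ∀ i j, i ≠ j → v (E.e j - E.e i) = v (E.e 1 - E.e 0) := by
  have h0 : v (E.e 2 - E.e 0) ≤ v (E.e 1 - E.e 0) := E.good1 v hv2 hI ho hρ hφ 0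
  have h1 : v (E.e 0 - E.e 1) ≤ v (E.e 2 - E.e 1) := E.good1 v hv2 hI ho hρ hφ 1
  have h2 : v (E.e 1 - E.e 2) ≤ v (E.e 0 - E.e 2) := E.good1 v hv2 hI ho hρ hφ 2
  have s01 := v.map_sub_swap (E.e 0) (E.e 1)
  have s12 := v.map_sub_swap (E.e 1) (E.e 2)
  have s02 := v.map_sub_swap (E.e 0) (E.e 2)
  rw [s01] at h1
  rw [s12, s02] at h2
  have g1 := le_antisymm h0 (h1.trans h2)
  have g2 := le_antisymm (h2.trans h0) h1
  intro i j hij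
  fin_cases i <;> fin_cases j <;> simp_all
end

end Part14

section Part15
set_option linter.all false

section
variable {K A : Type*} [Field K] [AddCommGroup A] {Γ : Type*} [LinearOrderedCommGroupWithZero Γ]

structure GoodV (v : Valuation K Γ) (E : EC K A) : Prop where
  two : v 2 = 1
  le : ∀ i, v (E.e i) ≤ 1
  un : ∀ i j, i ≠ j → v (E.e j - E.e i) = 1

variable {v : Valuation K Γ} {E : EC K A} (G : GoodV v E)
include G

theorem GoodV.big {x : K} (h : 1 < v x) (i : Fin 3) : v (x - E.e i) = v x := vsub_lt v (lt_of_le_of_lt (G.le i) h)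
theorem GoodV.small {x : K} (h : v x ≤ 1) (i : Fin 3) : v (x - E.e i) ≤ 1 := v.map_sub_le h (G.le i)
theorem GoodV.small' {x : K} {i : Fin 3} (h : 1 < v (x - E.e i)) : 1 < v x := by
  by_contra hc
  exact absurd (G.small (not_lt.1 hc) i) (not_le.2 h)

theorem GoodV.dd (i : Fin 3) : v ((E.e (i + 1) - E.e i) * (E.e (i + 2) - E.e i)) = 1 := by
  rw [map_mul, G.un _ _ (f3 i).1, G.un _ _ (f3 i).2.2, one_mul]

theorem GoodV.y2 {P : A} (h0 : P ≠ 0) (h : 1 < v (E.x P)) : v (E.y P ^ 2) = v (E.x P) ^ 3 := by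
  rw [E.ode P h0, map_mul, map_mul, G.big h, G.big h, G.big h, pow_three, mul_assoc]

theorem GoodV.dblH {P : A} (h2 : P + P ≠ 0) (h : 1 < v (E.x P)) : 1 < v (E.x (P + P)) := by
  have h0 : P ≠ 0 := by rintro rfl; simp at h2
  have hd := congrArg v (E.dbl 0 P h2)
  have hr : 0 < v (E.x P) := zero_lt_one.trans h
  have hlt : v ((E.e (0 + 1) - E.e 0) * (E.e (0 + 2) - E.e 0)) < v ((E.x P - E.e 0) ^ 2) := by
    rw [G.dd, map_pow, G.big h]; exact one_lt_pow₀ h two_ne_zero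
  rw [map_mul, map_mul, v4 v G.two, one_mul, G.y2 h0 h, map_pow, vsub_lt v hlt, map_pow, G.big h] at hd
  · apply G.small' (i := 0)
    have : v (E.x (P + P) - E.e 0) = v (E.x P) := by
      apply mul_right_cancel₀ (pow_ne_zero 3 hr.ne')
      rw [hd, ← pow_mul, ← pow_succ']
    rwa [this]

theorem GoodV.addH {P Q : A} (hP : P ≠ 0) (hQ : Q ≠ 0) (h1 : P + Q ≠ 0) (h2 : P - Q ≠ 0) (hr : 1 < v (E.x P)) (hs : 1 < v (E.x Q)) :
    1 < v (E.x (P + Q)) := by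
  by_contra hA
  rw [not_lt] at hA
  have hp := congrArg v (E.prod 0 P Q hP hQ h1 h2)
  have hrs : 1 < v (E.x P) * v (E.x Q) := one_lt_mul'' hr hs
  have hd := congrArg v (E.diff P Q hP hQ h1 h2)
  have hδ : v (E.x P - E.x Q) < v (E.x P) * v (E.x Q) := by
    refine lt_of_le_of_lt (v.map_sub _ _) (max_lt ?_ ?_)
    · exact lt_mul_of_one_lt_right (zero_lt_one.trans hr) hs
    · exact lt_mul_of_one_lt_left (zero_lt_one.trans hs) hr
  have hlt : v ((E.e (0 + 1) - E.e 0) * (E.e (0 + 2) - E.e 0)) < v ((E.x P - E.e 0) * (E.x Q - E.e 0)) := by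
    rw [G.dd, map_mul, G.big hr, G.big hs]; exact hrs
  rw [map_mul, map_mul, map_pow, map_pow, vsub_lt v hlt, map_mul, G.big hr, G.big hs] at hp
  rw [map_mul, map_pow, map_mul, Valuation.map_neg, v4 v G.two, one_mul] at hd
  have hyy : v (E.y P * E.y Q) ^ 2 = (v (E.x P) * v (E.x Q)) ^ 3 := by
    rw [← map_pow, mul_pow, map_mul, G.y2 hP hr, G.y2 hQ hs, mul_pow]
  set δ := v (E.x P - E.x Q)
  set w := v (E.x P) * v (E.x Q)
  have hA' := G.small hA 0
  rcases le_or_gt (v (E.x (P - Q))) 1 with hB | hB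
  · have hB' := G.small hB 0
    have : v (E.x (P + Q) - E.e 0) * v (E.x (P - Q) - E.e 0) * δ ^ 2 < w ^ 2 := by
      calc _ ≤ 1 * 1 * δ ^ 2 := by gcongr
        _ = δ ^ 2 := by simp
        _ < w ^ 2 := pow_lt_pow_left₀ hδ zero_le' two_ne_zero
    exact absurd hp this.ne
  · rw [v.map_sub_swap, vsub_lt v (lt_of_le_of_lt hA hB)] at hd
    rw [G.big hB, mul_assoc, hd] at hp
    have h4 : v (E.x (P + Q) - E.e 0) ^ 2 * w ^ 3 = w * w ^ 3 := by
      rw [← hyy, ← mul_pow, hp, hyy, ← pow_mul, ← pow_succ']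
    have h5 := mul_right_cancel₀ (pow_ne_zero 3 (zero_lt_one.trans hrs).ne') h4
    have h6 : v (E.x (P + Q) - E.e 0) ^ 2 ≤ 1 := pow_le_one₀ zero_le' hA'
    rw [h5] at h6
    exact absurd h6 (not_le.2 hrs)

/-- kernel of reduction -/
def GoodV.H : AddSubgroup A where
  carrier := {P | P = 0 ∨ 1 < v (E.x P)}
  zero_mem' := Or.inl rfl
  neg_mem' := by
    rintro P (rfl | h)
    · left; simp
    · right; rwa [E.x_neg]
  add_mem' := by
    rintro P Q hP hQ
    by_cases hP0 : P = 0
    · rw [hP0, zero_add]; exact hQ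
    by_cases hQ0 : Q = 0
    · rw [hQ0, add_zero]; exact hP
    by_cases h1 : P + Q = 0
    · left; exact h1
    right
    by_cases h2 : P - Q = 0
    · rw [← sub_eq_zero.1 h2] at h1 ⊢
      exact G.dblH h1 (hP.resolve_left hP0)
    · exact G.addH hP0 hQ0 h1 h2 (hP.resolve_left hP0) (hQ.resolve_left hQ0)

theorem GoodV.mem_H {P : A} : P ∈ G.H ↔ P = 0 ∨ 1 < v (E.x P) := Iff.rfl

theorem GoodV.nH {P : A} (h : P ∉ G.H) : P ≠ 0 ∧ v (E.x P) ≤ 1 := by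
  rw [G.mem_H, not_or, not_lt] at h; exact h

theorem OddO.two_ne {P : A} (h : OddO P) (h0 : P ≠ 0) : P + P ≠ 0 := by
  intro h2
  obtain ⟨n, ⟨m, rfl⟩, hn⟩ := h
  rw [add_smul, mul_comm, mul_smul, two_smul, h2, smul_zero, zero_add, one_smul] at hn
  exact h0 hn

theorem GoodV.oddv {P : A} (h0 : P ≠ 0) (ho : OddO P) (i : Fin 3) : v (E.x P - E.e i) = max 1 (v (E.x P)) := by
  rcases le_or_gt (v (E.x P)) 1 with hx | hx
  · rw [max_eq_left hx]
    refine le_antisymm (G.small hx i) (not_lt.1 fun hlt => ?_)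
    have h2 := OddO.two_ne G ho h0
    have hd := congrArg v (E.dbl i P h2)
    have hl2 : v ((E.x P - E.e i) ^ 2) < v ((E.e (i + 1) - E.e i) * (E.e (i + 2) - E.e i)) := by
      rw [G.dd, map_pow]; exact pow_lt_one₀ zero_le' hlt two_ne_zero
    rw [fin_e E.toPE P h0 i, map_mul, map_mul, v4 v G.two, one_mul, map_pow, v.map_sub_swap _ (_ * _), vsub_lt v hl2, G.dd, one_pow] at hd
    · have hy : v ((E.x P - E.e i) * (E.x P - E.e (i + 1)) * (E.x P - E.e (i + 2))) < 1 := by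
        rw [map_mul, map_mul]
        calc _ ≤ v (E.x P - E.e i) * 1 * 1 := by gcongr <;> exact G.small hx _
          _ < 1 := by simpa using hlt
      have h3 : 1 < v (E.x (P + P) - E.e i) := by
        by_contra hc
        rw [not_lt] at hc
        have := mul_le_mul' hc (le_refl (v ((E.x P - E.e i) * (E.x P - E.e (i + 1)) * (E.x P - E.e (i + 2)))))
        rw [hd, one_mul] at this
        exact absurd this (not_le.2 hy)
      have := dbl_back' (S := fun P => 1 < v (E.x P)) (fun P hP h2 => G.dblH h2 hP) h0 ho (G.small' h3)
      exact absurd this (not_lt.2 hx)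
  · rw [max_eq_right hx.le, G.big hx]

theorem GoodV.CY {φ : A →+ A} {C : K} {n : ℕ} {ρ : A} {τ : Fin 3} (h : E.Iso φ C n ρ τ) (ho : Odd n)
    (hρ : addOrderOf ρ = n) (hφ : ∀ i, φ (E.T i) = E.T (i + τ)) :
    v C * ∏ k ∈ Finset.Ico 1 n, max 1 (v (E.x (k • ρ))) = 1 := by
  have hY : ∀ i, v (E.Y n ρ i) = ∏ k ∈ Finset.Ico 1 n, max 1 (v (E.x (k • ρ))) := by
    intro i
    rw [EC.Y, map_prod]
    exact Finset.prod_congr rfl fun k hk => G.oddv (ord_facts ho hρ k hk).1 (ord_facts ho hρ k hk).2 i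
  have hD := congrArg v (E.Dform h ho hρ hφ (i := 0) (j := 1) (k := 2) (by decide) (by decide) (by decide))
  have hne : v (E.Y n ρ 0) ≠ 0 := (Valuation.ne_zero_iff v).2 (E.Y_ne ho hρ 0)
  rw [hY 0] at hne
  rw [map_mul, map_pow, map_mul, map_mul, map_mul, G.un _ _ (by decide), hY, hY, hY, G.un _ _ (by clear * -; decide +revert), one_pow, one_mul, mul_one] at hD
  apply mul_right_cancel₀ hne
  rw [one_mul]; exact hD.symm

theorem GoodV.H3 {φ : A →+ A} {C : K} {n : ℕ} {ρ : A} {τ : Fin 3} (h : E.Iso φ C n ρ τ) (ho : Odd n)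
    (hρ : addOrderOf ρ = n) (hφ : ∀ i, φ (E.T i) = E.T (i + τ)) (hC : v C = 1) :
    ∀ P ∈ AddSubgroup.zmultiples ρ, P ∈ G.H → P = 0 := by
  classical
  intro P hP hPH
  by_contra hP0
  have hfin : IsOfFinAddOrder ρ := addOrderOf_pos_iff.1 (by rw [hρ]; exact ho.pos)
  obtain ⟨k, hk, hkP⟩ := (hfin.mem_zmultiples_iff_mem_range_addOrderOf).1 hP |> Finset.mem_image.1
  rw [Finset.mem_range, hρ] at hk
  have hk0 : k ≠ 0 := by rintro rfl; exact hP0 (by rw [← hkP, zero_smul])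
  have hcy := G.CY h ho hρ hφ
  rw [hC, one_mul] at hcy
  have := (Finset.prod_eq_one_iff_of_one_le' (fun i _ => le_max_left _ _)).1 hcy k (by rw [Finset.mem_Ico]; omega)
  rw [hkP] at this
  have h1 := hPH.resolve_left hP0
  rw [max_eq_right h1.le] at this
  exact absurd this h1.ne'

theorem GoodV.H12 {p s : ℕ} (hp : p.Prime) {a : K} (ha : 0 < v a) (ha1 : v a < 1) {φ ψ : A →+ A} {ρ₁ ρ₂ : A} {τ₁ τ₂ : Fin 3}
    (ho : Odd (p ^ s)) (h21 : p ^ s • ρ₂ = ρ₁)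
    (i1 : E.Iso φ (a ^ 2) (p ^ s) ρ₁ τ₁) (o1 : addOrderOf ρ₁ = p ^ s) (t1 : ∀ i, φ (E.T i) = E.T (i + τ₁))
    (i2 : E.Iso ψ ((a ^ 2) ^ 2) ((p ^ s) ^ 2) ρ₂ τ₂) (o2 : addOrderOf ρ₂ = (p ^ s) ^ 2) (t2 : ∀ i, ψ (E.T i) = E.T (i + τ₂)) :
    ρ₁ ∈ G.H := by
  have ho2 : Odd ((p ^ s) ^ 2) := ho.pow
  have c1 := G.CY i1 ho o1 t1
  have c2 := G.CY i2 ho2 o2 t2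
  by_cases hk : ∃ k ∈ Finset.Ico 1 ((p ^ s) ^ 2), ¬ p ^ s ∣ k ∧ k • ρ₂ ∈ G.H
  · obtain ⟨k, hk, hnd, hkH⟩ := hk
    have hg : Nat.gcd k ((p ^ s) ^ 2) ∣ p ^ s := by
      rw [← pow_mul] at *
      obtain ⟨j, hj, hj'⟩ := (Nat.dvd_prime_pow hp).1 (Nat.gcd_dvd_right k (p ^ (s * 2)))
      rw [hj']
      apply pow_dvd_pow
      by_contra hjs
      exact hnd ((pow_dvd_pow p (by omega : s ≤ j)).trans (hj' ▸ Nat.gcd_dvd_left _ _))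
    obtain ⟨c, hc⟩ := hg
    have hb := Nat.gcd_eq_gcd_ab k ((p ^ s) ^ 2)
    have : ρ₁ = (c * Nat.gcdA k ((p ^ s) ^ 2) : ℤ) • (k • ρ₂) := by
      have h0 : (((p ^ s) ^ 2 : ℕ) : ℤ) • ρ₂ = 0 := by rw [natCast_zsmul, ← o2, addOrderOf_nsmul_eq_zero]
      have e1 : ((p ^ s : ℕ) : ℤ) = (c * Nat.gcdA k ((p ^ s) ^ 2)) * (k : ℤ) + (c * Nat.gcdB k ((p ^ s) ^ 2)) * (((p ^ s) ^ 2 : ℕ) : ℤ) := by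
        rw [hc] at hb ⊢
        rw [← hc] at hb ⊢
        conv_lhs => rw [hc]
        rw [Nat.cast_mul, hb]; ring
      rw [← h21, ← natCast_zsmul ρ₂, e1, add_smul, mul_smul _ (((p ^ s) ^ 2 : ℕ) : ℤ), h0, smul_zero, add_zero, mul_smul, natCast_zsmul]
    rw [this]
    exact G.H.zsmul_mem hkH _
  · exfalso
    push Not at hk
    have e : ∏ k ∈ Finset.Ico 1 ((p ^ s) ^ 2), max 1 (v (E.x (k • ρ₂))) = ∏ k ∈ Finset.Ico 1 (p ^ s), max 1 (v (E.x (k • ρ₁))) := by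
      have hpos := ho.pos
      have inj : Set.InjOn (fun k => p ^ s * k) (Finset.Ico 1 (p ^ s)) := fun a _ b _ h => Nat.eq_of_mul_eq_mul_left hpos h
      have : ∏ k ∈ Finset.Ico 1 (p ^ s), max 1 (v (E.x (k • ρ₁))) = ∏ k ∈ (Finset.Ico 1 (p ^ s)).image (fun k => p ^ s * k), max 1 (v (E.x (k • ρ₂))) := by
        rw [Finset.prod_image inj]
        refine Finset.prod_congr rfl fun k _ => ?_
        rw [← h21, mul_comm, mul_smul]
      rw [this]
      symm
      apply Finset.prod_subset
      · intro x hx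
        obtain ⟨k, hk, rfl⟩ := Finset.mem_image.1 hx
        rw [Finset.mem_Ico] at hk ⊢
        refine ⟨Nat.mul_pos hpos hk.1, ?_⟩
        rw [sq]; exact Nat.mul_lt_mul_of_pos_left hk.2 hpos
      · intro k hk1 hk2
        have hnd : ¬ p ^ s ∣ k := by
          rintro ⟨c, rfl⟩
          apply hk2
          rw [Finset.mem_Ico] at hk1
          refine Finset.mem_image.2 ⟨c, Finset.mem_Ico.2 ⟨?_, ?_⟩, rfl⟩
          · exact Nat.pos_of_mul_pos_left hk1.1
          · rw [sq] at hk1; exact Nat.lt_of_mul_lt_mul_left hk1.2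
        exact max_eq_left (G.nH (hk k hk1 hnd)).2
    rw [e] at c2
    have : v (a ^ 2) * v (a ^ 2) = v (a ^ 2) := by
      have hne : (∏ k ∈ Finset.Ico 1 (p ^ s), max 1 (v (E.x (k • ρ₁)))) ≠ 0 := by
        intro h0; rw [h0, mul_zero] at c1; exact zero_ne_one c1
      apply mul_right_cancel₀ hne
      rw [c1, ← map_mul, ← sq (a ^ 2)]; exact c2
    have h1 : v (a ^ 2) = 1 := by
      apply mul_left_cancel₀ (a := v (a ^ 2)) _ (by rw [this, mul_one])
      rw [map_pow]; exact pow_ne_zero _ ha.ne'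
    rw [map_pow] at h1
    exact absurd h1 (pow_lt_one₀ zero_le' ha1 two_ne_zero).ne
end

end Part15

section Part16
set_option linter.all false

section
variable {K A : Type*} [Field K] [AddCommGroup A] {V : ValuationSubring K}

def Rd (V : ValuationSubring K) (x : K) (a : IsLocalRing.ResidueField V) : Prop :=
  ∃ h : x ∈ V, IsLocalRing.residue V ⟨x, h⟩ = a

theorem Rd.uniq {x : K} {a b : IsLocalRing.ResidueField V} (h1 : Rd V x a) (h2 : Rd V x b) : a = b := by
  obtain ⟨h, rfl⟩ := h1; obtain ⟨h, rfl⟩ := h2; rfl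
theorem Rd.add {x y : K} {a b : IsLocalRing.ResidueField V} (h1 : Rd V x a) (h2 : Rd V y b) : Rd V (x + y) (a + b) := by
  obtain ⟨h, rfl⟩ := h1; obtain ⟨h', rfl⟩ := h2
  exact ⟨add_mem h h', by rw [← map_add]; rfl⟩
theorem Rd.mul {x y : K} {a b : IsLocalRing.ResidueField V} (h1 : Rd V x a) (h2 : Rd V y b) : Rd V (x * y) (a * b) := by
  obtain ⟨h, rfl⟩ := h1; obtain ⟨h', rfl⟩ := h2
  exact ⟨mul_mem h h', by rw [← map_mul]; rfl⟩
theorem Rd.neg {x : K} {a : IsLocalRing.ResidueField V} (h1 : Rd V x a) : Rd V (-x) (-a) := by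
  obtain ⟨h, rfl⟩ := h1
  exact ⟨neg_mem h, by rw [← map_neg]; rfl⟩
theorem Rd.sub {x y : K} {a b : IsLocalRing.ResidueField V} (h1 : Rd V x a) (h2 : Rd V y b) : Rd V (x - y) (a - b) := by
  rw [sub_eq_add_neg, sub_eq_add_neg]; exact h1.add h2.neg
theorem Rd.pow {x : K} {a : IsLocalRing.ResidueField V} (h1 : Rd V x a) (n : ℕ) : Rd V (x ^ n) (a ^ n) := by
  obtain ⟨h, rfl⟩ := h1
  exact ⟨pow_mem h n, by rw [← map_pow]; rfl⟩
theorem Rd.nat (n : ℕ) : Rd V n n := ⟨natCast_mem V n, by rw [← map_natCast (IsLocalRing.residue V)]; rfl⟩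
theorem Rd.one : Rd V 1 1 := by simpa using Rd.nat (V := V) 1
theorem Rd.four : Rd V 4 4 := by simpa using Rd.nat (V := V) 4
theorem Rd.prod {f : ℕ → K} {a : IsLocalRing.ResidueField V} (n : ℕ) (h : ∀ k < n, Rd V (f k) a) :
    Rd V (∏ k ∈ Finset.range n, f k) (a ^ n) := by
  induction n with
  | zero => simpa using Rd.one
  | succ n ih =>
    rw [Finset.prod_range_succ, pow_succ]
    exact (ih fun k hk => h k (hk.trans n.lt_succ_self)).mul (h n n.lt_succ_self)
theorem Rd.le {x : K} {a : IsLocalRing.ResidueField V} (h1 : Rd V x a) : V.valuation x ≤ 1 := (V.valuation_le_one_iff x).2 h1.1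
theorem Rd.zero_iff {x : K} : Rd V x 0 ↔ V.valuation x < 1 := by
  constructor
  · rintro ⟨h, h0⟩
    rw [IsLocalRing.residue_eq_zero_iff] at h0
    exact (V.valuation_lt_one_iff ⟨x, h⟩).1 h0
  · intro h
    have hx := (V.valuation_le_one_iff x).1 h.le
    exact ⟨hx, (IsLocalRing.residue_eq_zero_iff _).2 ((V.valuation_lt_one_iff ⟨x, hx⟩).2 h)⟩

open Classical in
noncomputable def red (V : ValuationSubring K) (x : K) : IsLocalRing.ResidueField V :=
  if h : x ∈ V then IsLocalRing.residue V ⟨x, h⟩ else 0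

theorem Rd_red {x : K} (h : V.valuation x ≤ 1) : Rd V x (red V x) := by
  have h' := (V.valuation_le_one_iff x).1 h
  exact ⟨h', by rw [red, dif_pos h']⟩

theorem red_neg (x : K) : red V (-x) = - red V x := by
  by_cases h : x ∈ V
  · exact (Rd_red ((V.valuation_le_one_iff _).2 (neg_mem h))).uniq (Rd_red ((V.valuation_le_one_iff _).2 h)).neg
  · have h' : -x ∉ V := fun hh => h (by simpa using neg_mem hh)
    rw [red, red, dif_neg h, dif_neg h', neg_zero]

theorem red_ne {x : K} (h : V.valuation x = 1) : red V x ≠ 0 := by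
  intro h0
  have := Rd_red h.le
  rw [h0, Rd.zero_iff, h] at this
  exact lt_irrefl _ this

variable {E : EC K A} (G : GoodV V.valuation E)
include G

theorem GoodV.re (i : Fin 3) : Rd V (E.e i) (red V (E.e i)) := Rd_red (G.le i)
theorem GoodV.rx {P : A} (h : P ∉ G.H) : Rd V (E.x P) (red V (E.x P)) := Rd_red (G.nH h).2
theorem GoodV.vy {P : A} (h : P ∉ G.H) : V.valuation (E.y P) ≤ 1 := by
  have h1 : V.valuation (E.y P) ^ 2 ≤ 1 := by
    rw [← map_pow, E.ode P (G.nH h).1, map_mul, map_mul]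
    exact mul_le_one' (mul_le_one' (G.small (G.nH h).2 _) (G.small (G.nH h).2 _)) (G.small (G.nH h).2 _)
  exact (pow_le_one_iff_of_nonneg zero_le' two_ne_zero).1 h1
theorem GoodV.ry {P : A} (h : P ∉ G.H) : Rd V (E.y P) (red V (E.y P)) := Rd_red (G.vy h)

theorem GoodV.red_inj (i j : Fin 3) (h : i ≠ j) : red V (E.e i) ≠ red V (E.e j) := by
  intro h1
  have h2 : red V (E.e i - E.e j) = red V (E.e i) - red V (E.e j) :=
    (Rd_red (G.un _ _ h.symm).le).uniq ((G.re i).sub (G.re j))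
  rw [h1, sub_self] at h2
  exact red_ne (G.un _ _ h.symm) h2

theorem GoodV.k2 : (2 : IsLocalRing.ResidueField V) ≠ 0 := by
  have h := Rd.nat (V := V) 2
  intro h0
  rw [Nat.cast_ofNat, Nat.cast_ofNat, h0, Rd.zero_iff, G.two] at h
  exact lt_irrefl _ h

noncomputable def GoodV.PE (B : AddSubgroup A) (hB : ∀ P ∈ B, P ∈ G.H → P = 0) : PE (IsLocalRing.ResidueField V) B where
  x := fun z => red V (E.x z)
  y := fun z => red V (E.y z)
  e := fun i => red V (E.e i)
  e_inj := G.red_inj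
  x_neg := by intro z; simp [E.x_neg]
  y_neg := by intro z; simp [E.y_neg, red_neg]
  ode := by
    have hm : ∀ z : B, z ≠ 0 → (z : A) ∉ G.H := fun z hz h => hz (Subtype.ext (hB z z.2 h))
    intro z hz
    have h := E.ode z (G.nH (hm z hz)).1
    have X := G.rx (hm z hz)
    refine ((G.ry (hm z hz)).pow 2).uniq ?_
    rw [h]
    exact ((X.sub (G.re 0)).mul (X.sub (G.re 1))).mul (X.sub (G.re 2))
  diff := by
    have hm : ∀ z : B, z ≠ 0 → (z : A) ∉ G.H := fun z hz h => hz (Subtype.ext (hB z z.2 h))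
    intro z w h1 h2 h3 h4
    have h := E.diff z w (G.nH (hm z h1)).1 (G.nH (hm w h2)).1 (G.nH (hm _ h3)).1 (G.nH (hm _ h4)).1
    refine (((G.rx (hm _ h3)).sub (G.rx (hm _ h4))).mul (((G.rx (hm _ h1)).sub (G.rx (hm _ h2))).pow 2)).uniq ?_
    have h' : (E.x ↑(z + w) - E.x ↑(z - w)) * (E.x ↑z - E.x ↑w) ^ 2 = -4 * (E.y ↑z * E.y ↑w) := h
    rw [h']
    exact (Rd.four.neg).mul ((G.ry (hm _ h1)).mul (G.ry (hm _ h2)))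
  prod := by
    have hm : ∀ z : B, z ≠ 0 → (z : A) ∉ G.H := fun z hz h => hz (Subtype.ext (hB z z.2 h))
    intro i z w h1 h2 h3 h4
    have h := E.prod i z w (G.nH (hm z h1)).1 (G.nH (hm w h2)).1 (G.nH (hm _ h3)).1 (G.nH (hm _ h4)).1
    have hl := (((G.rx (hm _ h3)).sub (G.re i)).mul ((G.rx (hm _ h4)).sub (G.re i))).mul (((G.rx (hm _ h1)).sub (G.rx (hm _ h2))).pow 2)
    refine hl.uniq ?_
    rw [show (E.x ↑(z + w) - E.e i) * (E.x ↑(z - w) - E.e i) * (E.x ↑z - E.x ↑w) ^ 2 = _ from h]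
    exact ((((G.rx (hm _ h1)).sub (G.re i)).mul ((G.rx (hm _ h2)).sub (G.re i))).sub (((G.re (i+1)).sub (G.re i)).mul ((G.re (i+2)).sub (G.re i)))).pow 2
  dbl := by
    have hm : ∀ z : B, z ≠ 0 → (z : A) ∉ G.H := fun z hz h => hz (Subtype.ext (hB z z.2 h))
    intro i z h2
    have h1 : z ≠ 0 := by rintro rfl; simp at h2
    have h := E.dbl i z (G.nH (hm _ h2)).1
    have hl := ((G.rx (hm _ h2)).sub (G.re i)).mul (Rd.four.mul ((G.ry (hm _ h1)).pow 2))
    refine hl.uniq ?_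
    rw [show (E.x ↑(z + z) - E.e i) * (4 * E.y ↑z ^ 2) = _ from h]
    exact ((((G.rx (hm _ h1)).sub (G.re i)).pow 2).sub (((G.re (i+1)).sub (G.re i)).mul ((G.re (i+2)).sub (G.re i)))).pow 2

theorem GoodV.xH {P c : A} (hP : P ∉ G.H) (hc : c ∈ G.H) : Rd V (E.x (P + c)) (red V (E.x P)) := by
  by_cases hc0 : c = 0
  · rw [hc0, add_zero]; exact G.rx hP
  have hA : P + c ∉ G.H := fun h => hP (by simpa using sub_mem h hc)
  have hB : P - c ∉ G.H := fun h => hP (by simpa using add_mem h hc)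
  have hd := congrArg V.valuation (E.diff P c (G.nH hP).1 hc0 (G.nH hA).1 (G.nH hB).1)
  have hr := hc.resolve_left hc0
  have hrpos := zero_lt_one.trans hr
  have hx0 : E.x c ≠ 0 := by rw [← Valuation.ne_zero_iff V.valuation]; exact hrpos.ne'
  have hAB : Rd V (E.x (P + c) - E.x (P - c)) 0 := by
    rw [Rd.zero_iff]
    by_contra hge
    rw [not_lt] at hge
    rw [map_mul, map_mul, Valuation.map_neg, v4 _ G.two, one_mul, map_pow, V.valuation.map_sub_swap (E.x P), vsub_lt _ (lt_of_le_of_lt (G.nH hP).2 hr), map_mul] at hd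
    have h1 : V.valuation (E.x c) ^ 2 ≤ V.valuation (E.y c) := by
      calc _ = 1 * V.valuation (E.x c) ^ 2 := (one_mul _).symm
        _ ≤ _ := mul_le_mul' hge le_rfl
        _ = _ := hd
        _ ≤ 1 * V.valuation (E.y c) := mul_le_mul' (G.vy hP) le_rfl
        _ = _ := one_mul _
    have h2 := pow_le_pow_left₀ zero_le' h1 2
    rw [← map_pow _ (E.y c), G.y2 hc0 hr, ← pow_mul] at h2
    exact absurd h2 (not_le.2 (pow_lt_pow_right₀ hr (by norm_num)))
  have hu : Rd V (E.x c)⁻¹ 0 := by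
    rw [Rd.zero_iff, map_inv₀]; exact inv_lt_one_of_one_lt₀ hr
  have hAr := G.rx hA
  have hBr := G.rx hB
  have hXr := G.rx hP
  have hAB' : red V (E.x (P + c)) = red V (E.x (P - c)) := sub_eq_zero.1 ((hAr.sub hBr).uniq hAB)
  have key : ∀ i, (red V (E.x (P + c)) - red V (E.e i)) ^ 2 = (red V (E.x P) - red V (E.e i)) ^ 2 := by
    intro i
    have hp := E.prod i P c (G.nH hP).1 hc0 (G.nH hA).1 (G.nH hB).1
    have hp' : (E.x (P + c) - E.e i) * (E.x (P - c) - E.e i) * (E.x P * (E.x c)⁻¹ - 1) ^ 2 =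
        ((E.x P - E.e i) * (1 - E.e i * (E.x c)⁻¹) - (E.e (i + 1) - E.e i) * (E.e (i + 2) - E.e i) * (E.x c)⁻¹) ^ 2 := by
      field_simp
      linear_combination hp
    have l := ((hAr.sub (G.re i)).mul (hBr.sub (G.re i))).mul (((hXr.mul hu).sub Rd.one).pow 2)
    have r := (((hXr.sub (G.re i)).mul (Rd.one.sub ((G.re i).mul hu))).sub ((((G.re (i+1)).sub (G.re i)).mul ((G.re (i+2)).sub (G.re i))).mul hu)).pow 2
    rw [hp'] at l
    have := l.uniq r
    rw [← hAB'] at this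
    linear_combination this
  have : red V (E.x (P + c)) = red V (E.x P) := by
    have h0 := key 0
    have h1 := key 1
    have : (red V (E.x (P + c)) - red V (E.x P)) * (2 * (red V (E.e 0) - red V (E.e 1))) = 0 := by
      linear_combination h1 - h0
    rcases mul_eq_zero.1 this with h | h
    · exact sub_eq_zero.1 h
    · exact absurd h (mul_ne_zero G.k2 (sub_ne_zero.2 (G.red_inj _ _ (by decide))))
  rw [← this]; exact hAr

theorem GoodV.iso_red {φ : A →+ A} {C : K} {n : ℕ} {ρ : A} {τ : Fin 3} (h : E.Iso φ C n ρ τ) (ho : Odd n)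
    (hρ : addOrderOf ρ = n) (hφ : ∀ i, φ (E.T i) = E.T (i + τ)) (hH : ρ ∈ G.H) (ker : ∀ P, φ P = 0 → ∃ k : ℕ, P + k • ρ = 0) :
    ∃ u, u ≠ 0 ∧ ∀ P, P ∉ G.H → φ P ∉ G.H ∧ (red V (E.x P) - red V (E.e 0)) ^ n = u * (red V (E.x (φ P)) - red V (E.e τ)) := by
  have hv : V.valuation (C * E.Y n ρ 0) = 1 := by
    rw [← G.CY h ho hρ hφ, map_mul, EC.Y, map_prod]
    congr 1
    exact Finset.prod_congr rfl fun k hk => G.oddv (ord_facts ho hρ k hk).1 (ord_facts ho hρ k hk).2 0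
  refine ⟨red V (C * E.Y n ρ 0), red_ne hv, fun P hP => ?_⟩
  have h0 : φ P ≠ 0 := by
    intro h0
    obtain ⟨k, hk⟩ := ker P h0
    apply hP
    rw [eq_neg_of_add_eq_zero_left hk]
    exact neg_mem (nsmul_mem hH k)
  have key := h 0 P h0
  rw [zero_add] at key
  change _ = C * E.Y n ρ 0 * _ at key
  have hl : Rd V (∏ k ∈ Finset.range n, (E.x (P + k • ρ) - E.e 0)) ((red V (E.x P) - red V (E.e 0)) ^ n) :=
    Rd.prod n fun k _ => (G.xH hP (nsmul_mem hH k)).sub (G.re 0)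
  have hx : φ P ∉ G.H := by
    rw [G.mem_H, not_or]
    refine ⟨h0, fun h1 => ?_⟩
    have := hl.le
    rw [key, map_mul, hv, one_mul, G.big h1] at this
    exact absurd this (not_le.2 h1)
  refine ⟨hx, ?_⟩
  rw [key] at hl
  exact hl.uniq ((Rd_red hv.le).mul ((G.rx hx).sub (G.re τ)))

end

end Part16

section Part17
set_option linter.all false

section
open WeierstrassCurve.Affine
variable {K B : Type*} [Field K] [AddCommGroup B]

theorem sign_hom {G : Type*} [AddCommGroup G] (f : B → G) (h0 : f 0 = 0) (hn : ∀ z, f (-z) = - f z)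
    (hpm : ∀ z w, f (z + w) = f z + f w ∨ f (z + w) = -(f z + f w)) (ht : ∀ z, f z = - f z → z = 0) (z w : B) :
    f (z + w) = f z + f w := by
  rcases hpm z w with h | h
  · exact h
  have h1 := hpm (z + w) (-z)
  rw [add_neg_cancel_comm, hn, h] at h1
  rcases h1 with h1 | h1
  · rw [h]
    have : f z + f w + (f z + f w) = 0 := by nth_rewrite 2 [h1]; abel
    rw [neg_eq_iff_add_eq_zero]; exact this
  · have : f z = - f z := by
      rw [eq_neg_iff_add_eq_zero]
      have h2 : f w = f z + f z + f w := by nth_rewrite 1 [h1]; abel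
      exact right_eq_add.1 h2
    rw [ht z this, zero_add, h0, zero_add]

structure PE.On (E : PE K B) (W : WeierstrassCurve.Affine K) : Prop where
  a1 : W.a₁ = 0
  a2 : W.a₂ = -(E.e 0 + E.e 1 + E.e 2)
  a3 : W.a₃ = 0
  a4 : W.a₄ = E.e 0 * E.e 1 + E.e 1 * E.e 2 + E.e 0 * E.e 2
  a6 : W.a₆ = -(E.e 0 * E.e 1 * E.e 2)
  two : (2 : K) ≠ 0
  nt : ∀ z : B, z + z = 0 → z = 0

variable {E : PE K B} {W : WeierstrassCurve.Affine K} (O : E.On W)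
include O

theorem PE.On.y_ne {z : B} (hz : z ≠ 0) : E.y z ≠ 0 := by
  intro hy
  have h2 : z + z ≠ 0 := fun h => hz (O.nt z h)
  have ho := E.ode z hz
  rw [hy] at ho
  obtain ⟨i, hi⟩ : ∃ i, E.x z - E.e i = 0 := by
    have h : (E.x z - E.e 0) * (E.x z - E.e 1) * (E.x z - E.e 2) = 0 := by rw [← ho]; ring
    rcases mul_eq_zero.1 h with h | h
    · rcases mul_eq_zero.1 h with h | h
      exacts [⟨0, h⟩, ⟨1, h⟩]
    · exact ⟨2, h⟩
  have hd := E.dbl i z h2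
  rw [hy, hi] at hd
  have h3 : ((E.e (i + 1) - E.e i) * (E.e (i + 2) - E.e i)) ^ 2 = 0 := by linear_combination -hd
  exact pow_ne_zero 2 (mul_ne_zero (sub_ne_zero.2 (E.e_inj _ _ (f3 i).1.symm)) (sub_ne_zero.2 (E.e_inj _ _ (f3 i).2.2.symm))) h3

theorem PE.On.y_ne' {z : B} (hz : z ≠ 0) : E.y z ≠ W.negY (E.x z) (E.y z) := by
  intro h
  rw [negY, O.a1, O.a3] at h
  exact mul_ne_zero O.two (O.y_ne hz) (by linear_combination h)

theorem PE.On.ns {z : B} (hz : z ≠ 0) : W.Nonsingular (E.x z) (E.y z) := by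
  rw [nonsingular_iff]
  refine ⟨?_, Or.inr (O.y_ne' hz)⟩
  rw [equation_iff, O.a1, O.a2, O.a3, O.a4, O.a6]
  linear_combination E.ode z hz

open Classical in
noncomputable def PE.On.f (z : B) : W.Point := if h : z = 0 then .zero else .some _ _ (O.ns h)

theorem PE.On.f0 : O.f 0 = 0 := by rw [PE.On.f, dif_pos rfl]; rfl
theorem PE.On.fn {z : B} (h : z ≠ 0) : O.f z = .some _ _ (O.ns h) := by rw [PE.On.f, dif_neg h]

theorem PE.On.f_neg (z : B) : O.f (-z) = - O.f z := by
  by_cases h : z = 0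
  · rw [h, neg_zero, O.f0]; rfl
  · rw [O.fn h, O.fn (neg_ne_zero.2 h), Point.neg_some]
    congr 1
    · exact E.x_neg z
    · rw [E.y_neg, negY, O.a1, O.a3]; ring

theorem PE.On.f_ne {z : B} (h : z ≠ 0) : O.f z ≠ 0 := by rw [O.fn h]; exact Point.some_ne_zero _

theorem PE.On.f_tor (z : B) (h : O.f z = - O.f z) : z = 0 := by
  by_contra h0
  rw [O.fn h0, Point.neg_some, Point.some.injEq] at h
  exact O.y_ne' h0 h.2

omit O [AddCommGroup B] in
theorem some_pm {W : WeierstrassCurve.Affine K} {x₁ x₂ y₁ y₂ : K} (h1 : W.Nonsingular x₁ y₁) (h2 : W.Nonsingular x₂ y₂) (h : x₁ = x₂) :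
    Point.some _ _ h1 = Point.some _ _ h2 ∨ Point.some _ _ h1 = - Point.some _ _ h2 := by
  rcases Y_eq_of_X_eq h1.1 h2.1 h with hy | hy
  · left; congr 1
  · right; rw [Point.neg_some]; congr 1

variable [DecidableEq K]

theorem PE.On.f_pm (z w : B) : O.f (z + w) = O.f z + O.f w ∨ O.f (z + w) = -(O.f z + O.f w) := by
  by_cases hz : z = 0
  · left; rw [hz, O.f0, zero_add, zero_add]
  by_cases hw : w = 0
  · left; rw [hw, O.f0, add_zero, add_zero]
  by_cases hp : z + w = 0
  · left; rw [eq_neg_of_add_eq_zero_right hp, add_neg_cancel, O.f0, O.f_neg, add_neg_cancel]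
  by_cases hm : z - w = 0
  · obtain rfl := sub_eq_zero.1 hm
    rw [O.fn hp, O.fn hz, Point.add_self_of_Y_ne (O.y_ne' hz)]
    apply some_pm
    rw [slope_of_Y_ne rfl (O.y_ne' hz), addX, negY, O.a1, O.a2, O.a3, O.a4]
    have hd := E.dbl 0 z hp
    have ho := E.ode z hz
    have hy := O.y_ne hz
    have h2 := O.two
    rw [zero_add, zero_add] at hd
    have e : E.y z - (-E.y z - 0 * E.x z - 0) = 2 * E.y z := by ring
    rw [e]
    field_simp
    linear_combination hd + (- 4 * E.e 1 - 4 * E.e 2  + 8 * E.x z) * ho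
  · have hx : E.x z ≠ E.x w := by
      intro hx
      have := E.diff z w hz hw hp hm
      rw [hx, sub_self] at this
      have h4 : (2 : K) * 2 * (E.y z * E.y w) = 0 := by linear_combination this
      exact mul_ne_zero (mul_ne_zero O.two O.two) (mul_ne_zero (O.y_ne hz) (O.y_ne hw)) h4
    rw [O.fn hp, O.fn hz, O.fn hw, Point.add_of_X_ne hx]
    apply some_pm
    rw [slope_of_X_ne hx, addX, O.a1, O.a2]
    have hd := E.diff z w hz hw hp hm
    have h0 := E.prod 0 z w hz hw hp hm
    have h1 : _ = ((E.x z - E.e 1) * (E.x w - E.e 1) - (E.e 2 - E.e 1) * (E.e 0 - E.e 1)) ^ 2 := E.prod 1 z w hz hw hp hm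
    rw [zero_add, zero_add] at h0
    have o1 := E.ode z hz
    have o2 := E.ode w hw
    have hδ := sub_ne_zero.2 hx
    field_simp
    have he : 2 * (E.e 1 - E.e 0) ≠ 0 := mul_ne_zero O.two (sub_ne_zero.2 (E.e_inj _ _ (by decide)))
    apply mul_left_cancel₀ he
    linear_combination (h0 - h1) + (E.e 1 - E.e 0) * hd - 2 * (E.e 1 - E.e 0) * (o1 + o2)

noncomputable def PE.On.hom : B →+ W.Point where
  toFun := O.f
  map_zero' := O.f0
  map_add' := sign_hom O.f O.f0 O.f_neg O.f_pm O.f_tor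

theorem PE.On.hom_inj : Function.Injective O.hom := by
  rw [injective_iff_map_eq_zero]
  intro z hz
  by_contra h
  exact O.f_ne h hz

omit O [DecidableEq K] in
def PE.map (E : PE K B) (σ : K →+* K) : PE K B where
  x := fun z => σ (E.x z)
  y := fun z => σ (E.y z)
  e := fun i => σ (E.e i)
  e_inj := fun i j h h' => E.e_inj i j h (σ.injective h')
  x_neg := by intro z; rw [E.x_neg]
  y_neg := by intro z; rw [E.y_neg, map_neg]
  ode := by intro z hz; rw [← map_pow, E.ode z hz]; simp
  diff := by intro z w h1 h2 h3 h4; have := congrArg σ (E.diff z w h1 h2 h3 h4); simpa [map_ofNat σ 4] using this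
  prod := by intro i z w h1 h2 h3 h4; have := congrArg σ (E.prod i z w h1 h2 h3 h4); simpa using this
  dbl := by intro i z h; have := congrArg σ (E.dbl i z h); simpa [map_ofNat σ 4] using this

theorem PE.On.main (σ : K →+* K) (α : B →+ B) (hσe : ∀ i, E.e (i + 1) = σ (E.e i))
    (hσx : ∀ z, z ≠ 0 → E.x (α z) = σ (E.x z)) (ρ : B) (gen : ∀ z, ∃ n : ℤ, z = n • ρ) (hα : α (α ρ) = ρ) (hρ : ρ ≠ 0) :
    σ W.a₂ = W.a₂ ∧ σ W.a₄ = W.a₄ ∧ σ W.a₆ = W.a₆ ∧ ∃ (x y : K) (h : W.Nonsingular x y),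
      σ (σ x) = x ∧ σ (σ y) = y ∧ addOrderOf (Point.some x y h) = addOrderOf ρ := by
  have e1 : E.e 1 = σ (E.e 0) := hσe 0
  have e2 : E.e 2 = σ (E.e 1) := hσe 1
  have e0 : E.e 0 = σ (E.e 2) := hσe 2
  have b2 : σ W.a₂ = W.a₂ := by rw [O.a2]; simp only [map_neg, map_add, ← e0, ← e1, ← e2]; ring
  have b4 : σ W.a₄ = W.a₄ := by rw [O.a4]; simp only [map_mul, map_add, ← e0, ← e1, ← e2]; ring
  have b6 : σ W.a₆ = W.a₆ := by rw [O.a6]; simp only [map_neg, map_mul, ← e0, ← e1, ← e2]; ring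
  refine ⟨b2, b4, b6, E.x ρ, E.y ρ, O.ns hρ, ?_⟩
  have O' : (E.map σ).On W := by
    refine ⟨O.a1, ?_, O.a3, ?_, ?_, O.two, O.nt⟩
    · rw [← b2, O.a2]; simp [PE.map]
    · rw [← b4, O.a4]; simp [PE.map]
    · rw [← b6, O.a6]; simp [PE.map]
  have hα0 : ∀ z, z ≠ 0 → α z ≠ 0 := by
    intro z hz h
    obtain ⟨n, rfl⟩ := gen z
    apply hz
    rw [← hα, ← map_zsmul, ← map_zsmul, h, map_zero]
  have ord : addOrderOf (Point.some _ _ (O.ns hρ)) = addOrderOf ρ := by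
    rw [← O.fn hρ]; exact addOrderOf_injective O.hom O.hom_inj ρ
  have key : ∀ z, z ≠ 0 → O.f (α z) = O'.f z ∨ O.f (α z) = - O'.f z := by
    intro z hz
    rw [O.fn (hα0 z hz), O'.fn hz]
    exact some_pm _ _ (hσx z hz)
  obtain ⟨ε, hε, hy⟩ : ∃ ε : K, ε * ε = 1 ∧ ∀ z, z ≠ 0 → E.y (α z) = ε * σ (E.y z) := by
    rcases key ρ hρ with h | h
    · refine ⟨1, one_mul 1, fun z hz => ?_⟩
      have : O.f (α z) = O'.f z := by
        obtain ⟨n, rfl⟩ := gen z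
        change O.hom (α _) = O'.hom _
        change O.hom (α _) = O'.hom _ at h
        rw [map_zsmul, map_zsmul, map_zsmul, h]
      rw [O.fn (hα0 z hz), O'.fn hz, Point.some.injEq] at this
      rw [one_mul]; exact this.2
    · refine ⟨-1, by ring, fun z hz => ?_⟩
      have : O.f (α z) = - O'.f z := by
        obtain ⟨n, rfl⟩ := gen z
        change O.hom (α _) = - O'.hom _
        change O.hom (α _) = - O'.hom _ at h
        rw [map_zsmul, map_zsmul, map_zsmul, h, smul_neg]
      rw [O.fn (hα0 z hz), O'.fn hz, Point.neg_some, Point.some.injEq, negY, O.a1, O.a3] at this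
      have h2 := this.2
      simp only [PE.map] at h2
      rw [h2]; ring
  refine ⟨?_, ?_, ord⟩
  · rw [← hσx ρ hρ, ← hσx _ (hα0 ρ hρ), hα]
  · have h1 := hy _ (hα0 ρ hρ)
    have h2 := hy ρ hρ
    have hεσ : σ ε * σ ε = 1 := by rw [← map_mul, hε, map_one]
    have hε' : σ ε = ε := by
      rcases mul_self_eq_one_iff.1 hε with h | h <;> rw [h] <;> simp
    rw [hα, h2, map_mul, hε', ← mul_assoc, hε, one_mul] at h1
    exact h1.symm
end

end Part17

section Part18
set_option linter.all false

section
open Polynomial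

theorem resAC {K : Type*} [Field K] [IsAlgClosed K] (V : ValuationSubring K) : IsAlgClosed (IsLocalRing.ResidueField V) := by
  apply IsAlgClosed.of_exists_root
  intro p hp hirr
  obtain ⟨g, hg, hdeg, hmon⟩ := Polynomial.lifts_and_degree_eq_and_monic (f := IsLocalRing.residue V)
    (p := p) (Polynomial.map_surjective _ IsLocalRing.residue_surjective p) hp
  have hd : (g.map (algebraMap V K)).degree ≠ 0 := by
    rw [hmon.degree_map, hdeg]; exact (Polynomial.degree_pos_of_irreducible hirr).ne'
  obtain ⟨x, hx⟩ := IsAlgClosed.exists_root _ hd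
  rw [IsRoot, eval_map] at hx
  have hint : IsIntegral V x := ⟨g, hmon, hx⟩
  obtain ⟨y, rfl⟩ := IsIntegrallyClosed.isIntegral_iff.1 hint
  refine ⟨IsLocalRing.residue V y, ?_⟩
  rw [← hg, eval_map, eval₂_at_apply]
  rw [eval₂_at_apply] at hx
  have : g.eval y = 0 := (IsFractionRing.injective V K) (by rw [hx, map_zero])
  rw [this, map_zero]

theorem exV (q0 : ℕ) (hq : 3 ≤ q0) : ∃ V : ValuationSubring ℂ, V.valuation (αC q0) < 1 := by
  have ha := αC_sq q0 hq
  let S : Subring ℂ :=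
    { carrier := {z | ∃ m n : ℤ, z = m + n * αC q0}
      mul_mem' := by
        rintro _ _ ⟨a, b, rfl⟩ ⟨c, d, rfl⟩
        refine ⟨a * c - b * d * q0, a * d + b * c + b * d, ?_⟩
        push_cast
        linear_combination (b * d : ℂ) * ha
      one_mem' := ⟨1, 0, by simp⟩
      add_mem' := by
        rintro _ _ ⟨a, b, rfl⟩ ⟨c, d, rfl⟩
        exact ⟨a + c, b + d, by push_cast; ring⟩
      zero_mem' := ⟨0, 0, by simp⟩
      neg_mem' := by
        rintro _ ⟨a, b, rfl⟩
        exact ⟨-a, -b, by push_cast; ring⟩ }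
  have hS : αC q0 ∈ S := ⟨0, 1, by simp⟩
  have hI : Ideal.span {(⟨αC q0, hS⟩ : S)} ≠ ⊤ := by
    rw [Ne, Ideal.eq_top_iff_one, Ideal.mem_span_singleton']
    rintro ⟨⟨_, m, n, rfl⟩, h⟩
    have h1 : ((m : ℂ) + n * αC q0) * αC q0 = 1 := congrArg Subtype.val h
    have h2 : ((-(n * q0) - 1 : ℝ) : ℂ) + ((m + n : ℝ) : ℂ) * αC q0 = 0 := by
      push_cast
      linear_combination h1 - (n : ℂ) * ha
    have h3 := (αC_ind q0 hq h2).1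
    have h4 : n * (q0 : ℤ) = -1 := by
      have : (n : ℝ) * q0 = -1 := by linarith
      exact_mod_cast this
    have h5 : (q0 : ℤ) ∣ 1 := ⟨-n, by linarith⟩
    have := Int.le_of_dvd one_pos h5
    omega
  obtain ⟨V, hV1, hV2⟩ := Ideal.image_subset_nonunits_valuationSubring _ hI
  refine ⟨V, ?_⟩
  exact V.mem_nonunits_iff.1 (hV2 ⟨⟨αC q0, hS⟩, Ideal.subset_span rfl, rfl⟩)

theorem vp {K : Type*} [Field K] (V : ValuationSubring K) {p s : ℕ} (hodd : Odd p) {a : K} (ha : a ^ 2 = a - (p ^ s : ℕ))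
    (hv : V.valuation a < 1) : V.valuation p < 1 ∧ V.valuation 2 = 1 ∧ V.valuation ((a ^ 2 - 1) ^ 2) = 1 := by
  have ha2 : V.valuation (a ^ 2) < 1 := by rw [map_pow]; exact pow_lt_one₀ zero_le' hv two_ne_zero
  have hn : ∀ n : ℕ, V.valuation (n : K) ≤ 1 := fun n => (V.valuation_le_one_iff _).2 (natCast_mem V n)
  have h1 : V.valuation (p : K) < 1 := by
    have h : V.valuation ((p : K) ^ s) < 1 := by
      have : (p : K) ^ s = a - a ^ 2 := by rw [ha]; push_cast; ring
      rw [this]; exact V.valuation.map_sub_lt hv ha2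
    rw [map_pow] at h
    by_contra hc
    exact absurd h (not_lt.2 (one_le_pow₀ (not_lt.1 hc)))
  refine ⟨h1, ?_, ?_⟩
  · refine le_antisymm (by simpa using hn 2) (not_lt.1 fun h2 => ?_)
    obtain ⟨k, hk⟩ := hodd
    have e : (1 : K) = p - 2 * k := by rw [hk]; push_cast; ring
    have : V.valuation (1 : K) < 1 := by
      rw [e]
      refine V.valuation.map_sub_lt h1 ?_
      rw [map_mul]
      calc _ ≤ V.valuation 2 * 1 := mul_le_mul' le_rfl (hn k)
        _ < 1 := by rwa [mul_one]
    rw [map_one] at this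
    exact lt_irrefl _ this
  · rw [map_pow, Valuation.map_sub_eq_of_lt_right, map_one, one_pow]
    rwa [map_one]

theorem descend {p s q : ℕ} [Fact p.Prime] (hs : 0 < s) (hq : q = p ^ (2 * s)) {F κ : Type*} [Field F] [Fintype F] [DecidableEq F] [Field κ] [DecidableEq κ]
    [IsAlgClosed κ] [CharP κ p] (hF : Fintype.card F = q) (W : WeierstrassCurve.Affine κ) (a1 : W.a₁ = 0) (a3 : W.a₃ = 0)
    (a2 : W.a₂ ^ q = W.a₂) (a4 : W.a₄ ^ q = W.a₄) (a6 : W.a₆ ^ q = W.a₆) (x y : κ) (h : W.Nonsingular x y) (hx : x ^ q = x) (hy : y ^ q = y) :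
    ∃ W' : WeierstrassCurve.Affine F, W'.a₁ = 0 ∧ W'.a₃ = 0 ∧ ∃ P : W'.Point, addOrderOf P = addOrderOf (WeierstrassCurve.Affine.Point.some x y h) := by
  have hp : p.Prime := Fact.out
  have hch : CharP F p := by
    obtain ⟨r, hr⟩ := CharP.exists F
    obtain ⟨n, hr', hn⟩ := FiniteField.card F r
    have : r = p := by
      rw [hF, hq] at hn
      have : r ∣ p ^ (2 * s) := hn ▸ dvd_pow_self r n.2.ne'
      exact (Nat.prime_dvd_prime_iff_eq hr' hp).1 (hr'.dvd_of_dvd_pow this)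
    rwa [this] at hr
  letI : Algebra (ZMod p) F := ZMod.algebra F p
  letI : Algebra (ZMod p) κ := ZMod.algebra κ p
  haveI : Algebra.IsAlgebraic (ZMod p) F := Algebra.IsAlgebraic.of_finite _ _
  let ι : F →ₐ[ZMod p] κ := IsAlgClosed.lift
  letI : Algebra F κ := ι.toRingHom.toAlgebra
  have surj : ∀ z : κ, z ^ q = z → ∃ z' : F, algebraMap F κ z' = z := by
    intro z hz
    have hprod : (∏ a : F, (X - C a)) = X ^ q - X := by
      have hm : (X ^ q - X : F[X]).Monic := by
        apply monic_X_pow_sub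
        rw [degree_X]
        exact_mod_cast (by rw [← hF]; exact Fintype.one_lt_card : 1 < q)
      have hr := FiniteField.roots_X_pow_card_sub_X F
      rw [hF] at hr
      have := prod_multiset_X_sub_C_of_monic_of_roots_card_eq hm (by
        rw [hr, FiniteField.X_pow_card_sub_X_natDegree_eq F (by rw [← hF]; exact Fintype.one_lt_card), ← hF]; rfl)
      rw [hr] at this
      exact this
    have h0 := congrArg (aeval z) hprod
    simp only [map_prod, map_sub, aeval_X, aeval_C, map_pow, hz, sub_self] at h0
    obtain ⟨a, _, ha⟩ := Finset.prod_eq_zero_iff.1 h0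
    exact ⟨a, (sub_eq_zero.1 ha).symm⟩
  obtain ⟨b2, hb2⟩ := surj _ a2
  obtain ⟨b4, hb4⟩ := surj _ a4
  obtain ⟨b6, hb6⟩ := surj _ a6
  obtain ⟨x', rfl⟩ := surj _ hx
  obtain ⟨y', rfl⟩ := surj _ hy
  let W' : WeierstrassCurve F := ⟨0, b2, 0, b4, b6⟩
  have hW : W'.baseChange κ = W := by
    ext <;> simp [W', WeierstrassCurve.baseChange, WeierstrassCurve.map, a1, a3, hb2, hb4, hb6]
  subst hW
  have hns : (W'.baseChange F).toAffine.Nonsingular x' y' :=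
    (WeierstrassCurve.Affine.baseChange_nonsingular W' (f := Algebra.ofId F κ) (Algebra.ofId F κ).injective x' y').1 h
  refine ⟨(W'.baseChange F).toAffine, rfl, rfl, .some x' y' hns, ?_⟩
  rw [← addOrderOf_injective (WeierstrassCurve.Affine.Point.map (W' := W') (Algebra.ofId F κ)) (WeierstrassCurve.Affine.Point.map_injective _)]
  rfl
end

end Part18

section Part19
set_option linter.all false

section
variable {K A : Type*} [Field K] [IsAlgClosed K] [AddCommGroup A]

/-- normalised model with good reduction -/
theorem EC.normalize (E : EC K A) (V : ValuationSubring K) (h2 : V.valuation 2 = 1)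
    (h : ∀ i j, i ≠ j → V.valuation (E.e j - E.e i) = V.valuation (E.e 1 - E.e 0)) :
    ∃ (a b c : K) (ha : a ≠ 0) (hc : c ^ 2 = a ^ 3), GoodV V.valuation (E.scale a b c ha hc) := by
  have hd : E.e 1 - E.e 0 ≠ 0 := sub_ne_zero.2 (E.e_inj _ _ (by decide))
  have hvd : V.valuation (E.e 1 - E.e 0) ≠ 0 := (Valuation.ne_zero_iff _).2 hd
  obtain ⟨c, hc⟩ := IsAlgClosed.exists_pow_nat_eq ((E.e 1 - E.e 0)⁻¹ ^ 3) (n := 2) (by norm_num)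
  have un : ∀ i j, i ≠ j → V.valuation ((E.e 1 - E.e 0)⁻¹ * E.e j + -((E.e 1 - E.e 0)⁻¹ * E.e 0) - ((E.e 1 - E.e 0)⁻¹ * E.e i + -((E.e 1 - E.e 0)⁻¹ * E.e 0))) = 1 := by
    intro i j hij
    rw [add_sub_add_right_eq_sub, ← mul_sub, map_mul, h i j hij, map_inv₀, inv_mul_cancel₀ hvd]
  refine ⟨(E.e 1 - E.e 0)⁻¹, -((E.e 1 - E.e 0)⁻¹ * E.e 0), c, inv_ne_zero hd, hc, h2, ?_, un⟩
  intro i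
  by_cases hi : i = 0
  · subst hi
    simp [EC.scale, PE.scale]
  · have := un 0 i (Ne.symm hi)
    rw [add_neg_cancel, sub_zero] at this
    exact this.le

theorem tr_aux {k : Type*} [Field k] {μ u ν z sx sn s0 e1 : k} (hμ : μ ≠ 0) (hu : u ≠ 0)
    (hν : sn - s0 = u * (ν - e1)) (h : sx - s0 = u * (z - e1)) :
    μ⁻¹ * z + -(μ⁻¹ * ν) = (u * μ)⁻¹ * sx + -((u * μ)⁻¹ * sn) := by
  field_simp
  linear_combination hν - h

theorem CMd.point {p s q : ℕ} [Fact p.Prime] (hodd : Odd p) (hs : 0 < s) (hq : q = p ^ (2 * s)) (D : CMd (p ^ s) K A) (ha0 : D.a ≠ 0)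
    (V : ValuationSubring K) (hv : V.valuation D.a < 1)
    {F : Type*} [Field F] [Fintype F] [DecidableEq F] (hF : Fintype.card F = q) :
    ∃ W : WeierstrassCurve.Affine F, W.a₁ = 0 ∧ W.a₃ = 0 ∧ ∃ P : W.Point, addOrderOf P = p ^ s * (p ^ s + 2) := by
  classical
  have hp : p.Prime := Fact.out
  have ho : Odd (p ^ s) := hodd.pow
  have hpos := ho.pos
  have ho3 : Odd (p ^ s * (p ^ s + 2)) := ho.mul (ho.add_even (by decide))
  obtain ⟨hvp, hv2, hv3⟩ := vp V hodd D.ha hv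
  obtain ⟨a, b, c, ha, hc, G⟩ := D.E.normalize V hv2 (D.E.good V.valuation hv2 D.iso₁ ho D.o₁ D.αT)
  have i1 := D.iso₁.scale hpos a b c ha hc
  have i2 := D.iso₂.scale (pow_pos hpos 2) a b c ha hc
  have i3 := D.iso₃.scale ho3.pos a b c ha hc
  set E := D.E.scale a b c ha hc with hE
  have hT : ∀ i, D.α (E.T i) = E.T (i + 1) := D.αT
  have hT2 : ∀ i, (D.α.comp D.α) (E.T i) = E.T (i + 2) := by
    intro i
    rw [AddMonoidHom.comp_apply, hT, hT, show i + 1 + 1 = i + 2 by clear * -; decide +revert]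
  have hT3 : ∀ i, (D.α.comp D.α - AddMonoidHom.id A) (E.T i) = E.T (i + 1) := by
    intro i
    rw [AddMonoidHom.sub_apply, AddMonoidHom.comp_apply, D.hα, AddMonoidHom.id_apply, hT]
    obtain ⟨k, hk⟩ := ho
    have : p ^ s • E.T i = E.T i := by
      rw [hk, add_smul, mul_comm, mul_smul, two_smul, E.T_two, smul_zero, zero_add, one_smul]
    rw [this, sub_sub, E.T_two, sub_zero]
  have hva : 0 < V.valuation D.a := zero_lt_iff.2 ((Valuation.ne_zero_iff _).2 ha0)
  have hρ1 : D.ρ₁ ∈ G.H := G.H12 hp hva hv ho D.h₂₁ i1 D.o₁ hT i2 D.o₂ hT2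
  have hB := G.H3 i3 ho3 D.o₃ hT3 hv3
  obtain ⟨u, hu, hred⟩ := G.iso_red i1 ho D.o₁ hT hρ1 D.ker
  -- residue field
  let κ := IsLocalRing.ResidueField V
  haveI : IsAlgClosed κ := resAC V
  haveI : CharP κ p := by
    have h1 := Rd.nat (V := V) p
    have h2 : ((p : ℕ) : κ) = 0 := h1.uniq (Rd.zero_iff.2 hvp)
    exact CharP.congr _ (CharP.ringChar_of_prime_eq_zero hp h2)
  let σ : κ →+* κ := iterateFrobenius κ p s
  have hσ : ∀ x, σ x = x ^ p ^ s := fun x => iterateFrobenius_def p s x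
  have h1s : 1 < p ^ s := Nat.one_lt_pow hs.ne' hp.one_lt
  obtain ⟨μ, hμ⟩ := IsAlgClosed.exists_pow_nat_eq (k := κ) u (n := p ^ s - 1) (by omega)
  have hμ0 : μ ≠ 0 := by
    rintro rfl
    rw [zero_pow (by omega)] at hμ
    exact hu hμ.symm
  have hμ' : σ μ = u * μ := by
    rw [hσ, ← hμ, ← pow_succ]; congr 1; omega
  obtain ⟨ν, hν⟩ : ∃ ν : κ, σ ν - σ (red V (E.e 0)) = u * (ν - red V (E.e 1)) := by
    let g : Polynomial κ := Polynomial.X ^ (p ^ s) - (Polynomial.C u * Polynomial.X + Polynomial.C (σ (red V (E.e 0)) - u * red V (E.e 1)))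
    have hg : g.degree = (p ^ s : ℕ) := by
      rw [Polynomial.degree_sub_eq_left_of_degree_lt, Polynomial.degree_X_pow]
      rw [Polynomial.degree_X_pow]
      exact lt_of_le_of_lt Polynomial.degree_linear_le (by exact_mod_cast h1s)
    obtain ⟨ν, hν⟩ := IsAlgClosed.exists_root g (by rw [hg]; exact_mod_cast hpos.ne')
    refine ⟨ν, ?_⟩
    rw [hσ]
    simp [g, Polynomial.IsRoot] at hν
    linear_combination hν
  obtain ⟨c', hc'⟩ := IsAlgClosed.exists_pow_nat_eq (μ⁻¹ ^ 3) (n := 2) (by norm_num)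
  have tr : ∀ x z : κ, (x - red V (E.e 0)) ^ p ^ s = u * (z - red V (E.e 1)) →
      μ⁻¹ * z + -(μ⁻¹ * ν) = σ (μ⁻¹ * x + -(μ⁻¹ * ν)) := by
    intro x z h
    rw [← hσ, map_sub] at h
    rw [map_add, map_neg, map_mul, map_mul, map_inv₀, hμ']
    exact tr_aux hμ0 hu hν h
  let Γ := AddSubgroup.zmultiples D.ρ₃
  have hΓ : ∀ z : Γ, z ≠ 0 → (z : A) ∉ G.H := fun z hz h => hz (Subtype.ext (hB z z.2 h))
  let E₀ : PE κ Γ := G.PE Γ hB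
  let E₁ : PE κ Γ := E₀.scale μ⁻¹ (-(μ⁻¹ * ν)) c' (inv_ne_zero hμ0) hc'
  have hαρ : D.α D.ρ₃ = (1 + p ^ s) • D.ρ₃ := by
    have h1 := D.hα D.ρ₃
    rw [D.h₃] at h1
    rw [add_smul, one_smul]
    exact (sub_eq_iff_eq_add.1 h1.symm)
  have hαΓ : ∀ z ∈ Γ, D.α z ∈ Γ := by
    intro z hz
    obtain ⟨n, rfl⟩ := AddSubgroup.mem_zmultiples_iff.1 hz
    rw [map_zsmul, hαρ]
    exact zsmul_mem (nsmul_mem (AddSubgroup.mem_zmultiples _) _) _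
  let α' : Γ →+ Γ := (D.α.comp Γ.subtype).codRestrict Γ (fun z => hαΓ _ z.2)
  let ρ : Γ := ⟨D.ρ₃, AddSubgroup.mem_zmultiples _⟩
  have hoρ : addOrderOf ρ = p ^ s * (p ^ s + 2) := by
    rw [← D.o₃]; exact (addOrderOf_injective Γ.subtype Subtype.val_injective ρ).symm
  have gen : ∀ z : Γ, ∃ n : ℤ, z = n • ρ := by
    rintro ⟨z, hz⟩
    obtain ⟨n, rfl⟩ := AddSubgroup.mem_zmultiples_iff.1 hz
    exact ⟨n, rfl⟩
  let W : WeierstrassCurve.Affine κ := ⟨0, -(E₁.e 0 + E₁.e 1 + E₁.e 2), 0, E₁.e 0 * E₁.e 1 + E₁.e 1 * E₁.e 2 + E₁.e 0 * E₁.e 2,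
    -(E₁.e 0 * E₁.e 1 * E₁.e 2)⟩
  have O : E₁.On W := by
    refine ⟨rfl, rfl, rfl, rfl, rfl, G.k2, ?_⟩
    intro z hz
    by_contra h0
    obtain ⟨n, rfl⟩ := gen z
    have hodd' : OddO (n • ρ) := ⟨_, ho3, by rw [smul_comm, ← hoρ, addOrderOf_nsmul_eq_zero, smul_zero]⟩
    obtain ⟨N, ⟨m, rfl⟩, hn⟩ := hodd'
    rw [add_smul, mul_comm, mul_smul, two_smul, hz, smul_zero, zero_add, one_smul] at hn
    exact h0 hn
  have hσe : ∀ i, E₁.e (i + 1) = σ (E₁.e i) := by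
    intro i
    apply tr
    have hTH : E.T i ∉ G.H := by
      rw [G.mem_H, not_or, not_lt, E.xT]
      exact ⟨E.T_ne i, G.le i⟩
    have := (hred _ hTH).2
    rw [hT, E.xT, E.xT] at this
    exact this
  have hσx : ∀ z, z ≠ 0 → E₁.x (α' z) = σ (E₁.x z) := by
    intro z hz
    apply tr
    exact (hred _ (hΓ z hz)).2
  have hρ0 : ρ ≠ 0 := by
    intro h
    rw [h, addOrderOf_zero] at hoρ
    nlinarith
  have hαα : α' (α' ρ) = ρ := Subtype.ext D.h₃
  obtain ⟨b2, b4, b6, x, y, hns, hx, hy, hord⟩ := O.main σ α' hσe hσx ρ gen hαα hρ0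
  have hσq : ∀ z, σ (σ z) = z → z ^ q = z := by
    intro z hz
    rw [hσ, hσ, ← pow_mul, ← pow_add, ← two_mul, ← hq] at hz
    exact hz
  obtain ⟨W', w1, w3, P, hP⟩ := descend (p := p) hs hq hF W rfl rfl (hσq _ (by rw [b2, b2])) (hσq _ (by rw [b4, b4]))
    (hσq _ (by rw [b6, b6])) x y hns (hσq _ hx) (hσq _ hy)
  exact ⟨W', w1, w3, P, by rw [hP, hord, hoρ]⟩
end

theorem exists_point (p : ℕ) (hp : p.Prime) (hodd : Odd p) (s : ℕ) (hs : 0 < s) (q : ℕ) (hq : q = p ^ (2 * s))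
    (F : Type*) [Field F] [Fintype F] [DecidableEq F] (hF : Fintype.card F = q) :
    ∃ W : WeierstrassCurve.Affine F, W.a₁ = 0 ∧ W.a₃ = 0 ∧ ∃ P : W.Point, addOrderOf P = p ^ s * (p ^ s + 2) := by
  haveI : Fact p.Prime := ⟨hp⟩
  have hq03 : 3 ≤ p ^ s := by
    have h1 : 2 ≤ p := hp.two_le
    have h2 : p ≤ p ^ s := Nat.le_self_pow hs.ne' p
    rcases hodd with ⟨r, hr⟩
    omega
  obtain ⟨V, hV⟩ := exV (p ^ s) hq03
  refine (theCM (p ^ s) hq03 hodd.pow).point hodd hs hq ?_ V hV hF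
  change αC (p ^ s) ≠ 0
  intro h
  have := (αC_ind (p ^ s) hq03 (u := 0) (v := 1) (by simp [h])).2
  exact one_ne_zero this

end Part19

/-- For an odd prime `p`, `q = p^(2s)`, and a divisor `h ≥ 3` of
`q + 2p^s`, for all `1 ≤ t < m ≤ (q + 2p^s - h)/(2h) - 1`, there exist an optimal
`(2h-2, 3)`-LRC with parameters `[2hm, (2h-2)t + 1, 2h(m-t)]_q` and an optimal
`(2, 2h-1)`-LRC with parameters `[2hm, 2t + 1, 2h(m-t)]_q`. -/
theorem stmt_2 (p : ℕ) (hp : p.Prime) (hodd : Odd p)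
    (s : ℕ) (hs : 0 < s) (q : ℕ) (hq : q = p ^ (2 * s))
    (h : ℕ) (hh : 3 ≤ h) (hdvd : h ∣ q + 2 * p ^ s)
    (t m : ℕ) (ht : 1 ≤ t) (htm : t < m)
    (hm : (m : ℚ) ≤ ((q : ℚ) + 2 * (p : ℚ) ^ s - (h : ℚ)) / (2 * (h : ℚ)) - 1)
    (F : Type*) [Field F] [Fintype F] [DecidableEq F] (hF : Fintype.card F = q) :
    ExistsOptimalLRC F (2 * h * m) ((2 * h - 2) * t + 1) (2 * h * (m - t)) (2 * h - 2) 3 ∧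
    ExistsOptimalLRC F (2 * h * m) (2 * t + 1) (2 * h * (m - t)) 2 (2 * h - 1) := by
  exact stmt_from_point p hp hodd s hs q hq h hh hdvd t m ht htm hm F hF
    (exists_point p hp hodd s hs q hq F hF)
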